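/- (Framework Theorem.) Let k ≥ 2, 1 ≤ d ≤ k−1 and δ > 0. If δ has the (k,d)-Hamilton-framework property, then δ has the (k,d)-Hamilton-cycle property. (Consequently the tight Hamilton cycle threshold is at most the Hamilton framework threshold: hc_d(k) ≤ hf_d(k).) -/

import Mathlib

section
open Finset

variable {A : Type*} [DecidableEq A]

/-- The set of vertices occupying positions `i, …, i+k-1` of the walk `w`. -/
def walkEdgeAt (k : ℕ) (w : List A) (i : ℕ) : Finset A :=
  ((w.drop i).take k).toFinset

/-- `w` is a tight walk in the `k`-graph with edge set `E`: it has at least `k`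
vertices and every `k` consecutive vertices form an edge of `E`. -/
def IsTightWalk (k : ℕ) (E : Finset (Finset A)) (w : List A) : Prop :=
  k ≤ w.length ∧ ∀ i, i + k ≤ w.length → walkEdgeAt k w i ∈ E

/-- The edge `e` appears on the walk `w` (as `k` consecutive vertices). -/
def EdgeOnWalk (k : ℕ) (w : List A) (e : Finset A) : Prop :=
  ∃ i, i + k ≤ w.length ∧ walkEdgeAt k w i = e

/-- A `k`-uniform edge set is tightly connected if any two of its edges lie on a
common tight walk all of whose edges belong to it. -/
def TightlyConnected (k : ℕ) (E : Finset (Finset A)) : Prop :=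
  ∀ e₁ ∈ E, ∀ e₂ ∈ E, ∃ w : List A, IsTightWalk k E w ∧ EdgeOnWalk k w e₁ ∧ EdgeOnWalk k w e₂

/-- `w` is a closed tight walk: every cyclic interval of `k` consecutive vertices
forms an edge of `E`.  Its length is `w.length`. -/
def IsClosedTightWalk (k : ℕ) (E : Finset (Finset A)) (w : List A) : Prop :=
  k ≤ w.length ∧ ∀ i < w.length, ((w.rotate i).take k).toFinset ∈ E

/-- A tight Hamilton cycle: a cyclic ordering of all the vertices in which every `k`
cyclically consecutive vertices form an edge. -/
def HasTightHamCycle (k : ℕ) (V : Finset A) (E : Finset (Finset A)) : Prop :=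
  ∃ w : List A, w.Nodup ∧ w.toFinset = V ∧ IsClosedTightWalk k E w

/-- The `j`-th shadow: all `j`-element sets contained in some edge. -/
def shadow (j : ℕ) (E : Finset (Finset A)) : Finset (Finset A) :=
  E.biUnion fun e => e.powersetCard j

/-- The link graph of `S`: the `(k-d)`-graph whose edges are `e \ S` for edges `e ⊇ S`. -/
def link (S : Finset A) (E : Finset (Finset A)) : Finset (Finset A) :=
  (E.filter fun e => S ⊆ e).image fun e => e \ S

/-- `E` has a fractional matching of size at least `m`. -/
def HasFracMatching (E : Finset (Finset A)) (m : ℝ) : Prop :=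
  ∃ w : Finset A → ℝ,
    (∀ e ∈ E, 0 ≤ w e ∧ w e ≤ 1) ∧
    (∀ v : A, ∑ e ∈ E.filter (fun e' => v ∈ e'), w e ≤ 1) ∧
    m ≤ ∑ e ∈ E, w e

/-- `E` has a `b`-fractional matching of size at least `m` (vertex constraints on `V`). -/
def HasBFracMatching (V : Finset A) (E : Finset (Finset A)) (b : A → ℝ) (m : ℝ) : Prop :=
  ∃ w : Finset A → ℝ,
    (∀ e ∈ E, 0 ≤ w e ∧ w e ≤ 1) ∧
    (∀ v ∈ V, ∑ e ∈ E.filter (fun e' => v ∈ e'), w e ≤ b v) ∧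
    m ≤ ∑ e ∈ E, w e

/-- `γ`-robustly matchable: every vertex weighting with values in `[1-γ,1]` is realised
exactly by an edge weighting with values in `[0,1]`. -/
def RobustlyMatchable (γ : ℝ) (V : Finset A) (E : Finset (Finset A)) : Prop :=
  ∀ b : A → ℝ, (∀ v ∈ V, 1 - γ ≤ b v ∧ b v ≤ 1) →
    ∃ w : Finset A → ℝ, (∀ e ∈ E, 0 ≤ w e ∧ w e ≤ 1) ∧
      ∀ v ∈ V, ∑ e ∈ E.filter (fun e' => v ∈ e'), w e = b v

/-- A switcher: an edge `e` with a central vertex `a` such that for every `b ∈ e`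
there is `c ∉ e` with `(e ∪ {c}) \ {a}` and `(e ∪ {c}) \ {b}` both edges. -/
def HasSwitcher (C : Finset (Finset A)) : Prop :=
  ∃ e ∈ C, ∃ a ∈ e, ∀ b ∈ e, ∃ c, c ∉ e ∧
    insert c (e.erase a) ∈ C ∧ insert c (e.erase b) ∈ C

/-- An arc for the `d`-vicinity `C` of the `k`-graph with edge set `E`: a tuple of
`k+1` distinct vertices `v₁, …, v_{k+1}` with `{v₁,…,v_d} ∈ ∂_d`,
`{v_{d+1},…,v_k} ∈ C {v₁,…,v_d}`, `{v₂,…,v_{d+1}} ∈ ∂_d` and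
`{v_{d+2},…,v_{k+1}} ∈ C {v₂,…,v_{d+1}}`. -/
def HasArc (k d : ℕ) (E : Finset (Finset A)) (C : Finset A → Finset (Finset A)) : Prop :=
  ∃ l : List A, l.length = k + 1 ∧ l.Nodup ∧
    (l.take d).toFinset ∈ shadow d E ∧
    ((l.drop d).take (k - d)).toFinset ∈ C ((l.take d).toFinset) ∧
    ((l.drop 1).take d).toFinset ∈ shadow d E ∧
    (l.drop (d + 1)).toFinset ∈ C (((l.drop 1).take d).toFinset)

/-- The `k`-graph generated by a `d`-vicinity: all sets `B ∪ S` with `S ∈ ∂_d(E)`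
and `B ∈ C S`. -/
def generatedEdges (d : ℕ) (E : Finset (Finset A)) (C : Finset A → Finset (Finset A)) :
    Finset (Finset A) :=
  (shadow d E).biUnion fun S => (C S).image fun B => B ∪ S

/-- `α`-perturbed minimum relative `d`-degree at least `δ` for a `k`-graph on vertex
set `V` with edge set `E`. -/
def PerturbedDegLB (k d : ℕ) (a δ : ℝ) (V : Finset A) (E : Finset (Finset A)) : Prop :=
  ∀ j : ℕ, 1 ≤ j → j ≤ d →
    (∀ S ∈ shadow j E,
      δ * (((V.card - j).choose (k - j) : ℕ) : ℝ) ≤ ((E.filter fun e => S ⊆ e).card : ℝ)) ∧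
    ((((V.powersetCard j).filter fun S => S ∉ shadow j E).card : ℝ)
        ≤ a * ((V.card.choose j : ℕ) : ℝ)) ∧
    (∀ T : Finset A, (T ∈ shadow (j - 1) E ∨ (j = 1 ∧ T = ∅)) →
      ((((V.powersetCard j).filter fun S => T ⊆ S ∧ S ∉ shadow j E).card : ℝ)
        < a * ((V.card : ℝ) - (j : ℝ) + 1)))

/-- A `(γ, δ)`-Hamilton `d`-vicinity of a `k`-graph on `t = V.card` vertices. -/
def IsHamVicinity (k d : ℕ) (γ δ : ℝ) (V : Finset A) (E : Finset (Finset A))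
    (C : Finset A → Finset (Finset A)) : Prop :=
  (∀ S ∈ shadow d E, C S ⊆ link S E) ∧
  (∀ S ∈ shadow d E, TightlyConnected (k - d) (C S)) ∧
  (∀ S ∈ shadow d E, ∀ S' ∈ shadow d E, (C S ∩ C S').Nonempty) ∧
  (∀ S ∈ shadow d E, HasSwitcher (C S)) ∧
  HasArc k d E C ∧
  (∀ S ∈ shadow d E, HasFracMatching (C S) ((1 / (k : ℝ) + γ) * (V.card : ℝ))) ∧
  (∀ S ∈ shadow d E, (1 - δ + γ) * ((V.card.choose (k - d) : ℕ) : ℝ) ≤ ((C S).card : ℝ))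

/-- An `(a, γ, δ)`-Hamilton framework: a subgraph on vertex set `VH` with edge set `EH`
of a `k`-graph on vertex set `VR`, satisfying (F1)–(F5). -/
def IsHamFramework (k : ℕ) (a γ δ : ℝ) (VR VH : Finset A) (EH : Finset (Finset A)) : Prop :=
  (1 - a) * (VR.card : ℝ) ≤ (VH.card : ℝ) ∧
  TightlyConnected k EH ∧
  (∃ w : List A, IsClosedTightWalk k EH w ∧ w.length % k = 1 % k) ∧
  RobustlyMatchable γ VH EH ∧
  (∀ v ∈ VH, (1 - δ + γ) * (((VH.card - 1).choose (k - 1) : ℕ) : ℝ)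
      ≤ ((EH.filter fun e => v ∈ e).card : ℝ))

/-- A tight component: an edge-maximal tightly connected subgraph. -/
def IsTightComponent (k : ℕ) (E C : Finset (Finset A)) : Prop :=
  C ⊆ E ∧ TightlyConnected k C ∧
    ∀ C' : Finset (Finset A), C ⊆ C' → C' ⊆ E → TightlyConnected k C' → C' = C

/-- `δ` has the `(k,d)`-Hamilton-cycle property. -/
def HamCycleProp (k d : ℕ) (δ : ℝ) : Prop :=
  ∀ μ : ℝ, 0 < μ → ∃ n₀ : ℕ, ∀ (B : Type) [DecidableEq B],
    ∀ (V : Finset B) (E : Finset (Finset B)),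
      n₀ ≤ V.card → (∀ e ∈ E, e ⊆ V ∧ e.card = k) →
      (∀ S ⊆ V, S.card = d →
        (δ + μ) * (((V.card - d).choose (k - d) : ℕ) : ℝ)
          ≤ ((E.filter fun e => S ⊆ e).card : ℝ)) →
      HasTightHamCycle k V E

/-- `δ` has the `(k,d)`-Hamilton-framework property. -/
def HamFrameworkProp (k d : ℕ) (δ : ℝ) : Prop :=
  ∀ μ : ℝ, 0 < μ → ∃ γ₀ : ℝ, 0 < γ₀ ∧ ∀ γ : ℝ, 0 < γ → γ ≤ γ₀ →
    ∃ α₀ : ℝ, 0 < α₀ ∧ ∀ a : ℝ, 0 < a → a ≤ α₀ →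
      ∃ ε₀ : ℝ, 0 < ε₀ ∧ ∀ ε : ℝ, 0 < ε → ε ≤ ε₀ →
        ∃ t₀ : ℕ, ∀ t : ℕ, t₀ ≤ t →
          ∀ (B : Type) [DecidableEq B], ∀ (VR : Finset B) (ER : Finset (Finset B)),
            VR.card = t → (∀ e ∈ ER, e ⊆ VR ∧ e.card = k) →
            (∀ S ⊆ VR, S.card = d →
              (δ + μ) * (((t - d).choose (k - d) : ℕ) : ℝ)
                ≤ ((ER.filter fun e => S ⊆ e).card : ℝ)) →
            ∀ I : Finset (Finset B), I ⊆ ER → (I.card : ℝ) ≤ ε * ((t.choose k : ℕ) : ℝ) →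
              ∃ (VH : Finset B) (EH : Finset (Finset B)),
                VH ⊆ VR ∧ EH ⊆ ER ∧ (∀ e ∈ EH, e ⊆ VH) ∧ (∀ e ∈ EH, e ∉ I) ∧
                IsHamFramework k a γ δ VR VH EH

/-- `δ` has the `(k,d)`-Hamilton-vicinity property. -/
def HamVicinityProp (k d : ℕ) (δ : ℝ) : Prop :=
  ∀ μ : ℝ, 0 < μ → ∃ γ₀ : ℝ, 0 < γ₀ ∧ ∀ γ : ℝ, 0 < γ → γ ≤ γ₀ →
    ∃ α₀ : ℝ, 0 < α₀ ∧ ∀ a : ℝ, 0 < a → a ≤ α₀ →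
      ∃ t₀ : ℕ, ∀ t : ℕ, t₀ ≤ t →
        ∀ (B : Type) [DecidableEq B], ∀ (V : Finset B) (E : Finset (Finset B)),
          V.card = t → (∀ e ∈ E, e ⊆ V ∧ e.card = k) →
          PerturbedDegLB k d a (δ + μ) V E →
          (∀ v ∈ V, ∃ e ∈ E, v ∈ e) →
          ∃ C : Finset B → Finset (Finset B), IsHamVicinity k d γ δ V E C
end

set_option linter.all false

noncomputable section
open Classical in
def ind (p : Prop) : ℝ := if p then 1 else 0

def ex {α : Type*} [Fintype α] (f : α → ℝ) : ℝ := (∑ x, f x) / (Fintype.card α : ℝ)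

def pr {α : Type*} [Fintype α] (P : α → Prop) : ℝ := ex (fun x => ind (P x))
end

lemma ind_nonneg (p : Prop) : 0 ≤ ind p := by unfold ind; split_ifs <;> norm_num
lemma ind_le_one (p : Prop) : ind p ≤ 1 := by unfold ind; split_ifs <;> norm_num
lemma ind_true {p : Prop} (h : p) : ind p = 1 := by simp [ind, h]
lemma ind_false {p : Prop} (h : ¬ p) : ind p = 0 := by simp [ind, h]
lemma ind_mono {p q : Prop} (h : p → q) : ind p ≤ ind q := by
  unfold ind; split_ifs <;> first | tauto | norm_num

section
variable {α β γ : Type*} [Fintype α] [Fintype β] [Fintype γ]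

lemma ex_mono {f g : α → ℝ} (h : ∀ x, f x ≤ g x) : ex f ≤ ex g := by
  unfold ex; gcongr; exact h _

lemma ex_nonneg {f : α → ℝ} (h : ∀ x, 0 ≤ f x) : 0 ≤ ex f :=
  div_nonneg (Finset.sum_nonneg fun x _ => h x) (Nat.cast_nonneg _)

lemma ex_add (f g : α → ℝ) : ex (fun x => f x + g x) = ex f + ex g := by
  unfold ex; rw [Finset.sum_add_distrib, add_div]

lemma ex_sub (f g : α → ℝ) : ex (fun x => f x - g x) = ex f - ex g := by
  unfold ex; rw [Finset.sum_sub_distrib, sub_div]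

lemma ex_mul (c : ℝ) (f : α → ℝ) : ex (fun x => c * f x) = c * ex f := by
  unfold ex; rw [← Finset.mul_sum, mul_div_assoc]

lemma ex_sum {ι : Type*} (s : Finset ι) (f : ι → α → ℝ) :
    ex (fun x => ∑ i ∈ s, f i x) = ∑ i ∈ s, ex (f i) := by
  unfold ex; rw [Finset.sum_comm, Finset.sum_div]

lemma ex_const [Nonempty α] (c : ℝ) : ex (fun _ : α => c) = c := by
  unfold ex; simp

lemma ex_const_le (c : ℝ) (hc : 0 ≤ c) : ex (fun _ : α => c) ≤ c := by
  rcases isEmpty_or_nonempty α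
  · unfold ex; simpa using hc
  · rw [ex_const]

lemma ex_prod (f : α × β → ℝ) : ex f = ex (fun a => ex (fun b => f (a, b))) := by
  unfold ex
  rw [Fintype.sum_prod_type, ← Finset.sum_div, div_div, Fintype.card_prod]
  push_cast; rw [mul_comm]

lemma ex_equiv (e : α ≃ β) (f : β → ℝ) : ex (fun a => f (e a)) = ex f := by
  unfold ex; rw [Equiv.sum_comp e f, Fintype.card_congr e]

lemma pr_nonneg (P : α → Prop) : 0 ≤ pr P := ex_nonneg fun _ => ind_nonneg _
lemma pr_le_one (P : α → Prop) : pr P ≤ 1 :=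
  (ex_mono fun _ => ind_le_one _).trans (ex_const_le 1 zero_le_one)
lemma pr_mono {P Q : α → Prop} (h : ∀ x, P x → Q x) : pr P ≤ pr Q := ex_mono fun x => ind_mono (h x)
lemma pr_true [Nonempty α] {P : α → Prop} (h : ∀ x, P x) : pr P = 1 := by
  unfold pr; rw [← ex_const (α := α) 1]; congr 1; ext x; exact ind_true (h x)
lemma pr_false {P : α → Prop} (h : ∀ x, ¬ P x) : pr P = 0 := by
  unfold pr ex; rw [Finset.sum_eq_zero]; simp
  intro x _; exact ind_false (h x)
lemma pr_congr {P Q : α → Prop} (h : ∀ x, P x ↔ Q x) : pr P = pr Q :=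
  le_antisymm (pr_mono fun x => (h x).1) (pr_mono fun x => (h x).2)

lemma pr_or {P Q R : α → Prop} (h : ∀ x, P x → Q x ∨ R x) : pr P ≤ pr Q + pr R := by
  unfold pr; rw [← ex_add]; refine ex_mono fun x => ?_
  by_cases hp : P x
  · rcases h x hp with hq | hr
    · rw [ind_true hp, ind_true hq]; linarith [ind_nonneg (R x)]
    · rw [ind_true hp, ind_true hr]; linarith [ind_nonneg (Q x)]
  · rw [ind_false hp]; linarith [ind_nonneg (R x), ind_nonneg (Q x)]

lemma pr_exists {ι : Type*} [Fintype ι] {P : α → Prop} {Q : ι → α → Prop}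
    (h : ∀ x, P x → ∃ i, Q i x) : pr P ≤ ∑ i, pr (Q i) := by
  unfold pr; rw [← ex_sum]; refine ex_mono fun x => ?_
  by_cases hp : P x
  · obtain ⟨i, hi⟩ := h x hp
    rw [ind_true hp, ← ind_true hi]
    exact Finset.single_le_sum (f := fun i => ind (Q i x)) (fun _ _ => ind_nonneg _) (Finset.mem_univ i)
  · rw [ind_false hp]; exact Finset.sum_nonneg fun _ _ => ind_nonneg _

lemma pr_pos {P : α → Prop} (h : 0 < pr P) : ∃ x, P x := by
  by_contra hc; push Not at hc; rw [pr_false hc] at h; exact lt_irrefl _ h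

lemma pr_not [Nonempty α] (P : α → Prop) : pr (fun x => ¬ P x) = 1 - pr P := by
  unfold pr; rw [← ex_const (α := α) 1, ← ex_sub]; congr 1; ext x
  by_cases h : P x <;> simp [ind, h]

lemma pr_equiv (e : α ≃ β) (P : β → Prop) : pr (fun a => P (e a)) = pr P :=
  ex_equiv e (fun b => ind (P b))

lemma pr_prod (P : α × β → Prop) : pr P = ex (fun a => pr (fun b => P (a, b))) := ex_prod _

lemma pr_swap (P : α × β → Prop) : pr P = pr (fun p : β × α => P (p.2, p.1)) :=
  (pr_equiv (Equiv.prodComm β α) P).symm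

lemma pr_prod_ge {c : ℝ} {P : α × β → Prop} {Q : α → Prop}
    (h : ∀ a, Q a → c ≤ pr (fun b => P (a, b))) : c * pr Q ≤ pr P := by
  rw [pr_prod, pr, ← ex_mul]; refine ex_mono fun a => ?_
  by_cases hq : Q a
  · rw [ind_true hq, mul_one]; exact h a hq
  · rw [ind_false hq, mul_zero]; exact pr_nonneg _

lemma pr_prod_le {c : ℝ} (hc : 0 ≤ c) {P : α × β → Prop}
    (h : ∀ a, pr (fun b => P (a, b)) ≤ c) : pr P ≤ c := by
  rw [pr_prod]; exact (ex_mono h).trans (ex_const_le c hc)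

lemma rmarkov {d : ℝ} (hd : 0 ≤ d) {P : α × β → Prop} (h : d ≤ pr P) :
    d / 2 ≤ pr (fun a => d / 2 ≤ pr (fun b => P (a, b))) := by
  have : pr P ≤ pr (fun a => d / 2 ≤ pr (fun b => P (a, b))) + d / 2 := by
    refine le_trans ?_ (add_le_add_right (ex_const_le (α := α) (d / 2) (by linarith)) _)
    rw [pr_prod]; conv_rhs => rw [pr, ← ex_add]
    refine ex_mono fun a => ?_
    by_cases hq : d / 2 ≤ pr (fun b => P (a, b))
    · rw [ind_true hq]; linarith [pr_le_one (fun b => P (a, b))]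
    · rw [ind_false hq]; linarith
  linarith

lemma markov {t : ℝ} {P : α × β → Prop} : t * pr (fun a => t ≤ pr (fun b => P (a, b))) ≤ pr P :=
  pr_prod_ge fun _ h => h

lemma pr_fst [Nonempty β] (P : α → Prop) : pr (fun p : α × β => P p.1) = pr P := by
  rw [pr_prod]; unfold pr; congr 1; ext a; exact ex_const (α := β) (ind (P a))

lemma pr_snd [Nonempty α] (P : β → Prop) : pr (fun p : α × β => P p.2) = pr P := by
  rw [pr_swap]; exact pr_fst P

lemma pr_card (P : α → Prop) [DecidablePred P] :
    pr P = ((Finset.univ.filter P).card : ℝ) / Fintype.card α := by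
  unfold pr ex ind; congr 1; rw [Finset.card_filter]; push_cast
  exact Finset.sum_congr rfl fun x _ => by congr

lemma pr_cons {n : ℕ} (P : (Fin (n+1) → α) → Prop) :
    pr P = pr (fun p : α × (Fin n → α) => P (Fin.cons p.1 p.2)) :=
  (pr_equiv (Fin.consEquiv (fun _ : Fin (n+1) => α)) P).symm

end

def updInv {k : ℕ} {V : Type*} (i : Fin k) : ((Fin k → V) × V) ≃ ((Fin k → V) × V) where
  toFun p := (Function.update p.1 i p.2, p.1 i)
  invFun p := (Function.update p.1 i p.2, p.1 i)
  left_inv p := by simp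
  right_inv p := by simp

lemma pr_upd {k : ℕ} {V : Type*} [Fintype V] (i : Fin k) (P : (Fin k → V) × V → Prop) :
    pr (fun p : (Fin k → V) × V => P (Function.update p.1 i p.2, p.1 i)) = pr P :=
  pr_equiv (updInv i) P

def mix {k : ℕ} {α : Type*} (s : Fin k → Bool) (x y : Fin k → α) : Fin k → α :=
  fun i => if s i then y i else x i

lemma double (k : ℕ) : ∀ d : ℝ, 0 < d → ∃ c : ℝ, 0 < c ∧ ∀ (α : Type) [Fintype α]
    (S : (Fin k → α) → Prop), d ≤ pr S →
      c ≤ pr (fun p : (Fin k → α) × (Fin k → α) => ∀ s, S (mix s p.1 p.2)) := by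
  induction k with
  | zero =>
    intro d hd
    refine ⟨1, one_pos, fun α _ S h => ?_⟩
    obtain ⟨x, hx⟩ := pr_pos (hd.trans_le h)
    rw [pr_true]
    intro p s
    rwa [Subsingleton.elim (mix s p.1 p.2) x]
  | succ k ih =>
    intro d hd
    set d1 : ℝ := (d / 2) * (d / 2) * (d / 2) with hd1
    have h1 : 0 < d1 := by positivity
    obtain ⟨c, hc, H⟩ := ih (d1 / 2) (by linarith)
    refine ⟨c * (d1 / 2), by positivity, fun α _ S h => ?_⟩
    have e1 : d1 ≤ pr (fun p : (α × α) × (Fin k → α) => S (Fin.cons p.1.1 p.2) ∧ S (Fin.cons p.1.2 p.2)) := by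
      rw [pr_cons, pr_swap] at h
      have h2 := rmarkov hd.le h
      rw [pr_swap]
      refine le_trans ?_ (pr_prod_ge (c := d/2 * (d/2))
        (Q := fun t : Fin k → α => d / 2 ≤ pr (fun a => S (Fin.cons a t))) ?_)
      · rw [hd1]; exact mul_le_mul_of_nonneg_left h2 (by positivity)
      · intro t ht
        refine le_trans (mul_le_mul_of_nonneg_left ht (by positivity)) (pr_prod_ge fun a ha => ?_)
        refine ht.trans (pr_mono fun b hb => ⟨ha, hb⟩)
    have e2 := rmarkov h1.le e1
    have e3 := pr_prod_ge (c := c) (P := fun p : (α × α) × ((Fin k → α) × (Fin k → α)) =>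
      ∀ s, S (Fin.cons p.1.1 (mix s p.2.1 p.2.2)) ∧ S (Fin.cons p.1.2 (mix s p.2.1 p.2.2)))
      fun a ha => H α (fun t => S (Fin.cons a.1 t) ∧ S (Fin.cons a.2 t)) ha
    refine (mul_le_mul_of_nonneg_left e2 hc.le).trans (e3.trans ?_)
    let e : ((α × α) × ((Fin k → α) × (Fin k → α))) ≃ ((Fin (k+1) → α) × (Fin (k+1) → α)) :=
      (Equiv.prodProdProdComm α α _ _).trans
        (Equiv.prodCongr (Fin.consEquiv (fun _ => α)) (Fin.consEquiv (fun _ => α)))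
    rw [← pr_equiv e]
    refine pr_mono fun p hp s => ?_
    have : mix s (e p).1 (e p).2 = Fin.cons (if s 0 then p.1.2 else p.1.1)
        (mix (fun i => s i.succ) p.2.1 p.2.2) := by
      ext i; refine Fin.cases ?_ (fun i => ?_) i
      · simp [mix, e, Fin.consEquiv]
      · simp [mix, e, Fin.consEquiv]
    rw [this]
    have := hp (fun i => s i.succ)
    split_ifs
    · exact this.2
    · exact this.1

section tight
variable {V : Type} [DecidableEq V]

def Tight (E : Finset (Finset V)) (k : ℕ) (l : List V) : Prop :=
  ∀ s, s <:+: l → s.length = k → s.toFinset ∈ E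

def ed (E : Finset (Finset V)) {k : ℕ} (x : Fin k → V) : Prop := Finset.univ.image x ∈ E

lemma Tight.infix {E : Finset (Finset V)} {k : ℕ} {l l' : List V} (h : Tight E k l) (h' : l' <:+: l) :
    Tight E k l' := fun s hs => h s (hs.trans h')

lemma Tight.short {E : Finset (Finset V)} {k : ℕ} {l : List V} (h : l.length < k) : Tight E k l :=
  fun s hs hk => absurd hs.length_le (by omega)

lemma Tight.glue {E : Finset (Finset V)} {r : ℕ} {p s w : List V} (hs : r ≤ s.length)
    (h1 : Tight E (r+1) (p ++ s)) (h2 : Tight E (r+1) (s ++ w)) : Tight E (r+1) (p ++ s ++ w) := by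
  rintro t ⟨a, b, h⟩ ht
  by_cases hl : p.length ≤ a.length
  · have hp : p <+: a := by
      refine List.prefix_of_prefix_length_le (l₃ := p ++ s ++ w) ?_ ?_ hl
      · rw [List.append_assoc]; exact List.prefix_append _ _
      · rw [← h, List.append_assoc]; exact List.prefix_append _ _
    obtain ⟨a', rfl⟩ := hp
    refine h2 t ⟨a', b, ?_⟩ ht
    have : p ++ (a' ++ t ++ b) = p ++ (s ++ w) := by simpa [List.append_assoc] using h
    exact List.append_cancel_left this
  · have : a ++ t <+: p ++ s := by
      refine List.prefix_of_prefix_length_le (l₃ := p ++ s ++ w) ?_ (List.prefix_append _ _) ?_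
      · rw [← h]; exact List.prefix_append _ _
      · simp; omega
    obtain ⟨b', hb⟩ := this
    exact h1 t ⟨a, b', hb⟩ ht

lemma tight_pair {E : Finset (Finset V)} {k : ℕ} {x y : Fin k → V}
    (h : ∀ s : Fin k → Bool, ed E (mix s x y)) : Tight E k (List.ofFn x ++ List.ofFn y) := by
  rintro t ⟨a, b, hab⟩ ht
  have hlen := congrArg List.length hab
  simp at hlen
  have : t.toFinset = Finset.univ.image (mix (fun j : Fin k => decide (j.1 < a.length)) x y) := by
    have key : ∀ (j : ℕ) (hj : j < t.length), t[j]? = (List.ofFn x ++ List.ofFn y)[a.length + j]? := by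
      intro j hj
      rw [← hab, List.getElem?_append_left (by simp; omega), List.getElem?_append_right (by omega)]
      simp
    ext v
    simp only [List.mem_toFinset, Finset.mem_image, Finset.mem_univ, true_and]
    constructor
    · intro hv
      obtain ⟨j, hj, rfl⟩ := List.getElem_of_mem hv
      have kj := key j hj
      rw [List.getElem?_eq_getElem hj] at kj
      by_cases hc : a.length + j < k
      · refine ⟨⟨a.length + j, hc⟩, ?_⟩
        rw [List.getElem?_append_left (by simpa using hc)] at kj
        simp [hc] at kj
        simp [mix, kj]
      · refine ⟨⟨a.length + j - k, by omega⟩, ?_⟩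
        rw [List.getElem?_append_right (by simp; omega)] at kj
        simp at kj
        obtain ⟨h', kj⟩ := kj
        have : a.length + j - k < a.length := by omega
        simp [mix, this]; exact kj.symm
    · rintro ⟨⟨j, hj⟩, rfl⟩
      by_cases hc : j < a.length
      · have kj := key (j + k - a.length) (by omega)
        rw [List.getElem?_append_right (by simp; omega)] at kj
        have e : a.length + (j + k - a.length) - (List.ofFn x).length = j := by simp; omega
        rw [e] at kj
        simp [hj] at kj
        simp [mix, hc]; exact List.mem_of_getElem? kj
      · have kj := key (j - a.length) (by omega)
        rw [List.getElem?_append_left (by simp; omega)] at kj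
        have e : a.length + (j - a.length) = j := by omega
        rw [e] at kj
        simp [hj] at kj
        simp [mix, hc]; exact List.mem_of_getElem? kj
  rw [this]; exact h _

lemma Tight.closed {E : Finset (Finset V)} {r : ℕ} {l : List V} (hl : r + 1 ≤ l.length)
    (h : Tight E (r+1) (l ++ l.take r)) : IsClosedTightWalk (r+1) E l := by
  refine ⟨hl, fun i hi => ?_⟩
  have e : (l.rotate i).take (r+1) = ((l ++ l.take r).drop i).take (r+1) := by
    rw [List.rotate_eq_drop_append_take hi.le, List.drop_append_of_le_length hi.le,
      List.take_append, List.take_append, List.take_take, List.take_take, List.length_drop]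
    congr 2; omega
  rw [e]
  refine h _ ((List.take_prefix _ _).isInfix.trans (List.drop_suffix _ _).isInfix) ?_
  simp; omega

/-- last `r` entries -/
def lastR (r : ℕ) (l : List V) : List V := l.drop (l.length - r)

def nextP {ι : Type} (P : ι → List V) (z : List V) : List ι → List V
  | [] => z
  | i :: _ => P i

def Good {ι : Type} (E : Finset (Finset V)) (r : ℕ) (P c : ι → List V) (z : List V) : List ι → Prop
  | [] => True
  | i :: L => Tight E (r+1) (P i) ∧ r ≤ (P i).length ∧
      Tight E (r+1) (lastR r (P i) ++ c i ++ (nextP P z L).take r) ∧ Good E r P c z L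

lemma Good.tight {ι : Type} {E : Finset (Finset V)} {r : ℕ} {P c : ι → List V} {z : List V}
    (hz : r ≤ z.length) : ∀ (L : List ι), Good E r P c z L →
    Tight E (r+1) (L.flatMap (fun i => P i ++ c i) ++ z.take r) ∧
      ∃ t, L.flatMap (fun i => P i ++ c i) ++ z.take r = (nextP P z L).take r ++ t ∧
        r ≤ (nextP P z L).length
  | [], _ => ⟨Tight.short (by simp), [], by simp [nextP], hz⟩
  | i :: L, ⟨h1, h2, h3, h4⟩ => by
    obtain ⟨a, t, ht, hlen⟩ := Good.tight hz L h4
    constructor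
    · rw [List.flatMap_cons, List.append_assoc, ht]
      rw [ht] at a
      have e1 : P i = (P i).take ((P i).length - r) ++ lastR r (P i) := (List.take_append_drop _ _).symm
      have g1 : Tight E (r+1) (P i ++ (c i ++ (nextP P z L).take r)) := by
        rw [e1]; apply Tight.glue
        · simp [lastR]; omega
        · rwa [← e1]
        · rwa [← List.append_assoc]
      have g2 := Tight.glue (p := P i ++ c i) (s := (nextP P z L).take r) (w := t) (r := r) (E := E)
        (by simp; omega) (by rwa [List.append_assoc]) a
      rwa [List.append_assoc (P i ++ c i)] at g2
    · refine ⟨(P i).drop r ++ c i ++ (L.flatMap (fun i => P i ++ c i) ++ z.take r), ?_, h2⟩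
      simp only [nextP, List.flatMap_cons, List.append_assoc]
      rw [← List.append_assoc (List.take r _), List.take_append_drop]

lemma Good.congr {ι : Type} {E : Finset (Finset V)} {r : ℕ} {P P' c : ι → List V} {z z' : List V}
    (hz : z'.take r = z.take r) (h : ∀ i, Tight E (r+1) (P' i) ∧ r ≤ (P' i).length ∧
      (P' i).take r = (P i).take r ∧ lastR r (P' i) = lastR r (P i)) :
    ∀ L : List ι, Good E r P c z L → Good E r P' c z' L
  | [], _ => trivial
  | i :: L, ⟨_, _, h3, h4⟩ => by
    refine ⟨(h i).1, (h i).2.1, ?_, Good.congr hz h L h4⟩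
    have : (nextP P' z' L).take r = (nextP P z L).take r := by
      cases L with
      | nil => exact hz
      | cons j L => exact (h j).2.2.1
    rw [this, (h i).2.2.2]; exact h3

end tight

section chain
variable {X : Type}

def Ch (D : X → X → Prop) : X → List X → X → Prop
  | x, [], y => D x y
  | x, z :: l, y => D x z ∧ Ch D z l y

def PrefCh (D : X → X → Prop) (x : X) (l : List X) (y : X) : Prop := ∃ j, Ch D x (l.take j) y

def DD {V : Type} [DecidableEq V] (E : Finset (Finset V)) {k : ℕ} (x y : Fin k → V) : Prop :=
  ∀ s, ed E (mix s x y)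

lemma Ch.tight {V : Type} [DecidableEq V] {E : Finset (Finset V)} {r : ℕ} {y : Fin (r+1) → V} :
    ∀ (l : List (Fin (r+1) → V)) (x : Fin (r+1) → V), Ch (DD E) x l y →
      Tight E (r+1) (List.ofFn x ++ l.flatMap List.ofFn ++ List.ofFn y)
  | [], x, h => by simpa using tight_pair h
  | z :: l, x, ⟨h1, h2⟩ => by
    have := Tight.glue (r := r) (by simp) (tight_pair h1) (by
      have := Ch.tight l z h2; rw [List.append_assoc] at this; exact this)
    simpa only [List.flatMap_cons, List.append_assoc] using this
end chain

lemma classes {X : Type} [Fintype X] (D : X → X → Prop) (ε : ℝ) (hε : 0 < ε) :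
    ∃ f : X → Option X, pr (fun p : X × X => D p.1 p.2 ∧ f p.1 ≠ f p.2) ≤ ε ∧
      ∀ (z : Option X) (A : X → Prop),
        ε * pr (fun p : X × X => f p.1 = z ∧ f p.2 = z ∧ ¬ (A p.1 ↔ A p.2)) ≤
          pr (fun p : X × X => D p.1 p.2 ∧ f p.1 = z ∧ f p.2 = z ∧ ¬ (A p.1 ↔ A p.2)) := by
  classical
  let Φ : (X → Option X) → ℝ := fun f =>
    pr (fun p : X × X => D p.1 p.2 ∧ f p.1 ≠ f p.2) + ε * pr (fun p : X × X => f p.1 = f p.2)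
  obtain ⟨f, hf⟩ := Finite.exists_min Φ
  refine ⟨f, ?_, fun z A => ?_⟩
  · have h1 := hf (fun _ => none)
    have h2 : Φ (fun _ => none) ≤ ε := by
      simp only [Φ]; rw [pr_false (by simp), zero_add]
      exact mul_le_of_le_one_right hε.le (pr_le_one _)
    have h3 : pr (fun p : X × X => D p.1 p.2 ∧ f p.1 ≠ f p.2) ≤ Φ f :=
      le_add_of_nonneg_right (mul_nonneg hε.le (pr_nonneg _))
    linarith
  · obtain ⟨w, hw⟩ : ∃ w, ∀ x, f x ≠ w := by
      by_contra hc; push Not at hc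
      have := Fintype.card_le_of_surjective f hc
      simp at this
    let g : X → Option X := fun x => if f x = z ∧ A x then w else f x
    have h1 := hf g
    simp only [Φ] at h1
    have e1 : pr (fun p : X × X => D p.1 p.2 ∧ g p.1 ≠ g p.2) ≤
        pr (fun p : X × X => D p.1 p.2 ∧ f p.1 ≠ f p.2) +
        pr (fun p : X × X => D p.1 p.2 ∧ f p.1 = z ∧ f p.2 = z ∧ ¬ (A p.1 ↔ A p.2)) := by
      refine pr_or fun p hp => ?_
      by_cases h : f p.1 = f p.2
      · right
        refine ⟨hp.1, ?_⟩
        have := hp.2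
        simp only [g] at this
        split_ifs at this <;> simp_all
      · exact Or.inl ⟨hp.1, h⟩
    have e2 : pr (fun p : X × X => g p.1 = g p.2) +
        pr (fun p : X × X => f p.1 = z ∧ f p.2 = z ∧ ¬ (A p.1 ↔ A p.2)) ≤
        pr (fun p : X × X => f p.1 = f p.2) := by
      unfold pr; rw [← ex_add]; refine ex_mono fun p => ?_
      by_cases h : f p.1 = z ∧ f p.2 = z ∧ ¬ (A p.1 ↔ A p.2)
      · have hg : ¬ g p.1 = g p.2 := by
          obtain ⟨h1, h2, h3⟩ := h
          have := hw p.1; have := hw p.2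
          simp only [g]; split_ifs <;> grind
        rw [ind_true h, ind_false hg, ind_true (h.1.trans h.2.1.symm)]; norm_num
      · rw [ind_false h, add_zero]; apply ind_mono
        intro hg
        have := hw p.1; have := hw p.2
        simp only [g] at hg; split_ifs at hg <;> grind
    nlinarith

section connect

lemma grow_step {X : Type} [Fintype X] {D : X → X → Prop} {i : ℕ} {Λ t : ℝ} (hΛ : 0 ≤ Λ) {x x0 : X}
    (h : t ≤ pr (fun y => D x y ∧ ∃ j ≤ i, Λ ≤ pr (fun ω : Fin j → X => Ch D y (List.ofFn ω) x0))) :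
    ∃ j ≤ i + 1, Λ * (t / (i + 1)) ≤ pr (fun ω : Fin j → X => Ch D x (List.ofFn ω) x0) := by
  have h1 : t ≤ ∑ j : Fin (i+1), pr (fun y => D x y ∧ Λ ≤ pr (fun ω : Fin j → X => Ch D y (List.ofFn ω) x0)) :=
    h.trans (pr_exists fun y ⟨hy, j, hj, hh⟩ => ⟨⟨j, by omega⟩, hy, hh⟩)
  obtain ⟨j, -, hj⟩ : ∃ j ∈ (Finset.univ : Finset (Fin (i+1))), t / (i + 1) ≤
      pr (fun y => D x y ∧ Λ ≤ pr (fun ω : Fin j → X => Ch D y (List.ofFn ω) x0)) := by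
    apply Finset.exists_le_of_sum_le Finset.univ_nonempty
    refine le_trans (le_of_eq ?_) h1
    simp; field_simp
  refine ⟨j + 1, by omega, ?_⟩
  rw [pr_cons]
  refine (mul_le_mul_of_nonneg_left hj hΛ).trans (pr_prod_ge fun y hy => ?_)
  refine hy.2.trans (pr_mono fun ω hω => ?_)
  simp only [List.ofFn_succ, Fin.cons_zero, Fin.cons_succ]
  exact ⟨hy.1, hω⟩

lemma connect (ε c : ℝ) (hε : 0 < ε) (hε1 : ε ≤ 1) (hc : 0 < c) (hc1 : c ≤ 1) :
    ∃ (J : ℕ) (l : ℝ), 0 < l ∧ ∀ (X : Type) [Fintype X] (D : X → X → Prop)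
      (_ : ∀ x y, D x y → D y x) (f : X → Option X)
      (_ : ∀ (z : Option X) (A : X → Prop),
        ε * pr (fun p : X × X => f p.1 = z ∧ f p.2 = z ∧ ¬ (A p.1 ↔ A p.2)) ≤
          pr (fun p : X × X => D p.1 p.2 ∧ f p.1 = z ∧ f p.2 = z ∧ ¬ (A p.1 ↔ A p.2)))
      (x x0 : X), f x = f x0 → c ≤ pr (fun y => D x y ∧ f y = f x) →
        c ≤ pr (fun y => D x0 y ∧ f y = f x0) →
        ∃ j ≤ J, l ≤ pr (fun ω : Fin j → X => Ch D x (List.ofFn ω) x0) := by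
  set lam : ℝ := ε * c / 4 with hlam
  have hl0 : 0 < lam := by positivity
  have hl1 : lam ≤ c / 2 := by rw [hlam]; nlinarith
  let Λ : ℕ → ℝ := fun i => Nat.rec 1 (fun i a => a * (lam / (i + 1))) i
  have Λs : ∀ i, Λ (i+1) = Λ i * (lam / (i + 1)) := fun i => rfl
  have Λpos : ∀ i, 0 < Λ i := by
    intro i; induction i with
    | zero => exact one_pos
    | succ i ih => rw [Λs]; positivity
  have Λmono : ∀ i, Λ (i+1) ≤ Λ i := by
    intro i; rw [Λs]; apply mul_le_of_le_one_right (Λpos i).le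
    rw [div_le_one (by positivity)]; have : (0:ℝ) ≤ i := by positivity
    linarith
  obtain ⟨N, hN⟩ := exists_pow_lt_of_lt_one (show 0 < c / 2 by linarith) (show 1 - lam < 1 by linarith)
  refine ⟨N + 1, Λ (N+1), Λpos (N+1), fun X _ D hD f hf x x0 hx hdx hd0 => ?_⟩
  obtain ⟨S, Sd⟩ : ∃ S : ℕ → X → Prop, ∀ i y, S i y ↔ (f y = f x0 ∧
    ∃ j ≤ i, Λ i ≤ pr (fun ω : Fin j → X => Ch D y (List.ofFn ω) x0)) := ⟨_, fun _ _ => Iff.rfl⟩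
  have Smono : ∀ i y, S i y → S (i+1) y := by
    intro i y h; rw [Sd] at h ⊢; obtain ⟨a, j, hj, h⟩ := h
    exact ⟨a, j, by omega, (Λmono i).trans h⟩
  have S0 : ∀ i, c ≤ pr (S i) := by
    intro i; induction i with
    | zero =>
      refine hd0.trans (pr_mono fun y hy => (Sd _ _).2 ⟨hy.2, 0, le_rfl, ?_⟩)
      rw [pr_true]
      · exact le_rfl
      · intro ω; simp only [List.ofFn_zero, Ch]; exact hD _ _ hy.1
    | succ i ih => exact ih.trans (pr_mono (Smono i))
  have step : ∀ i y, f y = f x0 → lam ≤ pr (fun v => D y v ∧ S i v) → S (i+1) y := by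
    intro i y hy h
    refine (Sd _ _).2 ⟨hy, ?_⟩
    rw [Λs]
    exact grow_step (Λpos i).le (h.trans (pr_mono fun v hv => ⟨hv.1, ((Sd _ _).1 hv.2).2⟩))
  let b : ℕ → ℝ := fun i => pr (fun y => f y = f x0 ∧ ¬ S i y)
  have hb : ∀ i, b (i+1) ≤ (1 - lam) * b i := by
    intro i
    have h1 := hf (f x0) (S i)
    have h2 : c * b i ≤ pr (fun p : X × X => f p.1 = f x0 ∧ f p.2 = f x0 ∧ ¬ (S i p.1 ↔ S i p.2)) := by
      refine pr_prod_ge fun y hy => (S0 i).trans (pr_mono fun v hv => ⟨hy.1, ((Sd _ _).1 hv).1, ?_⟩)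
      have := hy.2; simp only []; tauto
    have h3 : pr (fun p : X × X => D p.1 p.2 ∧ f p.1 = f x0 ∧ f p.2 = f x0 ∧ ¬ (S i p.1 ↔ S i p.2)) ≤
        2 * pr (fun p : X × X => (f p.1 = f x0 ∧ ¬ S i p.1) ∧ D p.1 p.2 ∧ S i p.2) := by
      rw [two_mul]; nth_rewrite 3 [pr_swap]
      refine pr_or fun p ⟨a1, a2, a3, a4⟩ => ?_
      by_cases hs : S i p.1
      · right; exact ⟨⟨a3, by tauto⟩, hD _ _ a1, hs⟩
      · left; exact ⟨⟨a2, hs⟩, a1, by tauto⟩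
    have h4 : pr (fun p : X × X => (f p.1 = f x0 ∧ ¬ S i p.1) ∧ D p.1 p.2 ∧ S i p.2) ≤
        (b i - b (i+1)) + lam * b i := by
      rw [pr_prod]; simp only [b]
      unfold pr; rw [← ex_mul, ← ex_sub, ← ex_add]
      refine ex_mono fun y => ?_
      change pr _ ≤ _
      by_cases h5 : f y = f x0 ∧ ¬ S i y
      · by_cases h6 : S (i+1) y
        · rw [ind_true h5, ind_false (by tauto)]
          have := pr_le_one (fun v => (f y = f x0 ∧ ¬ S i y) ∧ D y v ∧ S i v)
          linarith
        · rw [ind_true h5, ind_true ⟨h5.1, h6⟩]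
          have h7 : ¬ lam ≤ pr (fun v => D y v ∧ S i v) := fun h => h6 (step i y h5.1 h)
          have : pr (fun v => (f y = f x0 ∧ ¬ S i y) ∧ D y v ∧ S i v) ≤ pr (fun v => D y v ∧ S i v) :=
            pr_mono fun v hv => hv.2
          push Not at h7; linarith
      · rw [pr_false (by tauto), ind_false h5, ind_false (by have := Smono i y; tauto)]; simp
    have h5 : ε * (c * b i) ≤ ε * _ := mul_le_mul_of_nonneg_left h2 hε.le
    have : ε * (c * b i) = 4 * (lam * b i) := by rw [hlam]; ring
    nlinarith
  have hbN : b N < c / 2 := by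
    have : ∀ i, b i ≤ (1 - lam) ^ i := by
      intro i; induction i with
      | zero => simpa using pr_le_one _
      | succ i ih =>
        rw [pow_succ']; exact (hb i).trans (mul_le_mul_of_nonneg_left ih (by linarith))
    exact (this N).trans_lt hN
  have hfin : lam ≤ pr (fun v => D x v ∧ S N v) := by
    have : pr (fun y => D x y ∧ f y = f x) ≤ pr (fun v => D x v ∧ S N v) + b N :=
      pr_or fun y hy => by
        by_cases hs : S N y
        · exact Or.inl ⟨hy.1, hs⟩
        · exact Or.inr ⟨hy.2.trans hx, hs⟩
    linarith
  exact ((Sd _ _).1 (step N x hx hfin)).2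
end connect

lemma DD_symm {V : Type} [DecidableEq V] {E : Finset (Finset V)} {k : ℕ} {x y : Fin k → V}
    (h : DD E x y) : DD E y x := fun s => by
  have : mix s y x = mix (fun i => !s i) x y := by ext i; simp only [mix]; by_cases h : s i <;> simp [h]
  rw [this]; exact h _

lemma pr_coord {ι V : Type} [Fintype ι] [DecidableEq ι] [Fintype V] [Nonempty V] (i : ι) (P : V → Prop) :
    pr (fun w : ι → V => P (w i)) = pr P := by
  classical
  rw [← pr_fst (β := ({j : ι // j ≠ i} → V)) P]
  exact pr_equiv (Equiv.piSplitAt i (fun _ => V)) (fun p => P p.1)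

lemma pr_arrow_fst {ι V : Type} [Fintype ι] [DecidableEq ι] [Fintype V] [Nonempty V]
    (P : (ι → V) → Prop) : pr (fun w : ι → V × V => P (fun i => (w i).1)) = pr P := by
  rw [← pr_fst (β := ι → V) P]
  exact pr_equiv (Equiv.arrowProdEquivProdArrow ι (fun _ => V) (fun _ => V)) (fun p => P p.1)

lemma lowdeg (k : ℕ) (ε : ℝ) (hε : 0 < ε) : ∃ c : ℝ, 0 < c ∧ c ≤ 1 ∧ ∀ (V : Type) [Fintype V] [DecidableEq V]
    (E : Finset (Finset V)),
      pr (fun x : Fin k → V => ed E x ∧ pr (fun y : Fin k → V => DD E x y) < c) ≤ ε := by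
  obtain ⟨c, hc, H⟩ := double k ε hε
  refine ⟨min (c / 2) 1, by positivity, min_le_right _ _, fun V _ _ E => ?_⟩
  by_contra hcon; push Not at hcon
  have h1 := H V _ hcon.le
  have h2 : c ≤ c / 2 := by
    refine h1.trans (pr_prod_le (by positivity) fun x => ?_)
    by_cases hx : pr (fun y : Fin k → V => DD E x y) < min (c / 2) 1
    · exact (pr_mono fun y hy s => (hy s).1).trans (hx.le.trans (min_le_left _ _))
    · rw [pr_false]
      · positivity
      · intro y hy
        exact hx (hy (fun _ => false)).2
  linarith

def BP {V : Type} [Fintype V] [DecidableEq V] (E : Finset (Finset V)) {k : ℕ} (c : ℝ)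
    (x x' : Fin k → V) : Prop := pr (fun y : Fin k → V => DD E x y ∧ DD E x' y) < c

lemma badpairs (k : ℕ) (ε : ℝ) (hε : 0 < ε) : ∃ c : ℝ, 0 < c ∧ ∀ (V : Type) [Fintype V] [DecidableEq V]
    (E : Finset (Finset V)) (i : Fin k),
      pr (fun p : (Fin k → V) × V => ed E p.1 ∧ ed E (Function.update p.1 i p.2) ∧
        BP E c p.1 (Function.update p.1 i p.2)) ≤ ε := by
  obtain ⟨c, hc, H⟩ := double k ε hε
  refine ⟨c / 2, by positivity, fun V _ _ E i => ?_⟩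
  by_contra hcon; push Not at hcon
  obtain ⟨p0, -⟩ := pr_pos (hε.trans hcon)
  have : Nonempty V := ⟨p0.2⟩
  set B : (Fin k → V) × V → Prop := fun p => ed E p.1 ∧ ed E (Function.update p.1 i p.2) ∧
        BP E (c/2) p.1 (Function.update p.1 i p.2) with hB
  have e1 : pr (fun ξ : Fin k → V × V => B (fun j => (ξ j).1, (ξ i).2)) = pr B := by
    have := pr_equiv (Equiv.arrowProdEquivProdArrow (Fin k) (fun _ => V) (fun _ => V))
      (fun p => B (p.1, p.2 i))
    rw [pr_prod B]
    refine this.trans ?_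
    rw [pr_prod]
    congr 1; ext x
    exact pr_coord i (fun v => B (x, v))
  have h1 := H (V × V) _ (e1 ▸ hcon.le)
  have h2 : c ≤ c / 2 := by
    refine h1.trans (pr_prod_le (by positivity) fun ξ => ?_)
    set x : Fin k → V := fun j => (ξ j).1 with hx
    set v := (ξ i).2 with hv
    by_cases hb : BP E (c/2) x (Function.update x i v)
    · have h3 := pr_arrow_fst (ι := Fin k) (fun y => DD E x y ∧ DD E (Function.update x i v) y)
      refine le_trans ?_ (h3.trans_le hb.le)
      refine pr_mono fun ξ' h => ⟨fun s => ?_, fun s => ?_⟩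
      · have := (h s).1
        convert this using 2
        funext j; simp only [mix, hx]; split_ifs <;> rfl
      · cases hs : s i with
        | false =>
          have := (h s).2.1
          convert this using 2
          funext j
          by_cases hj : j = i
          · subst hj; simp [mix, hs, hv]
          · simp only [mix, hx, Function.update_of_ne hj]; split_ifs <;> rfl
        | true =>
          have := (h s).1
          convert this using 2
          funext j
          by_cases hj : j = i
          · subst hj; simp [mix, hs]
          · simp only [mix, hx, Function.update_of_ne hj]; split_ifs <;> rfl
    · rw [pr_false]
      · positivity
      · intro ξ' h
        have := (h (fun _ => false)).2.2
        exact hb (by simpa [mix] using this)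
  linarith

lemma struct (k : ℕ) (ε : ℝ) (hε : 0 < ε) : ∃ (η c1 κ : ℝ) (J : ℕ), 0 < η ∧ 0 < c1 ∧ 0 < κ ∧
    ∀ (V : Type) [Fintype V] [DecidableEq V] (E : Finset (Finset V)),
    ∃ (f : (Fin k → V) → Option (Fin k → V)) (gd bad : (Fin k → V) → Prop),
      pr bad ≤ ε ∧ (∀ x, gd x → ed E x) ∧
      (∀ x, ed E x → ¬ bad x → gd x ∧
        ∀ i, η ≤ pr (fun v => gd (Function.update x i v) ∧ f (Function.update x i v) = f x)) ∧
      (∀ x i v, ed E x → ¬ bad x → ed E (Function.update x i v) → ¬ bad (Function.update x i v) →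
        f (Function.update x i v) = f x) ∧
      (∀ x y, gd x → gd y → f x = f y → ∃ j ≤ J,
        c1 ≤ pr (fun ω : Fin j → (Fin k → V) => Ch (DD E) x (List.ofFn ω) y)) ∧
      (∀ x, gd x → κ ≤ pr (fun y => f y = f x)) := by
  set K : ℝ := 1 + k with hK
  have hK1 : 1 ≤ K := by rw [hK]; have : (0:ℝ) ≤ k := by positivity
                         linarith
  set η : ℝ := min (ε / (4 * K)) 1 with hη
  have hη0 : 0 < η := by positivity
  set e0 : ℝ := η / 4 * (ε / (16 * K)) with he0
  have he00 : 0 < e0 := by positivity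
  obtain ⟨c, hc, hc1, Hc⟩ := lowdeg k e0 he00
  obtain ⟨b, hb, Hb⟩ := badpairs k e0 he00
  set c' : ℝ := min b c with hc'
  have hc'0 : 0 < c' := by positivity
  have hc'c : c' ≤ c := min_le_right _ _
  set εc : ℝ := min (c' / 4 * e0) 1 with hεc
  have hεc0 : 0 < εc := by positivity
  obtain ⟨J, l, hl, HJ⟩ := connect εc (c / 2) hεc0 (min_le_right _ _) (by positivity) (by linarith)
  refine ⟨η / 2, l, c / 2, J, by positivity, hl, by positivity, fun V _ _ E => ?_⟩
  obtain ⟨f, hf1, hf2⟩ := classes (X := Fin k → V) (DD E) εc hεc0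
  obtain ⟨gd, gdd⟩ : ∃ gd : (Fin k → V) → Prop, ∀ x, gd x ↔ (ed E x ∧ c ≤ pr (fun y => DD E x y) ∧
    pr (fun y => DD E x y ∧ f x ≠ f y) < c' / 4) := ⟨_, fun _ => Iff.rfl⟩
  obtain ⟨W, Wd⟩ : ∃ W : Fin k → (Fin k → V) → V → Prop, ∀ i x v, W i x v ↔
      (ed E (Function.update x i v) ∧
        (¬ gd (Function.update x i v) ∨ BP E c' x (Function.update x i v))) := ⟨_, fun _ _ _ => Iff.rfl⟩
  obtain ⟨bad, badd⟩ : ∃ bad : (Fin k → V) → Prop, ∀ x, bad x ↔ (ed E x ∧ (¬ gd x ∨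
      (∃ i, pr (fun v => ed E (Function.update x i v)) < η) ∨
      (∃ i, η / 4 ≤ pr (fun v => W i x v)))) := ⟨_, fun _ => Iff.rfl⟩
  -- class degree
  have cdeg : ∀ x, gd x → c / 2 ≤ pr (fun y => DD E x y ∧ f y = f x) := by
    intro x hx
    rw [gdd] at hx
    have : pr (fun y => DD E x y) ≤ pr (fun y => DD E x y ∧ f y = f x) + pr (fun y => DD E x y ∧ f x ≠ f y) :=
      pr_or fun y hy => by
        by_cases h : f y = f x
        · exact Or.inl ⟨hy, h⟩
        · exact Or.inr ⟨hy, fun h' => h h'.symm⟩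
    linarith
  -- good pairs have the same class
  have same : ∀ x x', gd x → gd x' → ¬ BP E c' x x' → f x = f x' := by
    intro x x' hx hx' hp
    by_contra hne
    rw [gdd] at hx hx'
    unfold BP at hp; push Not at hp
    have : pr (fun y => DD E x y ∧ DD E x' y) ≤ pr (fun y => DD E x y ∧ f x ≠ f y) +
        pr (fun y => DD E x' y ∧ f x' ≠ f y) := pr_or fun y hy => by
      by_cases h : f x = f y
      · exact Or.inr ⟨hy.2, fun h' => hne (h.trans h'.symm)⟩
      · exact Or.inl ⟨hy.1, h⟩
    linarith
  have ngd : pr (fun x => ed E x ∧ ¬ gd x) ≤ 2 * e0 := by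
    have h1 : pr (fun x => ed E x ∧ ¬ gd x) ≤ pr (fun x : Fin k → V => ed E x ∧ pr (fun y : Fin k → V => DD E x y) < c)
        + pr (fun x => c' / 4 ≤ pr (fun y => DD E x y ∧ f x ≠ f y)) := pr_or fun x hx => by
      by_contra hcon; push Not at hcon
      exact hx.2 ((gdd x).2 ⟨hx.1, hcon.1 hx.1, hcon.2⟩)
    have h2 := markov (t := c' / 4) (P := fun p : (Fin k → V) × (Fin k → V) => DD E p.1 p.2 ∧ f p.1 ≠ f p.2)
    have h3 : pr (fun x => c' / 4 ≤ pr (fun y => DD E x y ∧ f x ≠ f y)) ≤ e0 := by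
      have h4 : c' / 4 * pr (fun x => c' / 4 ≤ pr (fun y => DD E x y ∧ f x ≠ f y)) ≤ c' / 4 * e0 :=
        h2.trans (hf1.trans (min_le_left _ _))
      exact le_of_mul_le_mul_left h4 (by positivity)
    linarith [Hc V E]
  have part2 : ∀ i, pr (fun x : Fin k → V => ed E x ∧ pr (fun v => ed E (Function.update x i v)) < η) ≤ η := by
    intro i
    rcases isEmpty_or_nonempty V with hV | hV
    · rw [pr_false]
      · exact hη0.le
      · exact fun x => (hV.false (x i)).elim
    rw [← pr_fst (β := V), ← pr_upd i]
    refine pr_prod_le hη0.le fun x => ?_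
    simp only [Function.update_idem]
    by_cases h : pr (fun v => ed E (Function.update x i v)) < η
    · exact (pr_mono fun v hv => hv.1).trans h.le
    · rw [pr_false (fun v hv => h hv.2)]; exact hη0.le
  have part3 : ∀ i, pr (fun x : Fin k → V => ed E x ∧ η / 4 ≤ pr (fun v => W i x v)) ≤ ε / (4 * K) := by
    intro i
    rcases isEmpty_or_nonempty V with hV | hV
    · rw [pr_false]
      · positivity
      · exact fun x => (hV.false (x i)).elim
    have h1 : pr (fun p : (Fin k → V) × V => ed E p.1 ∧ W i p.1 p.2) ≤ 3 * e0 := by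
      have h2 := pr_or (P := fun p : (Fin k → V) × V => ed E p.1 ∧ W i p.1 p.2)
        (Q := fun p => ed E (Function.update p.1 i p.2) ∧ ¬ gd (Function.update p.1 i p.2))
        (R := fun p => ed E p.1 ∧ ed E (Function.update p.1 i p.2) ∧
          BP E b p.1 (Function.update p.1 i p.2)) (fun p hp => by
          obtain ⟨h1, h2⟩ := hp
          rw [Wd] at h2
          rcases h2 with ⟨h2, h3 | h3⟩
          · exact Or.inl ⟨h2, h3⟩
          · exact Or.inr ⟨h1, h2, lt_of_lt_of_le h3 (min_le_left _ _)⟩)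
      have h3 := pr_upd i (fun p : (Fin k → V) × V => ed E p.1 ∧ ¬ gd p.1)
      rw [pr_fst (fun x => ed E x ∧ ¬ gd x)] at h3
      have := Hb V E i
      simp only [] at h3
      linarith
    have h2 := markov (t := η / 4) (P := fun p : (Fin k → V) × V => ed E p.1 ∧ W i p.1 p.2)
    have h3 : pr (fun x : Fin k → V => ed E x ∧ η / 4 ≤ pr (fun v => W i x v)) ≤
        pr (fun x => η / 4 ≤ pr (fun v => ed E x ∧ W i x v)) :=
      pr_mono fun x hx => hx.2.trans (pr_mono fun v hv => ⟨hx.1, hv⟩)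
    have h4 : η / 4 * pr (fun x => η / 4 ≤ pr (fun v => ed E x ∧ W i x v)) ≤ η / 4 * (ε / (4 * K)) := by
      refine h2.trans (h1.trans ?_)
      rw [he0]
      have : 0 < η * ε / K := by positivity
      have e : η / 4 * (ε / (4 * K)) - 3 * (η / 4 * (ε / (16 * K))) = η * ε / K / 64 := by field_simp; ring
      linarith
    exact h3.trans (le_of_mul_le_mul_left h4 (by positivity))
  refine ⟨f, gd, bad, ?_, fun x hx => ((gdd x).1 hx).1, ?_, ?_, ?_, ?_⟩
  · have h1 : pr bad ≤ pr (fun x => ed E x ∧ ¬ gd x) + pr (fun x =>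
        (∃ i, ed E x ∧ pr (fun v => ed E (Function.update x i v)) < η) ∨
        (∃ i, ed E x ∧ η / 4 ≤ pr (fun v => W i x v))) := pr_or fun x hx => by
      rw [badd] at hx
      rcases hx with ⟨h, h' | ⟨i, h'⟩ | ⟨i, h'⟩⟩
      · exact Or.inl ⟨h, h'⟩
      · exact Or.inr (Or.inl ⟨i, h, h'⟩)
      · exact Or.inr (Or.inr ⟨i, h, h'⟩)
    have h2 := pr_or (P := fun x => (∃ i, ed E x ∧ pr (fun v => ed E (Function.update x i v)) < η) ∨
        (∃ i, ed E x ∧ η / 4 ≤ pr (fun v => W i x v))) (fun x hx => hx)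
    have h3 := pr_exists (P := fun x => ∃ i : Fin k, ed E x ∧ pr (fun v => ed E (Function.update x i v)) < η)
      (fun x hx => hx)
    have h4 := pr_exists (P := fun x => ∃ i, ed E x ∧ η / 4 ≤ pr (fun v => W i x v)) (fun x hx => hx)
    have h5 := Finset.sum_le_sum fun i (_ : i ∈ (Finset.univ : Finset (Fin k))) => part2 i
    have h6 := Finset.sum_le_sum fun i (_ : i ∈ (Finset.univ : Finset (Fin k))) => part3 i
    simp only [Finset.sum_const, Finset.card_univ, Fintype.card_fin, nsmul_eq_mul] at h5 h6
    have h7 : (k:ℝ) * (ε / (4 * K)) ≤ ε / 4 := by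
      have : (k:ℝ) ≤ K := by rw [hK]; linarith
      calc (k:ℝ) * (ε / (4 * K)) ≤ K * (ε / (4 * K)) := by gcongr
        _ = ε / 4 := by field_simp
    have h8 : 2 * e0 ≤ ε / 4 := by
      have hs : η ≤ 1 := min_le_right _ _
      have h9 : ε / (16 * K) ≤ ε / 16 := div_le_div_of_nonneg_left hε.le (by norm_num) (by linarith)
      have h11 : 0 < ε / (16 * K) := by positivity
      have h12 := mul_le_mul hs h9 h11.le zero_le_one
      rw [he0]; linarith
    have h10 : (k:ℝ) * η ≤ k * (ε / (4 * K)) := by gcongr; exact min_le_left _ _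
    linarith
  · intro x hx hnb
    rw [badd] at hnb; push Not at hnb
    obtain ⟨h1, h2, h3⟩ := hnb hx
    refine ⟨h1, fun i => ?_⟩
    have h4 : pr (fun v => ed E (Function.update x i v)) ≤
        pr (fun v => gd (Function.update x i v) ∧ f (Function.update x i v) = f x) + pr (fun v => W i x v) :=
      pr_or fun v hv => by
        by_cases h : W i x v
        · exact Or.inr h
        · rw [Wd] at h; push Not at h
          exact Or.inl ⟨(h hv).1, (same _ _ h1 (h hv).1 (h hv).2).symm⟩
    linarith [h2 i, h3 i]
  · intro x i v hx hnb hx' hnb'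
    rw [badd] at hnb hnb'; push Not at hnb hnb'
    obtain ⟨h1, h2, h3⟩ := hnb hx
    obtain ⟨h1', h2', h3'⟩ := hnb' hx'
    have h4 := h2 i; have h5 := h3 i; have h6 := h3' i
    have h7 : 0 < pr (fun w => ed E (Function.update x i w) ∧ ¬ W i x w ∧ ¬ W i (Function.update x i v) w) := by
      have a1 := pr_or (P := fun w => ed E (Function.update x i w))
        (Q := fun w => ed E (Function.update x i w) ∧ ¬ W i x w ∧ ¬ W i (Function.update x i v) w)
        (R := fun w => W i x w ∨ W i (Function.update x i v) w) (fun w hw => by tauto)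
      have a2 := pr_or (P := fun w => W i x w ∨ W i (Function.update x i v) w) (fun w hw => hw)
      linarith
    obtain ⟨w, hw1, hw2, hw3⟩ := pr_pos h7
    rw [Wd] at hw2 hw3
    rw [Function.update_idem] at hw3
    push Not at hw2 hw3
    have b1 := same _ _ h1 (hw2 hw1).1 (hw2 hw1).2
    have b2 := same _ _ h1' (hw2 hw1).1 (hw3 hw1).2
    exact b2.trans b1.symm
  · intro x y hx hy hxy
    exact HJ (Fin k → V) (DD E) (fun _ _ => DD_symm) f hf2 x y hxy (cdeg x hx) (cdeg y hy)
  · intro x hx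
    exact (cdeg x hx).trans (pr_mono fun y hy => hy.2)

lemma card_pr {α : Type*} [Fintype α] (P : α → Prop) [DecidablePred P] :
    ((Finset.univ.filter P).card : ℝ) = pr P * Fintype.card α := by
  rw [pr_card]
  rcases isEmpty_or_nonempty α with h | h
  · simp
  · field_simp

lemma pow_le_choose' (k n : ℕ) (h : 2 * k ≤ n) :
    (n : ℝ) ^ k ≤ (2 ^ k * k.factorial : ℝ) * (n.choose k : ℝ) := by
  have h1 := Nat.pow_le_choose (α := ℝ) k n
  have h2 : (n : ℝ) / 2 ≤ ((n + 1 - k : ℕ) : ℝ) := by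
    rw [div_le_iff₀ two_pos]; exact_mod_cast (by omega : n ≤ (n + 1 - k) * 2)
  have h3 : ((n : ℝ) / 2) ^ k ≤ ((n + 1 - k : ℕ) : ℝ) ^ k := by gcongr
  rw [div_pow, div_le_iff₀ (by positivity)] at h3
  rw [div_le_iff₀ (by positivity)] at h1
  calc (n:ℝ)^k ≤ ((n + 1 - k : ℕ) : ℝ) ^ k * 2 ^ k := h3
    _ ≤ ((n.choose k : ℝ) * k.factorial) * 2 ^ k := by gcongr
    _ = _ := by ring

lemma pr_marg {ι κ V : Type} [Fintype ι] [Fintype κ] [DecidableEq ι] [DecidableEq κ] [Fintype V] [Nonempty V]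
    (g : κ → ι) (hg : Function.Injective g) (P : (κ → V) → Prop) :
    pr (fun w : ι → V => P (fun j => w (g j))) = pr P := by
  classical
  let p : ι → Prop := fun i => i ∈ Set.range g
  let e := Equiv.ofInjective g hg
  have h1 := pr_equiv (Equiv.piEquivPiSubtypeProd p (fun _ => V)) (fun q => P (fun j => q.1 (e j)))
  refine Eq.trans ?_ (h1.trans ?_)
  · rfl
  · rw [pr_fst (fun q : ({x // p x} → V) => P (fun j => q (e j)))]
    exact pr_equiv (Equiv.arrowCongr e.symm (Equiv.refl V)) P

section walks
variable {V : Type} [DecidableEq V] {r : ℕ}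

def lab (r : ℕ) (W : ℕ → V) (i : ℕ) (j : Fin (r+1)) : V :=
  W (i + (j.1 + (r + 1 - i % (r+1))) % (r+1))

lemma lab_mod (i j : ℕ) (hj : j < r + 1) :
    (i + (j + (r + 1 - i % (r+1))) % (r+1)) % (r+1) = j := by
  have h := Nat.mod_lt i (Nat.succ_pos r)
  have e : i + (j + (r + 1 - i % (r+1))) = j + (r+1) * (i / (r+1) + 1) := by
    have := Nat.div_add_mod i (r+1)
    rw [mul_add, mul_one]; simp only [Nat.succ_eq_add_one] at h; omega
  rw [Nat.add_mod_mod, e, Nat.add_mul_mod_self_left, Nat.mod_eq_of_lt hj]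

lemma lab_eq (W : ℕ → V) (i p : ℕ) (h1 : i ≤ p) (h2 : p < i + (r+1)) (j : Fin (r+1)) (hj : p % (r+1) = j) :
    lab r W i j = W p := by
  unfold lab; congr 1
  have h := lab_mod i j.1 j.2
  have h3 := Nat.mod_lt (j.1 + (r + 1 - i % (r+1))) (Nat.succ_pos r)
  set q := i + (j.1 + (r + 1 - i % (r+1))) % (r+1) with hq
  have h5 := Nat.div_add_mod q (r+1)
  have h6 := Nat.div_add_mod p (r+1)
  rw [h] at h5; rw [hj] at h6
  simp only [Nat.succ_eq_add_one] at h3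
  have h8 : q / (r+1) = p / (r+1) := by
    have h9 : q < p + (r+1) := by omega
    have h10 : p < q + (r+1) := by omega
    have h11 : (r+1) * (q/(r+1)) < (r+1) * (p / (r+1) + 1) := by rw [mul_add]; omega
    have h12 : (r+1) * (p/(r+1)) < (r+1) * (q / (r+1) + 1) := by rw [mul_add]; omega
    have h13 := lt_of_mul_lt_mul_left h11 (Nat.zero_le _)
    have h14 := lt_of_mul_lt_mul_left h12 (Nat.zero_le _)
    omega
  rw [h8] at h5; omega

lemma lab_succ (W : ℕ → V) (i : ℕ) :
    lab r W (i+1) = Function.update (lab r W i) ⟨i % (r+1), Nat.mod_lt _ (Nat.succ_pos r)⟩ (W (i + (r+1))) := by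
  funext j
  by_cases hj : j = ⟨i % (r+1), Nat.mod_lt _ (Nat.succ_pos r)⟩
  · rw [hj, Function.update_self]
    exact lab_eq W (i+1) (i + (r+1)) (by omega) (by omega) _ (by simp)
  · rw [Function.update_of_ne hj]
    set p := i + (j.1 + (r + 1 - i % (r+1))) % (r+1) with hp
    have h1 : p % (r+1) = j := lab_mod i j.1 j.2
    have h3 := Nat.mod_lt (j.1 + (r + 1 - i % (r+1))) (Nat.succ_pos r)
    refine lab_eq W (i+1) p ?_ (by simp only [Nat.succ_eq_add_one] at h3; omega) j h1
    rcases Nat.eq_or_lt_of_le (show i ≤ p by omega) with h | h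
    · exact absurd (Fin.ext (by rw [← h1, ← h])) hj
    · omega

lemma lab_image (W : ℕ → V) (i : ℕ) :
    Finset.univ.image (lab r W i) = (Finset.range (r+1)).image (fun t => W (i + t)) := by
  ext v; simp only [Finset.mem_image, Finset.mem_univ, true_and, Finset.mem_range]
  constructor
  · rintro ⟨j, rfl⟩; exact ⟨_, Nat.mod_lt _ (Nat.succ_pos r), rfl⟩
  · rintro ⟨t, ht, rfl⟩
    exact ⟨⟨(i+t) % (r+1), Nat.mod_lt _ (Nat.succ_pos r)⟩, lab_eq W i (i+t) (by omega) (by omega) _ rfl⟩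

lemma perm_of_image {k : ℕ} {x y : Fin k → V} (hc : (Finset.univ.image x).card = k)
    (h : Finset.univ.image y = Finset.univ.image x) : ∃ σ : Equiv.Perm (Fin k), y = x ∘ σ := by
  have hy : Function.Injective y := by
    have : (Finset.univ.image y).card = (Finset.univ : Finset (Fin k)).card := by rw [h, hc]; simp
    simpa using Finset.card_image_iff.1 this
  have : ∀ j, ∃ i, x i = y j := fun j => by
    have : y j ∈ Finset.univ.image x := h ▸ Finset.mem_image_of_mem y (Finset.mem_univ j)
    simpa using this
  choose s hs using this
  have hsi : Function.Injective s := fun a b hab => hy (by rw [← hs, ← hs, hab])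
  exact ⟨Equiv.ofBijective s (Finite.injective_iff_bijective.1 hsi), funext fun j => (hs j).symm⟩

variable {β : Type} {f : (Fin (r+1) → V) → β} {EH : Finset (Finset V)}
  (hf : ∀ x i v, ed EH x → ed EH (Function.update x i v) → f (Function.update x i v) = f x)
include hf

lemma lab_const (W : ℕ → V) (σ : Equiv.Perm (Fin (r+1))) (i : ℕ) :
    ∀ m, (∀ j ≤ m, ed EH (lab r W (i+j))) → f (lab r W (i+m) ∘ σ) = f (lab r W i ∘ σ)
  | 0, _ => rfl
  | m+1, h => by
    have ih := lab_const W σ i m fun j hj => h j (by omega)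
    rw [← ih]
    have e : ∀ x : Fin (r+1) → V, ed EH x → ed EH (x ∘ σ) := fun x hx => by
      unfold ed at *; rwa [← Finset.image_image, Finset.image_univ_equiv]
    have h1 := e _ (h m (by omega))
    have h2 := e _ (h (m+1) le_rfl)
    rw [← add_assoc, lab_succ, Function.update_comp_equiv] at h2 ⊢
    exact hf _ _ _ h1 h2

lemma window_set (w : List V) (d : V) (i : ℕ) (h : i + (r+1) ≤ w.length) :
    ((w.drop i).take (r+1)).toFinset = Finset.univ.image (lab r (fun n => w.getD n d) i) := by
  clear hf
  rw [lab_image]; ext v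
  simp only [List.mem_toFinset, Finset.mem_image, Finset.mem_range, List.mem_iff_getElem]
  constructor
  · rintro ⟨t, ht, rfl⟩
    simp at ht
    refine ⟨t, by omega, ?_⟩
    simp [List.getD_eq_getElem?_getD, List.getElem?_eq_getElem (show i + t < w.length by omega)]
  · rintro ⟨t, ht, rfl⟩
    refine ⟨t, by simp; omega, ?_⟩
    simp [List.getD_eq_getElem?_getD, List.getElem?_eq_getElem (show i + t < w.length by omega)]

lemma walk_class (hE : ∀ e ∈ EH, e.card = r + 1) (hT : TightlyConnected (r+1) EH)
    (hC : ∃ w : List V, IsClosedTightWalk (r+1) EH w ∧ w.length % (r+1) = 1 % (r+1)) :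
    ∃ x0, ed EH x0 ∧ ∀ e ∈ EH, ∃ x : Fin (r+1) → V, Finset.univ.image x = e ∧
      ∀ j : ℕ, f (x ∘ ((Equiv.subRight (1 : Fin (r+1))) ^ j : Equiv.Perm _)) = f x0 := by
  obtain ⟨w, ⟨hw1, hw2⟩, hw3⟩ := hC
  have hl : 0 < w.length := by omega
  let W : ℕ → V := fun n => w[n % w.length]'(Nat.mod_lt _ hl)
  have hWe : ∀ i, ed EH (lab r W i) := by
    intro i
    have h1 := hw2 (i % w.length) (Nat.mod_lt _ hl)
    unfold ed; convert h1 using 1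
    rw [lab_image]; ext v
    simp only [List.mem_toFinset, Finset.mem_image, Finset.mem_range, List.mem_iff_getElem]
    constructor
    · rintro ⟨t, ht, rfl⟩
      refine ⟨t, by simp; omega, ?_⟩
      simp [List.getElem_rotate, W, add_comm]
    · rintro ⟨t, ht, rfl⟩
      simp at ht
      refine ⟨t, by omega, ?_⟩
      simp [List.getElem_rotate, W, add_comm]
  set x0 := lab r W 0 with hx0
  set ρ : Equiv.Perm (Fin (r+1)) := Equiv.subRight 1 with hρ
  have hrot : lab r W w.length = x0 ∘ ρ := by
    funext j
    have h1 : lab r W w.length j = W ((ρ j).1 + w.length) := by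
      refine lab_eq W _ _ (by omega) (by have := (ρ j).2; omega) j ?_
      rw [Nat.add_mod, hw3, ← Nat.add_mod]
      have : ((ρ j + 1 : Fin (r+1))).1 = j.1 := by simp [hρ, Equiv.subRight]
      rw [← this, Fin.val_add, Fin.val_one', Nat.add_mod_mod]
    have h2 : x0 (ρ j) = W (ρ j).1 := lab_eq W 0 _ (by omega) (by have := (ρ j).2; omega) _
      (Nat.mod_eq_of_lt (ρ j).2)
    rw [Function.comp, h2, h1]
    simp [W]
  have hx : ∀ j : ℕ, f (x0 ∘ (ρ ^ j : Equiv.Perm _)) = f x0 := by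
    intro j; induction j with
    | zero => rfl
    | succ j ih =>
      have h1 := lab_const hf W (ρ ^ j) 0 w.length (fun _ _ => hWe _)
      rw [zero_add, hrot] at h1
      rw [pow_succ', Equiv.Perm.coe_mul, ← Function.comp_assoc, h1, ih]
  refine ⟨x0, hWe 0, fun e he => ?_⟩
  obtain ⟨w', ⟨hl', hw'⟩, ⟨i1, h1, e1⟩, ⟨i2, h2, e2⟩⟩ := hT _ (hWe 0) e he
  let W' : ℕ → V := fun n => w'.getD n (x0 0)
  unfold walkEdgeAt at *
  have hW' : ∀ i, i + (r+1) ≤ w'.length → ed EH (lab r W' i) := fun i hi => by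
    unfold ed; rw [← window_set hf w' (x0 0) i hi]; exact hw' i hi
  rw [window_set hf w' (x0 0) _ h1] at e1
  rw [window_set hf w' (x0 0) _ h2] at e2
  obtain ⟨σ, hσ⟩ := perm_of_image (hE _ (hWe 0)) e1
  refine ⟨lab r W' i2 ∘ σ.symm, ?_, fun j => ?_⟩
  · rw [← Finset.image_image, Finset.image_univ_equiv]; exact e2
  · have key : ∀ τ : Equiv.Perm (Fin (r+1)), f (lab r W' i2 ∘ τ) = f (lab r W' i1 ∘ τ) := by
      intro τ
      rcases le_total i1 i2 with h | h
      · obtain ⟨m, rfl⟩ := Nat.exists_eq_add_of_le h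
        exact lab_const hf W' τ i1 m fun j hj => hW' _ (by omega)
      · obtain ⟨m, rfl⟩ := Nat.exists_eq_add_of_le h
        exact (lab_const hf W' τ i2 m fun j hj => hW' _ (by omega)).symm
    have := key (σ.symm * ρ ^ j)
    rw [Equiv.Perm.coe_mul, ← Function.comp_assoc, ← Function.comp_assoc] at this
    rw [this]
    change lab r W' i1 = _ at hσ
    have e : (x0 ∘ σ) ∘ σ.symm = x0 := by funext a; simp
    rw [hσ, e]; exact hx j
end walks

lemma sum_pigeon {J : ℕ} {a : ℝ} (g : Fin (J+1) → ℝ) (h : a ≤ ∑ i, g i) : ∃ i, a / (J+1) ≤ g i := by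
  by_contra hc; push Not at hc
  have : ∑ i, g i < ∑ _i : Fin (J+1), a / (J+1) := Finset.sum_lt_sum_of_nonempty ⟨0, Finset.mem_univ _⟩ fun i _ => hc i
  simp at this
  have e : ((J:ℝ)+1) * (a / (J+1)) = a := by field_simp
  linarith

/-- block index list -/
def cidx (j r : ℕ) : List (Bool ⊕ (Fin j × Fin (r+1))) :=
  Sum.inl false :: ((List.finRange j).flatMap (fun i => List.ofFn fun t => Sum.inr (i, t)) ++ [Sum.inl true])

lemma cidx_nodup (j r : ℕ) : (cidx j r).Nodup := by
  unfold cidx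
  rw [List.nodup_cons, List.nodup_append]
  refine ⟨by simp, ?_, by simp, by simp⟩
  rw [List.nodup_flatMap]
  refine ⟨fun i _ => List.nodup_ofFn.2 fun a b h => by simpa using h, ?_⟩
  refine (List.nodup_finRange j).imp fun {a b} hab => ?_
  rw [Function.onFun, List.disjoint_left]
  simp only [List.mem_ofFn, not_exists]
  rintro _ ⟨t, rfl⟩ t' h
  simp at h; exact hab h.1.symm

lemma cidx_len (j r : ℕ) : (cidx j r).length = 2 + (r+1) * j := by
  unfold cidx; simp [List.length_flatMap]; ring

lemma conn_core {V : Type} [Fintype V] [DecidableEq V] {E : Finset (Finset V)} {r J : ℕ} {η c1 : ℝ}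
    (hη : 0 < η) (hc1 : 0 < c1) {P1 P2 : V → Prop} {q q' : Fin r → V}
    (h1 : η ≤ pr P1) (h2 : η ≤ pr P2)
    (h : ∀ u' u, P1 u' → P2 u → ∃ j ≤ J,
        c1 ≤ pr (fun ω : Fin j → (Fin (r+1) → V) => Ch (DD E) (Fin.snoc q u') (List.ofFn ω) (Fin.cons u q'))) :
    ∃ idx : List (Fin (Fintype.card (Bool ⊕ (Fin J × Fin (r+1))))), idx.Nodup ∧ idx.length % (r+1) = 2 % (r+1) ∧
      c1 * (η * η / (J+1)) ≤ pr (fun ω : _ → V => Tight E (r+1) (List.ofFn q ++ idx.map ω ++ List.ofFn q')) := by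
  obtain ⟨v0, _⟩ := pr_pos (hη.trans_le h1)
  have : Nonempty V := ⟨v0⟩
  have e1 : η * η ≤ pr (fun p : V × V => P1 p.1 ∧ P2 p.2) :=
    (mul_le_mul_of_nonneg_left h1 hη.le).trans (pr_prod_ge fun a ha => h2.trans (pr_mono fun b hb => ⟨ha, hb⟩))
  have e2 := e1.trans (pr_exists (Q := fun (j : Fin (J+1)) (p : V × V) =>
    c1 ≤ pr (fun ω : Fin j.1 → (Fin (r+1) → V) => Ch (DD E) (Fin.snoc q p.1) (List.ofFn ω) (Fin.cons p.2 q')))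
    (fun p hp => by
      obtain ⟨j, hj, h'⟩ := h p.1 p.2 hp.1 hp.2
      exact ⟨⟨j, by omega⟩, h'⟩))
  obtain ⟨⟨j, hj⟩, hh⟩ := sum_pigeon _ e2
  have e3 := (mul_le_mul_of_nonneg_left hh hc1.le).trans (pr_prod_ge (c := c1)
    (P := fun p : (V × V) × (Fin j → (Fin (r+1) → V)) =>
      Ch (DD E) (Fin.snoc q p.1.1) (List.ofFn p.2) (Fin.cons p.1.2 q')) (fun a ha => ha))
  let g0 : (Bool ⊕ (Fin j × Fin (r+1))) → (Bool ⊕ (Fin J × Fin (r+1))) :=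
    Sum.map id (Prod.map (Fin.castLE (by omega)) id)
  have hg0 : Function.Injective g0 := by
    refine Sum.map_injective.2 ⟨Function.injective_id, (Fin.castLE_injective _).prodMap Function.injective_id⟩
  let g := fun a => Fintype.equivFin _ (g0 a)
  have hg : Function.Injective g := (Equiv.injective _).comp hg0
  refine ⟨(cidx j r).map g, (cidx_nodup j r).map hg, by simp [cidx_len], ?_⟩
  refine e3.trans ?_
  let P : ((Bool ⊕ (Fin j × Fin (r+1))) → V) → Prop := fun w =>
    Tight E (r+1) (List.ofFn q ++ (cidx j r).map w ++ List.ofFn q')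
  have e4 := pr_marg g hg P
  have e5 : pr (fun ω : Fin (Fintype.card (Bool ⊕ (Fin J × Fin (r+1)))) → V =>
      Tight E (r+1) (List.ofFn q ++ ((cidx j r).map g).map ω ++ List.ofFn q')) = pr P := by
    rw [← e4]; refine pr_congr fun ω => ?_
    simp only [P, List.map_map]; rfl
  rw [e5]
  let e : ((Bool ⊕ (Fin j × Fin (r+1))) → V) ≃ (V × V) × (Fin j → (Fin (r+1) → V)) :=
    (Equiv.sumArrowEquivProdArrow Bool (Fin j × Fin (r+1)) V).trans
      (Equiv.prodCongr (Equiv.boolArrowEquivProd V) (Equiv.curry _ _ _))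
  rw [← pr_equiv e]
  refine pr_mono fun w hw => ?_
  have := Ch.tight _ _ hw
  have e6 : (cidx j r).map w = [w (Sum.inl false)] ++ (List.ofFn (e w).2).flatMap List.ofFn ++ [w (Sum.inl true)] := by
    unfold cidx
    simp only [List.map_cons, List.map_append, List.map_flatMap, List.map_ofFn, List.ofFn_eq_map (f := (e w).2),
      List.flatMap_map]
    rfl
  simp only [P, e6]
  rw [List.ofFn_cons, List.ofFn_succ'] at this
  simpa [e, List.concat_eq_append, Function.comp_def] using this

lemma rot_pow {r : ℕ} (c : Fin (r+1)) : ∃ j : ℕ, ∀ a, ((Equiv.subRight (1 : Fin (r+1))) ^ j : Equiv.Perm _) a = a - c := by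
  induction c using Fin.induction with
  | zero => exact ⟨0, fun a => by simp⟩
  | succ c ih =>
    obtain ⟨j, hj⟩ := ih
    refine ⟨j+1, fun a => ?_⟩
    rw [pow_succ, Equiv.Perm.mul_apply, hj, ← Fin.coeSucc_eq_succ]
    simp only [Equiv.subRight_apply]; abel

lemma classSel (r : ℕ) (ε : ℝ) (hε : 0 < ε) : ∃ (c1 ε1 : ℝ) (s : ℕ), 0 < c1 ∧ 0 < ε1 ∧
    ∀ (V : Type) [Fintype V] [DecidableEq V] (E : Finset (Finset V)), (∀ e ∈ E, e.card = r+1) →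
    2 * (r+1) ≤ Fintype.card V → ∀ (F : Finset V → Finset (Finset V) → Prop),
    (∀ I ⊆ E, (I.card : ℝ) ≤ ε * (Fintype.card V).choose (r+1) → ∃ VH EH, EH ⊆ E ∧ (∀ e ∈ EH, e ∉ I) ∧
      TightlyConnected (r+1) EH ∧ (∃ w : List V, IsClosedTightWalk (r+1) EH w ∧ w.length % (r+1) = 1 % (r+1)) ∧ F VH EH) →
    ∃ Q : (Fin r → V) → Prop,
      (∀ q q', Q q → Q q' → ∃ idx : List (Fin s), idx.Nodup ∧ idx.length % (r+1) = 2 % (r+1) ∧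
        c1 ≤ pr (fun ω : Fin s → V => Tight E (r+1) (List.ofFn q ++ idx.map ω ++ List.ofFn q'))) ∧
      ∀ I ⊆ E, (I.card : ℝ) ≤ ε1 * (Fintype.card V).choose (r+1) → ∃ VH EH, EH ⊆ E ∧ (∀ e ∈ EH, e ∉ I) ∧
        F VH EH ∧ ∀ e ∈ EH, ∀ u ∈ e, ∃ q : Fin r → V, Q q ∧ Finset.univ.image (Fin.cons u q : Fin (r+1) → V) = e := by
  obtain ⟨η, c1, κ, J, hη, hc1, hκ, H⟩ := struct (r+1) (ε / (2 * (2^(r+1) * (r+1).factorial))) (by positivity)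
  refine ⟨c1 * (η * η / (J+1)), ε * κ / 2, Fintype.card (Bool ⊕ (Fin J × Fin (r+1))), by positivity, by positivity, ?_⟩
  intro V _ _ E hE hn F hF
  obtain ⟨f, gd, bad, h1, h2, h3, h4, h5, h6⟩ := H V E
  classical
  let Q : Option (Fin (r+1) → V) → (Fin r → V) → Prop := fun Z q =>
    η ≤ pr (fun u => gd (Fin.cons u q : Fin (r+1) → V) ∧ f (Fin.cons u q : Fin (r+1) → V) = Z) ∧
    η ≤ pr (fun u => gd (Fin.snoc q u : Fin (r+1) → V) ∧ f (Fin.snoc q u : Fin (r+1) → V) = Z)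
  suffices hh : ∃ Z, ∀ I ⊆ E, (I.card : ℝ) ≤ ε * κ / 2 * (Fintype.card V).choose (r+1) → ∃ VH EH, EH ⊆ E ∧ (∀ e ∈ EH, e ∉ I) ∧
        F VH EH ∧ ∀ e ∈ EH, ∀ u ∈ e, ∃ q : Fin r → V, Q Z q ∧ Finset.univ.image (Fin.cons u q : Fin (r+1) → V) = e by
    obtain ⟨Z, hZ⟩ := hh
    refine ⟨Q Z, fun q q' hq hq' => ?_, hZ⟩
    exact conn_core hη hc1 hq.2 hq'.1 fun u' u hu' hu => h5 _ _ hu'.1 hu.1 (hu'.2.trans hu.2.symm)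
  by_contra hcon; push Not at hcon
  choose I hI1 hI2 hI3 using hcon
  set C : ℝ := (((Fintype.card V).choose (r+1) : ℕ) : ℝ) with hC
  let R : Finset (Option (Fin (r+1) → V)) := Finset.univ.filter fun z => κ ≤ pr (fun y => f y = z)
  let I0 := E.filter fun e => ∃ x : Fin (r+1) → V, Finset.univ.image x = e ∧ bad x
  have hI0 : (I0.card : ℝ) ≤ ε / 2 * C := by
    have a1 : I0 ⊆ (Finset.univ.filter bad).image (fun x => Finset.univ.image x) := by
      intro e he
      obtain ⟨_, x, hx, hb⟩ := Finset.mem_filter.1 he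
      exact Finset.mem_image.2 ⟨x, by simpa using hb, hx⟩
    have a2 : (I0.card : ℝ) ≤ (Finset.univ.filter bad).card := by
      exact_mod_cast (Finset.card_le_card a1).trans Finset.card_image_le
    rw [card_pr] at a2
    have a3 := pow_le_choose' (r+1) _ hn
    rw [Fintype.card_fun, Fintype.card_fin] at a2
    push_cast at a2
    refine a2.trans ((mul_le_mul h1 a3 (by positivity) (by positivity)).trans (le_of_eq ?_))
    rw [← hC]; field_simp
  have hR : (R.card : ℝ) * κ ≤ 1 := by
    have b1 : (R.card : ℝ) * κ ≤ ∑ z ∈ R, pr (fun y => f y = z) := by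
      rw [← nsmul_eq_mul]; exact Finset.card_nsmul_le_sum _ _ _ fun z hz => (Finset.mem_filter.1 hz).2
    refine b1.trans ?_
    unfold pr; rw [← ex_sum]
    refine (ex_mono fun y => ?_).trans (ex_const_le 1 zero_le_one)
    unfold ind
    have : (∑ i ∈ R, if f y = i then (1:ℝ) else 0) ≤ 1 := by
      rw [Finset.sum_ite_eq]; split_ifs <;> norm_num
    convert this
  have hIc : ((I0 ∪ R.biUnion I).card : ℝ) ≤ ε * C := by
    have d1 : ((I0 ∪ R.biUnion I).card : ℝ) ≤ I0.card + ∑ z ∈ R, ((I z).card : ℝ) := by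
      exact_mod_cast (Finset.card_union_le _ _).trans (add_le_add_right Finset.card_biUnion_le _)
    have d2 : ∑ z ∈ R, ((I z).card : ℝ) ≤ R.card * (ε * κ / 2 * C) := by
      rw [← nsmul_eq_mul]; exact Finset.sum_le_card_nsmul _ _ _ fun z _ => hI2 z
    have hC0 : 0 ≤ C := by positivity
    have d3 : (R.card * κ) * (ε / 2 * C) ≤ 1 * (ε / 2 * C) := by gcongr
    nlinarith
  obtain ⟨VH, EH, g1, g2, g3, g4, g5⟩ := hF _ (Finset.union_subset (Finset.filter_subset _ _)
    (Finset.biUnion_subset.2 fun z _ => hI1 z)) hIc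
  have nb : ∀ x : Fin (r+1) → V, ed EH x → ed E x ∧ ¬ bad x := by
    intro x hx
    refine ⟨g1 hx, fun hb => g2 _ hx (Finset.mem_union_left _ (Finset.mem_filter.2 ⟨g1 hx, x, rfl, hb⟩))⟩
  obtain ⟨x0, hx0, hx⟩ := walk_class (f := f) (EH := EH) (fun x i v ha hb =>
    h4 x i v (nb _ ha).1 (nb _ ha).2 (nb _ hb).1 (nb _ hb).2) (fun e he => hE e (g1 he)) g3 g4
  have hZ : f x0 ∈ R := Finset.mem_filter.2 ⟨Finset.mem_univ _, h6 _ (h3 _ (nb _ hx0).1 (nb _ hx0).2).1⟩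
  obtain ⟨e, he, u, hu, hq⟩ := hI3 (f x0) VH EH g1 (fun e he hi => g2 e he
    (Finset.mem_union_right _ (Finset.mem_biUnion.2 ⟨_, hZ, hi⟩))) g5
  obtain ⟨x, rfl, hxf⟩ := hx e he
  obtain ⟨i, _, rfl⟩ := Finset.mem_image.1 hu
  have key : ∀ c : Fin (r+1), ∃ y : Fin (r+1) → V, (∀ a, y a = x (a - c)) ∧ f y = f x0 ∧ ed EH y := by
    intro c
    obtain ⟨j, hj⟩ := rot_pow c
    refine ⟨_, fun a => ?_, hxf j, ?_⟩
    · simp [hj]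
    · unfold ed; rw [← Finset.image_image, Finset.image_univ_equiv]; exact he
  obtain ⟨y, y1, y2, y3⟩ := key (-i)
  obtain ⟨z, z1, z2, z3⟩ := key (-(i+1))
  have hz : ∀ j : Fin r, z j.castSucc = y j.succ := fun j => by
    rw [z1, y1, ← Fin.coeSucc_eq_succ]; congr 1; abel
  have Y := (h3 _ (nb _ y3).1 (nb _ y3).2).2 0
  have Zz := (h3 _ (nb _ z3).1 (nb _ z3).2).2 (Fin.last r)
  have uy : ∀ v, Function.update y 0 v = Fin.cons v (Fin.tail y) := fun v => by
    rw [← Fin.update_cons_zero (y 0), Fin.cons_self_tail]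
  have uz : ∀ v, Function.update z (Fin.last r) v = Fin.snoc (Fin.tail y) v := fun v => by
    have : Fin.tail y = Fin.init z := by funext j; exact (hz j).symm
    rw [this, ← Fin.update_snoc_last (x := z (Fin.last r)), Fin.snoc_init_self]
  simp only [uy, y2] at Y
  simp only [uz, z2] at Zz
  refine hq (Fin.tail y) ⟨Y, Zz⟩ ?_
  have : x i = y 0 := by rw [y1]; simp
  rw [this, Fin.cons_self_tail]
  ext v; simp only [Finset.mem_image, Finset.mem_univ, true_and, y1]
  constructor
  · rintro ⟨a, rfl⟩; exact ⟨_, rfl⟩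
  · rintro ⟨a, rfl⟩; exact ⟨a - i, by simp⟩

lemma card_pow_mem {V : Type} [DecidableEq V] (s : Finset V) (v : V) (hv : v ∈ s) (d : ℕ) :
    ((s.powersetCard (d+1)).filter (fun S => v ∈ S)).card = (s.card - 1).choose d := by
  have : (s.powersetCard (d+1)).filter (fun S => v ∈ S) = ((s.erase v).powersetCard d).image (insert v) := by
    conv_lhs => rw [← Finset.insert_erase hv]
    rw [Finset.powersetCard_succ_insert (Finset.notMem_erase v s)]
    ext S; simp only [Finset.mem_filter, Finset.mem_union, Finset.mem_image, Finset.mem_powersetCard]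
    constructor
    · rintro ⟨h | h, hS⟩
      · exact absurd (h.1 hS) (Finset.notMem_erase v s)
      · exact h
    · rintro ⟨T, hT, rfl⟩; exact ⟨Or.inr ⟨T, hT, rfl⟩, Finset.mem_insert_self _ _⟩
  rw [this, Finset.card_image_of_injOn, Finset.card_powersetCard, Finset.card_erase_of_mem hv]
  intro a ha b hb hab
  have ha' : v ∉ a := fun h => Finset.notMem_erase v s ((Finset.mem_powersetCard.1 ha).1 h)
  have hb' : v ∉ b := fun h => Finset.notMem_erase v s ((Finset.mem_powersetCard.1 hb).1 h)
  rw [← Finset.erase_insert ha', ← Finset.erase_insert hb']; rw [show insert v a = insert v b from hab]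

lemma deg_one {V : Type} [Fintype V] [DecidableEq V] {E : Finset (Finset V)} {k d : ℕ} (hd : 1 ≤ d) (hdk : d ≤ k)
    (hkn : k ≤ Fintype.card V) (hE : ∀ e ∈ E, e.card = k) (δ : ℝ)
    (h : ∀ S : Finset V, S.card = d → δ * (((Fintype.card V - d).choose (k - d) : ℕ) : ℝ)
          ≤ ((E.filter fun e => S ⊆ e).card : ℝ)) (v : V) :
    δ * (((Fintype.card V - 1).choose (k - 1) : ℕ) : ℝ) ≤ ((E.filter fun e => v ∈ e).card : ℝ) := by
  obtain ⟨d, rfl⟩ := Nat.exists_eq_add_of_le' hd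
  set n := Fintype.card V with hn
  set Sv := ((Finset.univ : Finset V).powersetCard (d+1)).filter (fun S => v ∈ S)
  have h1 := Finset.sum_card_bipartiteAbove_eq_sum_card_bipartiteBelow (s := Sv) (t := E) (fun S e => S ⊆ e)
  have h2 : (Sv.card : ℝ) * (δ * (((n - (d+1)).choose (k - (d+1)) : ℕ) : ℝ)) ≤ ∑ S ∈ Sv, ((E.filter fun e => S ⊆ e).card : ℝ) := by
    rw [← nsmul_eq_mul]; refine Finset.card_nsmul_le_sum _ _ _ fun S hS => h S ?_
    exact (Finset.mem_powersetCard.1 (Finset.mem_filter.1 hS).1).2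
  have h3 : ∑ e ∈ E, (Sv.filter fun S => S ⊆ e).card ≤ (E.filter fun e => v ∈ e).card * (k-1).choose d := by
    rw [← smul_eq_mul, ← Finset.sum_const, Finset.sum_filter]
    refine Finset.sum_le_sum fun e he => ?_
    split_ifs with hv
    · rw [← hE e he, ← card_pow_mem e v hv d]
      refine Finset.card_le_card fun S hS => ?_
      simp only [Sv, Finset.mem_filter, Finset.mem_powersetCard] at hS ⊢
      exact ⟨⟨hS.2, hS.1.1.2⟩, hS.1.2⟩
    · rw [Nat.le_zero, Finset.card_eq_zero, Finset.filter_eq_empty_iff]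
      intro S hS hSe
      exact hv (hSe (Finset.mem_filter.1 hS).2)
  have h4 : ∑ S ∈ Sv, ((E.filter fun e => S ⊆ e).card : ℝ) ≤ (E.filter fun e => v ∈ e).card * (k-1).choose d := by
    simp only [Finset.bipartiteAbove, Finset.bipartiteBelow] at h1
    rw [← h1] at h3; exact_mod_cast h3
  have h5 : Sv.card = (n-1).choose d := by rw [card_pow_mem _ v (Finset.mem_univ v) d, Finset.card_univ]
  have h6 : (n-1).choose (k-1) * (k-1).choose d = (n-1).choose d * (n - (d+1)).choose (k-(d+1)) := by
    rw [Nat.choose_mul (by omega)]; congr 2 <;> omega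
  have h7 : ((n-1).choose (k-1) : ℝ) * (k-1).choose d = (n-1).choose d * (n - (d+1)).choose (k-(d+1)) := by
    exact_mod_cast h6
  have h8 : (0:ℝ) < (k-1).choose d := by exact_mod_cast Nat.choose_pos (by omega)
  rw [h5] at h2
  refine le_of_mul_le_mul_right ?_ h8
  calc _ = ((n-1).choose d : ℝ) * (δ * (n - (d+1)).choose (k-(d+1))) := by rw [mul_assoc, h7]; ring
    _ ≤ _ := h2.trans h4

lemma sum_cons {V : Type} [Fintype V] {r : ℕ} (F : (Fin (r+1) → V) → ℝ) :
    ∑ x, F x = ∑ v, ∑ q : Fin r → V, F (Fin.cons v q) := by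
  rw [← Fintype.sum_prod_type' (f := fun v (q : Fin r → V) => F (Fin.cons v q))]
  exact ((Fin.consEquiv (fun _ : Fin (r+1) => V)).sum_comp F).symm

lemma sum_ind {α : Type*} [Fintype α] (P : α → Prop) : ∑ x, ind (P x) = pr P * Fintype.card α := by
  unfold pr ex
  rcases isEmpty_or_nonempty α with h | h
  · simp
  · field_simp

lemma frac {V : Type} [Fintype V] [Nonempty V] [DecidableEq V] {r : ℕ} {γ c α : ℝ} (hc : 0 < c) (hγ : r * α / c ≤ γ)
    {VH : Finset V} {EH : Finset (Finset V)} (hR : RobustlyMatchable γ VH EH) (hV : ∀ e ∈ EH, e ⊆ VH)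
    {S : (Fin (r+1) → V) → Prop} (hS : ∀ e ∈ EH, ∃ x, Finset.univ.image x = e ∧ S x)
    {B : Finset V} (hB : Disjoint B VH) (hBc : (B.card : ℝ) ≤ α * Fintype.card V)
    (hBd : ∀ v ∈ B, c ≤ pr (fun q : Fin r → V => S (Fin.cons v q) ∧ ∀ i, q i ∈ VH)) :
    ∃ ω : (Fin (r+1) → V) → ℝ, (∀ x, 0 ≤ ω x) ∧ (∀ x, ω x ≠ 0 → S x) ∧
      (∀ w, ∑ x, ω x * ind (∃ i, x i = w) ≤ 1) ∧ (VH.card : ℝ) + B.card ≤ (r+1) * ∑ x, ω x := by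
  classical
  let L : V → (Fin r → V) → Prop := fun v q => S (Fin.cons v q) ∧ ∀ i, q i ∈ VH
  let N : V → ℝ := fun v => ∑ q, ind (L v q)
  let n : ℝ := Fintype.card V
  have hN : ∀ v ∈ B, c * n ^ r ≤ N v ∧ 0 < n ∧ 0 < N v := by
    intro v hv
    have h1 : N v = pr (L v) * n ^ r := by simp only [N, sum_ind]; simp [n]
    have hn : 0 < n := by simp only [n]; exact_mod_cast Fintype.card_pos_iff.2 ⟨v⟩
    have h2 : c * n ^ r ≤ N v := by rw [h1]; gcongr; exact hBd v hv
    exact ⟨h2, hn, lt_of_lt_of_le (by positivity) h2⟩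
  have hN0 : ∀ v, 0 ≤ N v := fun v => Finset.sum_nonneg fun _ _ => ind_nonneg _
  let ω1 : (Fin (r+1) → V) → ℝ := fun x => ind (x 0 ∈ B ∧ L (x 0) (Fin.tail x)) / N (x 0)
  have o1n : ∀ x, 0 ≤ ω1 x := fun x => div_nonneg (ind_nonneg _) (hN0 _)
  have o1s : ∀ x, ω1 x ≠ 0 → S x ∧ x 0 ∈ B ∧ ∀ i : Fin r, x i.succ ∈ VH := by
    intro x hx
    by_cases h : x 0 ∈ B ∧ L (x 0) (Fin.tail x)
    · refine ⟨?_, h.1, h.2.2⟩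
      have := h.2.1; rwa [Fin.cons_self_tail] at this
    · exact absurd (by simp [ω1, ind_false h]) hx
  let l1 : V → ℝ := fun w => ∑ x, ω1 x * ind (∃ i, x i = w)
  have l1c : ∀ w, l1 w = ∑ v ∈ B, ∑ q, (ind (L v q) / N v) * ind (∃ i, (Fin.cons v q : Fin (r+1) → V) i = w) := by
    intro w
    simp only [l1]; rw [sum_cons, ← Finset.sum_subset (Finset.subset_univ B)]
    · refine Finset.sum_congr rfl fun v hv => Finset.sum_congr rfl fun q _ => ?_
      simp [ω1, hv]
    · intro v _ hv
      refine Finset.sum_eq_zero fun q _ => ?_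
      have : ω1 (Fin.cons v q) = 0 := by simp only [ω1]; rw [ind_false (by simp [hv]), zero_div]
      rw [this, zero_mul]
  have l1B : ∀ w ∈ B, l1 w = 1 := by
    intro w hw
    rw [l1c, Finset.sum_eq_single w]
    · rw [show (1:ℝ) = N w / N w from (div_self (hN w hw).2.2.ne').symm]
      simp only [N]; rw [Finset.sum_div]
      refine Finset.sum_congr rfl fun q _ => ?_
      rw [ind_true (p := ∃ i, (Fin.cons w q : Fin (r+1) → V) i = w) ⟨0, rfl⟩, mul_one]
    · intro v hv hvw
      refine Finset.sum_eq_zero fun q _ => ?_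
      by_cases h : L v q
      · rw [ind_false (p := ∃ i, (Fin.cons v q : Fin (r+1) → V) i = w), mul_zero]
        rintro ⟨i, hi⟩
        revert hi; refine Fin.cases ?_ (fun i => ?_) i
        · simpa using hvw
        · intro hi; simp at hi
          exact Finset.disjoint_left.1 hB hw (hi ▸ h.2 i)
      · rw [ind_false h]; simp
    · intro h; exact absurd hw h
  have l1V : ∀ w ∈ VH, l1 w ≤ γ := by
    intro w hw
    rw [l1c]
    refine le_trans (Finset.sum_le_card_nsmul _ _ (r / (c * n)) fun v hv => ?_) ?_
    · obtain ⟨a1, a2, a3⟩ := hN v hv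
      have : Nonempty V := ⟨v⟩
      have b1 : ∀ q : Fin r → V, ind (L v q) / N v * ind (∃ i, (Fin.cons v q : Fin (r+1) → V) i = w) ≤
          (1 / (c * n ^ r)) * ∑ i, ind (q i = w) := by
        intro q
        refine mul_le_mul ?_ ?_ (ind_nonneg _) (by positivity)
        · gcongr; exact ind_le_one _
        · by_cases h : ∃ i, q i = w
          · obtain ⟨i, hi⟩ := h
            refine (ind_le_one _).trans ?_
            rw [← ind_true hi]
            exact Finset.single_le_sum (f := fun i => ind (q i = w)) (fun _ _ => ind_nonneg _) (Finset.mem_univ i)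
          · rw [ind_false]
            · exact Finset.sum_nonneg fun _ _ => ind_nonneg _
            · rintro ⟨i, hi⟩
              revert hi; refine Fin.cases ?_ (fun i => ?_) i
              · intro hi; simp at hi; exact Finset.disjoint_left.1 hB hv (hi ▸ hw)
              · intro hi; exact h ⟨i, by simpa using hi⟩
      refine (Finset.sum_le_sum fun q _ => b1 q).trans ?_
      rw [← Finset.mul_sum, Finset.sum_comm]
      have b2 : ∀ i : Fin r, ∑ q : Fin r → V, ind (q i = w) = n ^ r / n := by
        intro i
        rw [sum_ind, pr_coord i (fun u => u = w), pr_card]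
        simp [n, Finset.filter_eq', div_eq_inv_mul]
      simp only [b2, Finset.sum_const, Finset.card_univ, Fintype.card_fin, nsmul_eq_mul]
      apply le_of_eq; field_simp
    · rw [nsmul_eq_mul]
      rcases B.eq_empty_or_nonempty with h | ⟨v, hv⟩
      · have h2 : 0 ≤ α * n := by simpa [h] using hBc
        rw [h]; simp
        rcases eq_or_lt_of_le (show 0 ≤ n by simp only [n]; positivity) with h0 | h0
        · exact absurd (Fintype.card_pos_iff.2 ⟨w⟩) (by simp only [n] at h0; have h0 : (Fintype.card V : ℝ) = 0 := h0.symm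
                                                        norm_cast at h0; omega)
        · refine le_trans ?_ hγ
          have : 0 ≤ α := nonneg_of_mul_nonneg_left h2 h0
          positivity
      · have := (hN v hv).2.1
        refine le_trans ?_ hγ
        calc (B.card : ℝ) * (r / (c * n)) ≤ (α * n) * (r / (c * n)) := by gcongr
          _ = _ := by field_simp
  have l1n : ∀ w, 0 ≤ l1 w := fun w => Finset.sum_nonneg fun x _ => mul_nonneg (o1n x) (ind_nonneg _)
  obtain ⟨wt, hw1, hw2⟩ := hR (fun w => 1 - l1 w) fun v hv => ⟨by linarith [l1V v hv], by linarith [l1n v]⟩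
  choose! X hX1 hX2 using hS
  let ω2 : (Fin (r+1) → V) → ℝ := fun x => ∑ e ∈ EH, if X e = x then wt e else 0
  have l2 : ∀ w, ∑ x, ω2 x * ind (∃ i, x i = w) = ∑ e ∈ EH.filter (fun e => w ∈ e), wt e := by
    intro w
    simp only [ω2, Finset.sum_mul]; rw [Finset.sum_comm, Finset.sum_filter]
    refine Finset.sum_congr rfl fun e he => ?_
    simp only [ite_mul, zero_mul, Finset.sum_ite_eq, Finset.mem_univ, if_true]
    have : (∃ i, X e i = w) ↔ w ∈ e := by conv_rhs => rw [← hX1 e he]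
                                          simp
    simp [ind, this]
  have lt : ∀ w, ∑ x, (ω1 x + ω2 x) * ind (∃ i, x i = w) = l1 w + ∑ e ∈ EH.filter (fun e => w ∈ e), wt e := by
    intro w; rw [← l2]; simp only [l1, add_mul, Finset.sum_add_distrib]
  have l2B : ∀ w, w ∉ VH → ∑ e ∈ EH.filter (fun e => w ∈ e), wt e = 0 := by
    intro w hw
    rw [Finset.filter_eq_empty_iff.2 fun {e} he hwe => hw (hV e he hwe)]; simp
  have lV : ∀ w ∈ VH, ∑ x, (ω1 x + ω2 x) * ind (∃ i, x i = w) = 1 := by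
    intro w hw; rw [lt, hw2 w hw]; ring
  have lB : ∀ w ∈ B, ∑ x, (ω1 x + ω2 x) * ind (∃ i, x i = w) = 1 := by
    intro w hw; rw [lt, l2B w (Finset.disjoint_left.1 hB hw), l1B w hw]; ring
  have o2n : ∀ x, 0 ≤ ω2 x := fun x => Finset.sum_nonneg fun e he => by
    split_ifs
    · exact (hw1 e he).1
    · exact le_rfl
  refine ⟨fun x => ω1 x + ω2 x, fun x => add_nonneg (o1n x) (o2n x), fun x hx => ?_, fun w => ?_, ?_⟩
  · by_cases h : ω1 x = 0
    · have h2 : ω2 x ≠ 0 := by simpa [h] using hx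
      obtain ⟨e, he, h3⟩ := Finset.exists_ne_zero_of_sum_ne_zero h2
      have : X e = x := by by_contra h4; simp [h4] at h3
      rw [← this]; exact hX2 e he
    · exact (o1s x h).1
  · by_cases hw : w ∈ VH
    · exact (lV w hw).le
    · by_cases hb : w ∈ B
      · exact (lB w hb).le
      · rw [lt, l2B w hw]
        have : l1 w = 0 := by
          refine Finset.sum_eq_zero fun x _ => ?_
          by_cases h : ω1 x = 0
          · rw [h, zero_mul]
          · obtain ⟨_, h1, h2⟩ := o1s x h
            rw [ind_false, mul_zero]
            rintro ⟨i, hi⟩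
            revert hi; refine Fin.cases ?_ (fun i => ?_) i
            · intro hi; exact hb (hi ▸ h1)
            · intro hi; exact hw (hi ▸ h2 i)
        rw [this]; norm_num
  · have t1 : (VH.card : ℝ) + B.card = ∑ w ∈ B ∪ VH, ∑ x, (ω1 x + ω2 x) * ind (∃ i, x i = w) := by
      rw [Finset.sum_union hB, Finset.sum_congr rfl lV, Finset.sum_congr rfl lB]; simp; ring
    rw [t1]
    refine (Finset.sum_le_sum_of_subset_of_nonneg (Finset.subset_univ _) fun w _ _ => Finset.sum_nonneg fun x _ =>
      mul_nonneg (add_nonneg (o1n x) (o2n x)) (ind_nonneg _)).trans ?_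
    rw [Finset.sum_comm, Finset.mul_sum]
    refine Finset.sum_le_sum fun x _ => ?_
    rw [← Finset.mul_sum, mul_comm]
    refine mul_le_mul_of_nonneg_right ?_ (add_nonneg (o1n x) (o2n x))
    have : ∑ w, ind (∃ i, x i = w) = ((Finset.univ.image x).card : ℝ) := by
      have e : ∀ w, ind (∃ i, x i = w) = if w ∈ Finset.univ.image x then (1:ℝ) else 0 := fun w => by simp [ind]
      simp only [e]; rw [Finset.sum_ite_mem]; simp
    rw [this]; exact_mod_cast Finset.card_image_le.trans (by simp)

lemma choose_lb {m r : ℕ} {n α : ℝ} (hα : 0 ≤ α) (hα1 : α ≤ 1/2) (hn : 0 ≤ n)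
    (h : (1 - 2 * α) * n ≤ m + 1 - r) : (1 - 2 * α * r) * (n ^ r / r.factorial) ≤ (m.choose r : ℝ) := by
  have h1 := Nat.pow_le_choose (α := ℝ) r m
  refine le_trans ?_ h1
  rw [← mul_div_assoc]
  gcongr
  have h2 : (1 - 2 * α) * n ≤ ((m + 1 - r : ℕ) : ℝ) := by
    refine h.trans ?_
    have : m + 1 ≤ (m + 1 - r) + r := by omega
    have : ((m:ℝ) + 1) ≤ ((m + 1 - r : ℕ) : ℝ) + r := by exact_mod_cast this
    linarith
  have h3 : ((1 - 2 * α) * n) ^ r ≤ ((m + 1 - r : ℕ) : ℝ) ^ r := by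
    gcongr; exact mul_nonneg (by linarith) hn
  refine le_trans ?_ h3
  rw [mul_pow]; gcongr
  have := one_add_mul_le_pow (a := -(2*α)) (by linarith) r
  rw [show 1 + -(2*α) = 1 - 2 * α by ring] at this
  linarith

lemma image_cons {V : Type} [DecidableEq V] {r : ℕ} (u : V) (q : Fin r → V) :
    Finset.univ.image (Fin.cons u q : Fin (r+1) → V) = insert u (Finset.univ.image q) := by
  ext w; simp only [Finset.mem_image, Finset.mem_univ, true_and, Finset.mem_insert, Fin.exists_fin_succ, Fin.cons_zero, Fin.cons_succ]
  constructor
  · rintro (h | h)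
    · exact Or.inl h.symm
    · exact Or.inr h
  · rintro (h | h)
    · exact Or.inl h.symm
    · exact Or.inr h

lemma link_card {V : Type} [Fintype V] [DecidableEq V] {r : ℕ} {E : Finset (Finset V)} (hE : ∀ e ∈ E, e.card = r+1) (u : V) :
    (E.filter (fun e => u ∈ e)).card ≤
      (((Finset.univ : Finset V).powersetCard r).filter fun T => u ∉ T ∧ insert u T ∈ E).card := by
  refine Finset.card_le_card_of_injOn (fun e => e.erase u) (fun e he => ?_) fun a ha b hb hab => ?_
  · have he := Finset.mem_filter.1 he
    simp only [Finset.coe_filter, Set.mem_ofPred_eq, Finset.mem_powersetCard]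
    refine ⟨⟨Finset.subset_univ _, ?_⟩, Finset.notMem_erase _ _, ?_⟩
    · rw [Finset.card_erase_of_mem he.2, hE _ he.1]; rfl
    · rw [Finset.insert_erase he.2]; exact he.1
  · have ha := (Finset.mem_filter.1 ha).2
    have hb := (Finset.mem_filter.1 hb).2
    rw [← Finset.insert_erase ha, ← Finset.insert_erase hb]; simp only at hab; rw [hab]

lemma common {V : Type} [Fintype V] [DecidableEq V] {r : ℕ} {E EH : Finset (Finset V)} {VH : Finset V} {α μ γ δ : ℝ}
    {Q : (Fin r → V) → Prop} (hα : 0 ≤ α) (hαμ : α * (r+1) ≤ μ / 16) (hμ : 0 < μ) (hγ : 0 ≤ γ) (hγ1 : γ ≤ 1)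
    (hδ : 0 < δ) (hδ1 : δ + μ ≤ 1) (hE : ∀ e ∈ E, e.card = r+1) (hEH : EH ⊆ E)
    (hn : (r:ℝ) + 1 ≤ α * Fintype.card V)
    (hdeg : ∀ v : V, (δ + μ) * (((Fintype.card V - 1).choose r : ℕ) : ℝ) ≤ ((E.filter fun e => v ∈ e).card : ℝ))
    (hVH : (1 - α) * Fintype.card V ≤ VH.card)
    (hF5 : ∀ v ∈ VH, (1 - δ + γ) * (((VH.card - 1).choose r : ℕ) : ℝ) ≤ ((EH.filter fun e => v ∈ e).card : ℝ))
    (hQ : ∀ e ∈ EH, ∀ u ∈ e, ∃ q : Fin r → V, Q q ∧ Finset.univ.image (Fin.cons u q : Fin (r+1) → V) = e)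
    (u : V) (hu : u ∈ VH) (v : V) :
    μ / (2 * r.factorial) ≤ pr (fun q : Fin r → V => Q q ∧ ed EH (Fin.cons u q : Fin (r+1) → V) ∧ ed E (Fin.cons v q : Fin (r+1) → V)) := by
  classical
  set n : ℝ := ((Fintype.card V : ℕ) : ℝ) with hnn
  have hα2 : α ≤ 1/2 := by nlinarith [(by positivity : (0:ℝ) ≤ r)]
  have hr0 : (0:ℝ) ≤ r := by positivity
  set N : ℝ := n ^ r / r.factorial with hN
  have hn0 : 0 < n := by
    by_contra h; push Not at h
    nlinarith
  have hN0 : 0 < N := by positivity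
  have sub1 : ∀ m : ℕ, (m:ℝ) - 1 ≤ ((m-1 : ℕ) : ℝ) := fun m => by
    have : m ≤ (m - 1) + 1 := by omega
    have : (m:ℝ) ≤ ((m-1 : ℕ) : ℝ) + 1 := by exact_mod_cast this
    linarith
  have b1 : (1 - 2 * α * r) * N ≤ ((Fintype.card V - 1).choose r : ℝ) := by
    refine choose_lb hα hα2 hn0.le ?_
    have := sub1 (Fintype.card V); rw [← hnn] at this; nlinarith
  have b2 : (1 - 2 * α * r) * N ≤ ((VH.card - 1).choose r : ℝ) := by
    refine choose_lb hα hα2 hn0.le ?_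
    have := sub1 VH.card; nlinarith
  have hβ : 2 * α * r ≤ μ / 8 := by nlinarith
  let A1 := ((Finset.univ : Finset V).powersetCard r).filter fun T => u ∉ T ∧ insert u T ∈ EH
  let A2 := ((Finset.univ : Finset V).powersetCard r).filter fun T => v ∉ T ∧ insert v T ∈ E
  have a1 : (1 - δ + γ) * ((1 - 2 * α * r) * N) ≤ A1.card := by
    refine le_trans (mul_le_mul_of_nonneg_left b2 (by linarith)) ((hF5 u hu).trans ?_)
    exact_mod_cast link_card (fun e he => hE e (hEH he)) u
  have a2 : (δ + μ) * ((1 - 2 * α * r) * N) ≤ A2.card := by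
    refine le_trans (mul_le_mul_of_nonneg_left b1 (by linarith)) ((hdeg v).trans ?_)
    exact_mod_cast link_card hE v
  have a3 : ((A1 ∪ A2).card : ℝ) ≤ N := by
    have : (A1 ∪ A2).card ≤ (Fintype.card V).choose r := by
      rw [← Finset.card_univ, ← Finset.card_powersetCard]
      exact Finset.card_le_card (Finset.union_subset (Finset.filter_subset _ _) (Finset.filter_subset _ _))
    refine le_trans (by exact_mod_cast this) (Nat.choose_le_pow_div r _)
  have a4 : ((A1 ∪ A2).card : ℝ) + (A1 ∩ A2).card = A1.card + A2.card := by exact_mod_cast Finset.card_union_add_card_inter A1 A2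
  have a5 : μ / 2 * N ≤ (A1 ∩ A2).card := by
    have : (1 + γ + μ) * ((1 - 2 * α * r) * N) - N ≤ (A1 ∩ A2).card := by nlinarith
    refine le_trans ?_ this
    have : μ / 2 ≤ (1 + γ + μ) * (1 - 2 * α * r) - 1 := by nlinarith
    nlinarith
  have a6 : (A1 ∩ A2).card ≤ (Finset.univ.filter (fun q : Fin r → V => Q q ∧ ed EH (Fin.cons u q : Fin (r+1) → V) ∧ ed E (Fin.cons v q : Fin (r+1) → V))).card := by
    refine le_trans (Finset.card_le_card (fun T hT => ?_)) (Finset.card_image_le (f := fun q : Fin r → V => Finset.univ.image q))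
    obtain ⟨h1, h2⟩ := Finset.mem_inter.1 hT
    obtain ⟨h1, h3, h4⟩ := Finset.mem_filter.1 h1
    obtain ⟨_, h5, h6⟩ := Finset.mem_filter.1 h2
    obtain ⟨q, q1, q2⟩ := hQ _ h4 u (Finset.mem_insert_self _ _)
    have hTc := (Finset.mem_powersetCard.1 h1).2
    have : Finset.univ.image q = T := by
      have e := q2; rw [image_cons] at e
      have hu : u ∉ Finset.univ.image q := by
        intro hu
        rw [Finset.insert_eq_of_mem hu] at e
        have h7 := Finset.card_image_le (s := (Finset.univ : Finset (Fin r))) (f := q)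
        rw [e, Finset.card_insert_of_notMem h3, hTc] at h7; simp at h7
      rw [← Finset.erase_insert hu, e, Finset.erase_insert h3]
    refine Finset.mem_image.2 ⟨q, Finset.mem_filter.2 ⟨Finset.mem_univ _, q1, ?_, ?_⟩, this⟩
    · unfold ed; rw [q2]; exact h4
    · unfold ed; rw [image_cons, this]; exact h6
  have a7 : ((A1 ∩ A2).card : ℝ) ≤ _ := Nat.cast_le.2 a6
  rw [card_pr, Fintype.card_fun, Fintype.card_fin] at a7
  push_cast at a7
  rw [← hnn] at a7
  have h9 : 0 < n ^ r := by positivity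
  refine le_of_mul_le_mul_right (le_trans (le_of_eq ?_) (a5.trans a7)) h9
  rw [hN]; field_simp

def Iface (r : ℕ) (c K c2 : ℝ) (s : ℕ) {V : Type} [Fintype V] [DecidableEq V] (E : Finset (Finset V))
    (Q : (Fin r → V) → Prop) : Prop :=
  (∀ q q', Q q → Q q' → ∃ idx : List (Fin s), idx.Nodup ∧ idx.length % (r+1) = 2 % (r+1) ∧
    c2 ≤ pr (fun ω : Fin s → V => Tight E (r+1) (List.ofFn q ++ idx.map ω ++ List.ofFn q'))) ∧
  (∃ U : V → Prop, pr (fun v => ¬ U v) ≤ c / (4 * (r+1)) ∧ ∀ u, U u → ∀ v,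
    c ≤ pr (fun q : Fin r → V => Q q ∧ ed E (Fin.cons u q : Fin (r+1) → V) ∧ ed E (Fin.cons v q : Fin (r+1) → V))) ∧
  (∀ A : Finset V, (A.card : ℝ) ≤ c2 * Fintype.card V → ∀ J : (Fin (r+1) → V) → Prop, pr J ≤ c2 →
    ∃ ω : (Fin (r+1) → V) → ℝ, (∀ x, 0 ≤ ω x) ∧
      (∀ x, ω x ≠ 0 → ed E x ∧ Q (Fin.tail x) ∧ ¬ J x ∧ ∀ i, x i ∉ A) ∧
      (∀ w, ∑ x, ω x * ind (∃ i, x i = w) ≤ 1) ∧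
      (Fintype.card V : ℝ) - A.card - K * pr J * Fintype.card V ≤ (r+1) * ∑ x, ω x)

lemma iface_core {V : Type} [Fintype V] [DecidableEq V] {r : ℕ} {E : Finset (Finset V)} {c0 c2 ε1 γ α : ℝ}
    {Q : (Fin r → V) → Prop} (hE : ∀ e ∈ E, e.card = r+1) (hn : 2 * (r+1) ≤ Fintype.card V) (hc0 : 0 < c0)
    (hc2 : 0 ≤ c2) (hε1 : (r+2) * c2 * (2^(r+1) * (r+1).factorial) ≤ ε1) (hα1 : α ≤ 1/2) (hγ : r * α / (c0/2) ≤ γ)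
    (H : ∀ I ⊆ E, (I.card : ℝ) ≤ ε1 * (Fintype.card V).choose (r+1) → ∃ VH EH, EH ⊆ E ∧ (∀ e ∈ EH, e ∉ I) ∧
      (∀ e ∈ EH, e ⊆ VH) ∧ RobustlyMatchable γ VH EH ∧ (1 - α) * Fintype.card V ≤ VH.card ∧
      (∀ u ∈ VH, ∀ v, c0 ≤ pr (fun q : Fin r → V => Q q ∧ ed EH (Fin.cons u q : Fin (r+1) → V) ∧ ed E (Fin.cons v q : Fin (r+1) → V))) ∧
      ∀ e ∈ EH, ∀ u ∈ e, ∃ q : Fin r → V, Q q ∧ Finset.univ.image (Fin.cons u q : Fin (r+1) → V) = e)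
    (A : Finset V) (hA : (A.card : ℝ) ≤ c2 * Fintype.card V) (J : (Fin (r+1) → V) → Prop) (hJ : pr J ≤ c2) :
    ∃ ω : (Fin (r+1) → V) → ℝ, (∀ x, 0 ≤ ω x) ∧
      (∀ x, ω x ≠ 0 → ed E x ∧ Q (Fin.tail x) ∧ ¬ J x ∧ ∀ i, x i ∉ A) ∧
      (∀ w, ∑ x, ω x * ind (∃ i, x i = w) ≤ 1) ∧
      (Fintype.card V : ℝ) - A.card - 2 / c0 * pr J * Fintype.card V ≤ (r+1) * ∑ x, ω x := by
  classical
  have hcp : 0 < Fintype.card V := by omega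
  have hV0 : Nonempty V := Fintype.card_pos_iff.1 hcp
  have hn0 : (0:ℝ) < Fintype.card V := by exact_mod_cast hcp
  obtain ⟨J', J'd⟩ : ∃ J' : (Fin (r+1) → V) → Prop, ∀ x, J' x ↔ (J x ∨ ∃ i, x i ∈ A) := ⟨_, fun _ => Iff.rfl⟩
  have p1 : pr J' ≤ (r+2) * c2 := by
    have h1 : pr (fun x : Fin (r+1) → V => ∃ i, x i ∈ A) ≤ ∑ _i : Fin (r+1), c2 := by
      refine (pr_exists (Q := fun (i : Fin (r+1)) (x : Fin (r+1) → V) => x i ∈ A) fun x hx => hx).trans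
        (Finset.sum_le_sum fun i _ => ?_)
      rw [pr_coord i (fun v => v ∈ A), pr_card, div_le_iff₀ hn0]; simpa using hA
    have h2 := pr_or (P := J') (Q := J) (R := fun x => ∃ i, x i ∈ A) fun x hx => (J'd x).1 hx
    simp at h1; linarith
  let I := E.filter fun e => ∃ x : Fin (r+1) → V, Finset.univ.image x = e ∧ J' x
  have hI : (I.card : ℝ) ≤ ε1 * (Fintype.card V).choose (r+1) := by
    have a1 : I ⊆ (Finset.univ.filter J').image (fun x => Finset.univ.image x) := by
      intro e he
      obtain ⟨_, x, hx, hb⟩ := Finset.mem_filter.1 he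
      exact Finset.mem_image.2 ⟨x, by simpa using hb, hx⟩
    have a2 : (I.card : ℝ) ≤ (Finset.univ.filter J').card := by
      exact_mod_cast (Finset.card_le_card a1).trans Finset.card_image_le
    rw [card_pr] at a2
    have a3 := pow_le_choose' (r+1) _ hn
    rw [Fintype.card_fun, Fintype.card_fin] at a2
    push_cast at a2
    refine a2.trans ((mul_le_mul p1 a3 (by positivity) (by positivity)).trans ?_)
    rw [← mul_assoc]; gcongr
  obtain ⟨VH, EH, g1, g2, g3, g4, g5, g6, g7⟩ := H I (Finset.filter_subset _ _) hI
  have nJ : ∀ x : Fin (r+1) → V, ed EH x → ¬ J x ∧ ∀ i, x i ∉ A := by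
    intro x hx
    have : ¬ J' x := fun h => g2 _ hx (Finset.mem_filter.2 ⟨g1 hx, x, rfl, h⟩)
    rw [J'd] at this; push Not at this; exact this
  let T : Finset V := Finset.univ.filter fun v => c0 / 2 ≤ pr (fun q : Fin r → V => J (Fin.cons v q))
  let B : Finset V := ((Finset.univ \ VH) \ A) \ T
  have hT : (T.card : ℝ) ≤ 2 / c0 * pr J * Fintype.card V := by
    rw [card_pr]
    have := markov (t := c0/2) (P := fun p : V × (Fin r → V) => J (Fin.cons p.1 p.2))
    rw [← pr_cons] at this
    gcongr
    rw [div_mul_eq_mul_div, le_div_iff₀ hc0]; linarith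
  obtain ⟨u, hu⟩ : VH.Nonempty := by
    rw [← Finset.card_pos]
    have : (0:ℝ) < VH.card := lt_of_lt_of_le (mul_pos (by linarith) hn0) g5
    exact_mod_cast this
  have kS : ∀ e ∈ EH, ∃ x, Finset.univ.image x = e ∧ (fun x : Fin (r+1) → V => ed E x ∧ Q (Fin.tail x) ∧ ¬ J x ∧ ∀ i, x i ∉ A) x := by
    intro e he
    obtain ⟨u, hu⟩ : e.Nonempty := by rw [← Finset.card_pos, hE e (g1 he)]; omega
    obtain ⟨q, q1, q2⟩ := g7 e he u hu
    have : ed EH (Fin.cons u q : Fin (r+1) → V) := by unfold ed; rwa [q2]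
    exact ⟨_, q2, g1 this, by rwa [Fin.tail_cons], nJ _ this⟩
  have kD : Disjoint B VH := by
    rw [Finset.disjoint_left]; intro v hv
    simp only [B, Finset.mem_sdiff] at hv; exact hv.1.1.2
  have kC : (B.card : ℝ) ≤ α * Fintype.card V := by
    have : B.card ≤ Fintype.card V - VH.card := by
      rw [← Finset.card_univ, ← Finset.card_sdiff_of_subset (Finset.subset_univ VH)]
      exact Finset.card_le_card (Finset.sdiff_subset.trans Finset.sdiff_subset)
    have h2 : B.card + VH.card ≤ Fintype.card V := by have := Finset.card_le_univ VH; omega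
    have h3 : (B.card : ℝ) + VH.card ≤ Fintype.card V := by exact_mod_cast h2
    linarith
  have kE : ∀ v ∈ B, c0 / 2 ≤ pr (fun q : Fin r → V => (fun x : Fin (r+1) → V => ed E x ∧ Q (Fin.tail x) ∧ ¬ J x ∧ ∀ i, x i ∉ A) (Fin.cons v q) ∧ ∀ i, q i ∈ VH) := by
    intro v hv
    simp only [B, T, Finset.mem_sdiff, Finset.mem_filter, Finset.mem_univ, true_and, not_le] at hv
    obtain ⟨⟨hv1, hv2⟩, hv3⟩ := hv
    have h1 := (g6 u hu v).trans (pr_or (Q := fun q : Fin r → V => (ed E (Fin.cons v q : Fin (r+1) → V) ∧ Q (Fin.tail (Fin.cons v q : Fin (r+1) → V)) ∧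
      ¬ J (Fin.cons v q) ∧ ∀ i, (Fin.cons v q : Fin (r+1) → V) i ∉ A) ∧ ∀ i, q i ∈ VH)
      (R := fun q : Fin r → V => J (Fin.cons v q)) fun q hq => ?_)
    · linarith
    · obtain ⟨q1, q2, q3⟩ := hq
      rw [or_iff_not_imp_right]; intro hj
      have hqV : ∀ i, q i ∈ VH := fun i => g3 _ q2 (by rw [image_cons]; exact Finset.mem_insert_of_mem (Finset.mem_image_of_mem q (Finset.mem_univ i)))
      have hqA : ∀ i, q i ∉ A := fun i => (nJ _ q2).2 i.succ
      refine ⟨⟨q3, by rwa [Fin.tail_cons], hj, fun i => ?_⟩, hqV⟩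
      refine Fin.cases ?_ (fun i => ?_) i
      · exact hv2
      · exact hqA i
  obtain ⟨ω, w1, w2, w3, w4⟩ := frac (S := fun x : Fin (r+1) → V => ed E x ∧ Q (Fin.tail x) ∧ ¬ J x ∧ ∀ i, x i ∉ A) (half_pos hc0) hγ g4 g3 kS kD kC kE
  refine ⟨ω, w1, w2, w3, le_trans ?_ w4⟩
  have : Fintype.card V ≤ VH.card + B.card + A.card + T.card := by
    rw [← Finset.card_univ]
    have : (Finset.univ : Finset V) ⊆ VH ∪ B ∪ A ∪ T := by
      intro v _
      simp only [B, Finset.mem_union, Finset.mem_sdiff, Finset.mem_univ, true_and]; tauto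
    refine (Finset.card_le_card this).trans ?_
    have i1 := Finset.card_union_le (VH ∪ B ∪ A) T
    have i2 := Finset.card_union_le (VH ∪ B) A
    have i3 := Finset.card_union_le VH B
    omega
  have : (Fintype.card V : ℝ) ≤ VH.card + B.card + A.card + T.card := by exact_mod_cast this
  linarith

lemma iface (r d : ℕ) (hd : 1 ≤ d) (hdr : d ≤ r) (δ : ℝ) (hδ : 0 < δ) (h : HamFrameworkProp (r+1) d δ)
    (μ : ℝ) (hμ : 0 < μ) (hδμ : δ + μ ≤ 1) : ∃ (c K c2 : ℝ) (s n0 : ℕ), 0 < c ∧ c ≤ 1 ∧ 0 < K ∧ 0 < c2 ∧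
    ∀ (V : Type) [Fintype V] [DecidableEq V] (E : Finset (Finset V)), n0 ≤ Fintype.card V → (∀ e ∈ E, e.card = r+1) →
    (∀ S : Finset V, S.card = d → (δ + μ) * (((Fintype.card V - d).choose (r + 1 - d) : ℕ) : ℝ)
          ≤ ((E.filter fun e => S ⊆ e).card : ℝ)) → ∃ Q : (Fin r → V) → Prop, Iface r c K c2 s E Q := by
  obtain ⟨γ0, hγ0, h⟩ := h μ hμ
  set γ := min γ0 1 with hγ
  have hγp : 0 < γ := lt_min hγ0 one_pos
  obtain ⟨α0, hα0, h⟩ := h γ hγp (min_le_left _ _)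
  set c0 : ℝ := μ / (2 * r.factorial) with hc0
  have hc0p : 0 < c0 := by positivity
  have hc01 : c0 ≤ 1 := by
    have : (1:ℝ) ≤ r.factorial := by exact_mod_cast Nat.succ_le_of_lt r.factorial_pos
    rw [hc0, div_le_one (by positivity)]; linarith
  set α := min α0 (min (μ / (16 * (r+1))) (min (c0 / (4 * (r+1))) (γ * c0 / (2 * (r+1))))) with hα
  have hαp : 0 < α := by simp only [hα, lt_min_iff]; refine ⟨hα0, ?_, ?_, ?_⟩ <;> positivity
  have α1 : α * (r+1) ≤ μ / 16 := by
    have : α ≤ μ / (16 * (r+1)) := (min_le_right _ _).trans (min_le_left _ _)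
    rw [le_div_iff₀ (by positivity)] at this ⊢; linarith
  have α2 : α ≤ c0 / (4 * (r+1)) := (min_le_right _ _).trans ((min_le_right _ _).trans (min_le_left _ _))
  have α3 : r * α / (c0/2) ≤ γ := by
    have : α ≤ γ * c0 / (2 * (r+1)) := (min_le_right _ _).trans ((min_le_right _ _).trans (min_le_right _ _))
    rw [le_div_iff₀ (by positivity)] at this
    rw [div_le_iff₀ (by positivity)]; nlinarith
  have α4 : α ≤ 1/2 := by nlinarith [(by positivity : (0:ℝ) ≤ r)]
  obtain ⟨ε, hε, h⟩ := h α hαp (min_le_left _ _)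
  obtain ⟨t0, h⟩ := h ε hε le_rfl
  obtain ⟨c1, ε1, s, hc1, hε1, CS⟩ := classSel r ε hε
  set c2 := min c1 (ε1 / ((r+2) * (2^(r+1) * (r+1).factorial))) with hc2
  have hc2p : 0 < c2 := lt_min hc1 (by positivity)
  have hc22 : (r+2) * c2 * (2^(r+1) * (r+1).factorial) ≤ ε1 := by
    have : c2 ≤ ε1 / ((r+2) * (2^(r+1) * (r+1).factorial)) := min_le_right _ _
    rw [le_div_iff₀ (by positivity)] at this; linarith
  refine ⟨c0, 2 / c0, c2, s, max t0 (max (2 * (r+1)) (Nat.ceil ((r+1) / α))), hc0p, hc01, by positivity, hc2p, ?_⟩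
  intro V _ _ E hn hE hdeg
  simp only [max_le_iff] at hn
  obtain ⟨n1, n2, n3⟩ := hn
  have n4 : (r:ℝ) + 1 ≤ α * Fintype.card V := by
    have := (Nat.le_ceil _).trans (Nat.cast_le (α := ℝ).2 n3)
    rw [div_le_iff₀ hαp] at this; linarith
  have hdeg1 := deg_one hd (by omega : d ≤ r+1) (by omega) hE (δ + μ) hdeg
  simp only [Nat.add_sub_cancel] at hdeg1
  obtain ⟨Q, Q1, Q2⟩ := CS V E hE n2 (fun VH EH => (∀ e ∈ EH, e ⊆ VH) ∧ RobustlyMatchable γ VH EH ∧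
    (1 - α) * Fintype.card V ≤ VH.card ∧
    ∀ v ∈ VH, (1 - δ + γ) * (((VH.card - 1).choose r : ℕ) : ℝ) ≤ ((EH.filter fun e => v ∈ e).card : ℝ)) (by
      intro I hIE hI
      obtain ⟨VH, EH, f1, f2, f3, f4, f5, f6, f7, f8, f9⟩ := h _ n1 V Finset.univ E Finset.card_univ
        (fun e he => ⟨Finset.subset_univ _, hE e he⟩) (fun S _ hS => hdeg S hS) I hIE hI
      exact ⟨VH, EH, f2, f4, f6, f7, f3, f8, by simpa using f5, by simpa using f9⟩)
  have Q3 : ∀ I ⊆ E, (I.card : ℝ) ≤ ε1 * (Fintype.card V).choose (r+1) → ∃ VH EH, EH ⊆ E ∧ (∀ e ∈ EH, e ∉ I) ∧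
      (∀ e ∈ EH, e ⊆ VH) ∧ RobustlyMatchable γ VH EH ∧ (1 - α) * Fintype.card V ≤ VH.card ∧
      (∀ u ∈ VH, ∀ v, c0 ≤ pr (fun q : Fin r → V => Q q ∧ ed EH (Fin.cons u q : Fin (r+1) → V) ∧ ed E (Fin.cons v q : Fin (r+1) → V))) ∧
      ∀ e ∈ EH, ∀ u ∈ e, ∃ q : Fin r → V, Q q ∧ Finset.univ.image (Fin.cons u q : Fin (r+1) → V) = e := by
    intro I hIE hI
    obtain ⟨VH, EH, f1, f2, ⟨f3, f4, f5, f6⟩, f7⟩ := Q2 I hIE hI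
    exact ⟨VH, EH, f1, f2, f3, f4, f5, common hαp.le α1 hμ hγp.le (min_le_right _ _) hδ hδμ hE f1 n4 hdeg1 f5 f6 f7, f7⟩
  refine ⟨Q, fun q q' hq hq' => ?_, ?_, fun A hA J hJ => iface_core hE n2 hc0p hc2p.le hc22 α4 α3 Q3 A hA J hJ⟩
  · obtain ⟨idx, i1, i2, i3⟩ := Q1 q q' hq hq'
    exact ⟨idx, i1, i2, (min_le_left _ _).trans i3⟩
  · obtain ⟨VH, EH, f1, f2, f3, f4, f5, f6, f7⟩ := Q3 ∅ (Finset.empty_subset _) (by simp; positivity)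
    refine ⟨fun v => v ∈ VH, ?_, fun u hu v => (f6 u hu v).trans (pr_mono fun q hq => ⟨hq.1, f1 hq.2.1, hq.2.2⟩)⟩
    have hcp : 0 < Fintype.card V := by omega
    have hV0 : Nonempty V := Fintype.card_pos_iff.1 hcp
    have hn0 : (0:ℝ) < Fintype.card V := by exact_mod_cast hcp
    refine le_trans ?_ α2
    rw [pr_not, pr_card, sub_le_comm, le_div_iff₀ hn0]
    simpa using f5

lemma pr_pi {ι α : Type*} [Fintype ι] [DecidableEq ι] [Fintype α] (A : ι → α → Prop) :
    pr (fun x : ι → α => ∀ i, A i (x i)) = ∏ i, pr (A i) := by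
  unfold pr ex
  rw [Finset.prod_div_distrib, Finset.prod_univ_sum, Fintype.card_fun]
  congr 1
  · rw [Fintype.piFinset_univ]
    refine Finset.sum_congr rfl fun x _ => ?_
    show ind (∀ i, A i (x i)) = _
    by_cases h : ∀ i, A i (x i)
    · rw [ind_true h, Finset.prod_eq_one]; intro i _; exact ind_true (h i)
    · rw [ind_false h]; push Not at h; obtain ⟨i, hi⟩ := h
      exact (Finset.prod_eq_zero (Finset.mem_univ i) (ind_false hi)).symm
  · simp

lemma pr_sum {α γ : Type*} [Fintype α] [Fintype γ] (g : α → γ) (P : α → Prop) :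
    pr P = ∑ c, pr (fun x => P x ∧ g x = c) := by
  classical
  unfold pr; rw [← ex_sum]; congr 1; ext x
  rw [Finset.sum_eq_single (g x)]
  · by_cases h : P x <;> simp [ind, h]
  · intro b _ hb; exact ind_false fun h => hb h.2.symm
  · simp

lemma pr_eq_le {ι V : Type} [Fintype ι] [DecidableEq ι] [Fintype V] [Nonempty V] {i j : ι} (h : i ≠ j) :
    pr (fun ω : ι → V => ω i = ω j) ≤ 1 / Fintype.card V := by
  classical
  have hg : Function.Injective (![i, j] : Fin 2 → ι) := by
    intro a b; fin_cases a <;> fin_cases b <;> simp [h, h.symm]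
  have h1 := pr_marg (V := V) (![i, j]) hg (fun w => w 0 = w 1)
  simp only [Matrix.cons_val_zero, Matrix.cons_val_one] at h1
  rw [h1, ← pr_equiv (finTwoArrowEquiv V).symm]
  refine pr_prod_le (by positivity) fun a => ?_
  rw [pr_card]
  gcongr
  have : (Finset.univ.filter fun b : V => (finTwoArrowEquiv V).symm (a, b) 0 = (finTwoArrowEquiv V).symm (a, b) 1) ⊆ {a} := by
    intro b hb
    simp [finTwoArrowEquiv] at hb; simp [hb]
  exact_mod_cast (Finset.card_le_card this).trans (by simp)

lemma avoid_pr {ι V : Type} [Fintype ι] [DecidableEq ι] [Fintype V] [Nonempty V] [DecidableEq V] (P : (ι → V) → Prop) (W : Finset V) :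
    pr P ≤ pr (fun ω => P ω ∧ Function.Injective ω ∧ ∀ i, ω i ∉ W) +
      (Fintype.card ι * W.card + (Fintype.card ι : ℝ) ^ 2) / Fintype.card V := by
  classical
  have h1 : pr (fun ω : ι → V => ∃ i, ω i ∈ W) ≤ Fintype.card ι * W.card / Fintype.card V := by
    refine (pr_exists (Q := fun i (ω : ι → V) => ω i ∈ W) fun _ h => h).trans ?_
    have : ∀ i : ι, pr (fun ω : ι → V => ω i ∈ W) = (W.card : ℝ) / Fintype.card V := by
      intro i
      rw [pr_coord i (fun v => v ∈ W), pr_card]; simp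
    simp [this, mul_div_assoc]
  have h2 : pr (fun ω : ι → V => ¬ Function.Injective ω) ≤ (Fintype.card ι : ℝ) ^ 2 / Fintype.card V := by
    refine (pr_exists (Q := fun (p : ι × ι) (ω : ι → V) => p.1 ≠ p.2 ∧ ω p.1 = ω p.2) ?_).trans ?_
    · intro ω h
      simp only [Function.Injective] at h; push Not at h
      obtain ⟨a, b, h1, h2⟩ := h; exact ⟨(a, b), h2, h1⟩
    · refine (Finset.sum_le_card_nsmul _ _ (1 / (Fintype.card V : ℝ)) ?_).trans ?_
      · rintro ⟨i, j⟩ _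
        by_cases h : i = j
        · rw [pr_false]; positivity
          intro x hx; exact hx.1 h
        · exact (pr_mono fun x hx => hx.2).trans (pr_eq_le h)
      · simp only [Finset.card_univ, Fintype.card_prod, nsmul_eq_mul]; push_cast
        rw [mul_one_div, sq]
  have h3 := pr_or (P := P) (Q := fun ω => P ω ∧ Function.Injective ω ∧ ∀ i, ω i ∉ W)
    (R := fun ω => (∃ i, ω i ∈ W) ∨ ¬ Function.Injective ω) fun ω h => by
      by_cases h1 : ∃ i, ω i ∈ W <;> by_cases h2 : Function.Injective ω <;> simp_all
  have h4 := pr_or (P := fun ω : ι → V => (∃ i, ω i ∈ W) ∨ ¬ Function.Injective ω) fun ω h => h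
  rw [add_div]; linarith

lemma sdr {ι α : Type} [Fintype ι] [DecidableEq α] (t : ι → Finset α) (h : ∀ i, Fintype.card ι ≤ (t i).card) :
    ∃ f : ι → α, Function.Injective f ∧ ∀ i, f i ∈ t i := by
  classical
  rw [← Finset.all_card_le_biUnion_card_iff_exists_injective]
  intro s
  rcases s.eq_empty_or_nonempty with rfl | ⟨i, hi⟩
  · simp
  · exact (Finset.card_le_univ s).trans ((h i).trans (Finset.card_le_card (Finset.subset_biUnion_of_mem t hi)))

lemma cons_inj {ι V : Type} {N : ℕ} {a : ι → V} {ω : Fin N → ι → V} (h1 : Function.Injective a)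
    (h2 : Function.Injective fun p : Fin N × ι => ω p.1 p.2) (h3 : ∀ j i i', ω j i ≠ a i') :
    Function.Injective fun p : Fin (N+1) × ι => (Fin.cons a ω : Fin (N+1) → ι → V) p.1 p.2 := by
  rintro ⟨j, i⟩ ⟨j', i'⟩
  refine Fin.cases ?_ (fun j => ?_) j <;> refine Fin.cases ?_ (fun j' => ?_) j'
  · intro h; simp only [Fin.cons_zero] at h; rw [h1 h]
  · intro h; simp only [Fin.cons_zero, Fin.cons_succ] at h; exact absurd h.symm (h3 _ _ _)
  · intro h; simp only [Fin.cons_zero, Fin.cons_succ] at h; exact absurd h (h3 _ _ _)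
  · intro h; simp only [Fin.cons_succ] at h
    have := h2 (a₁ := (j, i)) (a₂ := (j', i')) h
    simp only [Prod.mk.injEq] at this; simp [this]

lemma sel_aux {ι V T : Type} [Fintype ι] [DecidableEq ι] [Fintype V] [Nonempty V] [DecidableEq V] [Fintype T] [Nonempty T] {p : ℝ} (hp : 0 < p)
    (A : T → (ι → V) → Prop) (hA : ∀ τ, p ≤ pr (A τ)) : ∀ (N : ℕ) (W : Finset V) (c : T → ℝ), (∀ τ, 0 ≤ c τ) →
    ((Fintype.card ι : ℝ) * (W.card + N * Fintype.card ι) + (Fintype.card ι : ℝ) ^ 2) ≤ p / 2 * Fintype.card V →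
    ∃ ω : Fin N → ι → V, (Function.Injective fun q : Fin N × ι => ω q.1 q.2) ∧ (∀ j i, ω j i ∉ W) ∧
      ∑ τ, c τ * ∏ j, (1 - ind (A τ (ω j)) / 2) ≤ (1 - p / 4) ^ N * ∑ τ, c τ := by
  classical
  intro N
  have hn : (0:ℝ) < Fintype.card V := by exact_mod_cast Fintype.card_pos
  have hp1 : p ≤ 1 := (hA (Classical.arbitrary T)).trans (pr_le_one _)
  induction N with
  | zero =>
    intro W c hc _
    exact ⟨Fin.elim0, fun a => a.1.elim0, fun a => a.elim0, by simp⟩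
  | succ N ih =>
    intro W c hc hW
    obtain ⟨G, hG⟩ : ∃ G : (ι → V) → Prop, ∀ ω, G ω ↔ Function.Injective ω ∧ ∀ i, ω i ∉ W := ⟨_, fun _ => Iff.rfl⟩
    have hGA : ∀ τ, p / 2 ≤ pr (fun ω => A τ ω ∧ G ω) := by
      intro τ
      have h1 := avoid_pr (A τ) W
      have h2 : (Fintype.card ι * W.card + (Fintype.card ι : ℝ) ^ 2) / Fintype.card V ≤ p / 2 := by
        rw [div_le_iff₀ hn]; refine le_trans ?_ hW
        gcongr; push_cast
        nlinarith [show (0:ℝ) ≤ (N+1) * Fintype.card ι by positivity]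
      simp only [hG]; linarith [hA τ]
    have key : ex (fun ω => ind (G ω) * ∑ τ, c τ * (1 - ind (A τ ω) / 2)) ≤
        ex (fun ω => ind (G ω) * ((1 - p / 4) * ∑ τ, c τ)) := by
      have e1 : ∀ ω, ind (G ω) * ∑ τ, c τ * (1 - ind (A τ ω) / 2) = ∑ τ, (c τ * ind (G ω) - c τ / 2 * ind (A τ ω ∧ G ω)) := by
        intro ω; rw [Finset.mul_sum]
        refine Finset.sum_congr rfl fun τ _ => ?_
        by_cases h1 : A τ ω <;> by_cases h2 : G ω <;> simp [ind, h1, h2]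
        ring
      simp only [e1]
      rw [ex_sum]
      have e2 : ex (fun ω => ind (G ω) * ((1 - p / 4) * ∑ τ, c τ)) = ∑ τ, (1 - p / 4) * c τ * pr G := by
        rw [← Finset.sum_mul, ← Finset.mul_sum, pr, ← ex_mul]; congr 1; ext ω; ring
      rw [e2]
      refine Finset.sum_le_sum fun τ _ => ?_
      rw [ex_sub, ex_mul, ex_mul]
      have h1 := hGA τ
      have h2 := pr_le_one G
      have h3 : p / 2 * pr G ≤ pr (fun ω => A τ ω ∧ G ω) := by nlinarith
      change c τ * pr G - c τ / 2 * pr (fun ω => A τ ω ∧ G ω) ≤ _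
      nlinarith [hc τ]
    obtain ⟨a, ha, hac⟩ : ∃ a, G a ∧ ∑ τ, c τ * (1 - ind (A τ a) / 2) ≤ (1 - p / 4) * ∑ τ, c τ := by
      by_contra hcon
      push Not at hcon
      refine absurd key (not_le.2 ?_)
      unfold ex
      refine div_lt_div_of_pos_right ?_ (by exact_mod_cast Fintype.card_pos)
      obtain ⟨x, hx⟩ := pr_pos (lt_of_lt_of_le (half_pos hp) (hGA (Classical.arbitrary T)))
      refine Finset.sum_lt_sum (fun ω _ => ?_) ⟨x, Finset.mem_univ _, ?_⟩
      · by_cases h : G ω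
        · rw [ind_true h]; linarith [hcon ω h]
        · rw [ind_false h]; simp
      · rw [ind_true hx.2]; linarith [hcon x hx.2]
    rw [hG] at ha
    obtain ⟨ω, w1, w2, w3⟩ := ih (W ∪ Finset.univ.image a) (fun τ => c τ * (1 - ind (A τ a) / 2))
      (fun τ => mul_nonneg (hc τ) (by linarith [ind_le_one (A τ a)])) (by
        refine le_trans ?_ hW
        have h1 : ((W ∪ Finset.univ.image a).card : ℝ) ≤ W.card + Fintype.card ι := by
          exact_mod_cast (Finset.card_union_le _ _).trans (Nat.add_le_add_left Finset.card_image_le _)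
        gcongr ?_ * ?_ + _
        push_cast; linarith)
    refine ⟨Fin.cons a ω, cons_inj ha.1 w1 fun j i i' h => w2 j i ?_, ?_, ?_⟩
    · rw [h]; simp
    · intro j i
      refine Fin.cases ?_ (fun j => ?_) j
      · exact ha.2 i
      · rw [Fin.cons_succ]; exact fun h => w2 j i (Finset.mem_union_left _ h)
    · simp only [Fin.prod_univ_succ, Fin.cons_zero, Fin.cons_succ]
      simp only [mul_assoc] at w3 ⊢
      refine w3.trans ?_
      rw [pow_succ, mul_assoc]
      exact mul_le_mul_of_nonneg_left hac (pow_nonneg (by linarith) _)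

lemma sel (s a : ℕ) (p : ℝ) (hp : 0 < p) : ∃ β0 : ℝ, 0 < β0 ∧ β0 ≤ 1 ∧ ∀ β : ℝ, 0 < β → β ≤ β0 → ∃ n0 : ℕ, ∀ (V : Type) [Fintype V] [DecidableEq V],
    n0 ≤ Fintype.card V → ∀ (ι T : Type) [Fintype ι] [DecidableEq ι] [Fintype T] [Nonempty T], Fintype.card ι = s → Fintype.card T ≤ (Fintype.card V) ^ a →
    ∀ (A : T → (ι → V) → Prop), (∀ τ, p ≤ pr (A τ)) → ∀ W : Finset V, (W.card : ℝ) ≤ β0 * Fintype.card V →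
    ∃ (N : ℕ) (ω : Fin N → ι → V), β / 2 * Fintype.card V ≤ N ∧ (N : ℝ) ≤ β * Fintype.card V ∧
      (Function.Injective fun q : Fin N × ι => ω q.1 q.2) ∧ (∀ j i, ω j i ∉ W) ∧
      ∀ τ, ∀ t : Finset (Fin N), (∀ j, A τ (ω j) → j ∈ t) → p / 8 * N ≤ t.card := by
  classical
  have hs : (0:ℝ) < (s + 1) ^ 2 := by positivity
  refine ⟨min 1 (p / (8 * (s+1)^2)), by positivity, min_le_left _ _, fun β hβ hβ0 => ?_⟩
  have hb : β ≤ p / (8 * (s+1)^2) := hβ0.trans (min_le_right _ _)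
  have hev : ∀ᶠ n : ℕ in Filter.atTop, ((n:ℝ)) ^ a < Real.exp (p * β / 16 * n) := by
    have h1 := Real.tendsto_pow_mul_exp_neg_atTop_nhds_zero a
    have h2 : Filter.Tendsto (fun n : ℕ => p * β / 16 * (n:ℝ)) Filter.atTop Filter.atTop :=
      Filter.Tendsto.const_mul_atTop (by positivity) tendsto_natCast_atTop_atTop
    have h3 := h1.comp h2
    have h4 := h3.eventually (gt_mem_nhds (show (0:ℝ) < (p * β / 16) ^ a by positivity))
    filter_upwards [h4] with n hn
    simp only [Function.comp, Real.exp_neg] at hn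
    rw [mul_inv_lt_iff₀ (Real.exp_pos _), mul_pow] at hn
    exact lt_of_mul_lt_mul_left hn (by positivity)
  obtain ⟨n1, hn1⟩ := Filter.eventually_atTop.1 hev
  refine ⟨max n1 (max 1 (max ⌈2/β⌉₊ ⌈8 * (s+1)^2/p⌉₊)), ?_⟩
  intro V _ _ hn ι T _ _ _ _ hι hT A hA W hW
  simp only [max_le_iff] at hn
  obtain ⟨g1, g2, g3, g4⟩ := hn
  have hV : Nonempty V := Fintype.card_pos_iff.1 g2
  set n : ℝ := ((Fintype.card V : ℕ) : ℝ) with hnd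
  have hn0 : 0 < n := by rw [hnd]; exact_mod_cast g2
  have g3' : 2 ≤ β * n := by
    have := (Nat.ceil_le.1 g3); rw [div_le_iff₀ hβ] at this; linarith
  have g4' : 8 * (s+1)^2 ≤ p * n := by
    have := (Nat.ceil_le.1 g4); rw [div_le_iff₀ hp] at this; push_cast at this; linarith
  set N := ⌊β * n⌋₊ with hN
  have hN1 : (N:ℝ) ≤ β * n := Nat.floor_le (by positivity)
  have hN2 : β / 2 * n ≤ N := by
    have := Nat.lt_floor_add_one (β * n); rw [← hN] at this; linarith
  have hbn : β * n ≤ p * n / (8 * (s+1)^2) := by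
    rw [mul_div_right_comm]; gcongr
  have hWn : (W.card : ℝ) ≤ p * n / (8 * (s+1)^2) := by
    rw [mul_div_right_comm]; refine hW.trans ?_; gcongr; exact min_le_right _ _
  have hX : p * n / (8 * (s+1)^2) * (s+1)^2 = p * n / 8 := by field_simp
  have hs0 : (0:ℝ) ≤ s := Nat.cast_nonneg s
  obtain ⟨ω, w1, w2, w3⟩ := sel_aux hp A hA N W (fun _ => 1) (by simp) (by
    rw [hι, ← hnd]
    have h1 : (s:ℝ) * (W.card + N * s) ≤ s * (p * n / (8 * (s+1)^2) + p * n / (8 * (s+1)^2) * s) := by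
      gcongr; linarith
    have h2 : (s:ℝ) * (p * n / (8 * (s+1)^2) + p * n / (8 * (s+1)^2) * s) ≤ p * n / 8 := by
      rw [← hX]
      have : 0 ≤ p * n / (8 * (s+1)^2) := by positivity
      nlinarith
    nlinarith)
  refine ⟨N, ω, hN2, hN1, w1, w2, fun τ t ht => ?_⟩
  have hp1 : p ≤ 1 := (hA τ).trans (pr_le_one _)
  have h1 : (1/2 : ℝ) ^ t.card ≤ ∏ j, (1 - ind (A τ (ω j)) / 2) := by
    have : (1/2 : ℝ) ^ t.card = ∏ j : Fin N, if j ∈ t then (1/2 : ℝ) else 1 := by simp [Finset.prod_ite_mem]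
    rw [this]
    refine Finset.prod_le_prod (fun j _ => by split_ifs <;> norm_num) fun j _ => ?_
    split_ifs with h
    · linarith [ind_le_one (A τ (ω j))]
    · rw [ind_false fun h' => h (ht j h')]; norm_num
  have h2 : ∏ j, (1 - ind (A τ (ω j)) / 2) ≤ ∑ τ, 1 * ∏ j, (1 - ind (A τ (ω j)) / 2) := by
    simp only [one_mul]
    refine Finset.single_le_sum (f := fun τ => ∏ j, (1 - ind (A τ (ω j)) / 2)) (fun τ _ => Finset.prod_nonneg fun j _ => ?_) (Finset.mem_univ τ)
    linarith [ind_le_one (A τ (ω j))]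
  have h3 : (1 - p / 4) ^ N ≤ Real.exp (-(p / 4 * N)) := by
    have : (1 - p / 4) ≤ Real.exp (-(p/4)) := by linarith [Real.add_one_le_exp (-(p/4))]
    refine (pow_le_pow_left₀ (by linarith) this N).trans ?_
    rw [← Real.exp_nat_mul]; apply le_of_eq; congr 1; ring
  have h4 : (∑ _τ : T, (1:ℝ)) ≤ Real.exp (p / 8 * N) := by
    simp only [Finset.sum_const, Finset.card_univ, nsmul_eq_mul, mul_one]
    refine (show (Fintype.card T : ℝ) ≤ n ^ a by rw [hnd]; exact_mod_cast hT).trans ((hn1 _ g1).le.trans ?_)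
    rw [Real.exp_le_exp, ← hnd]; nlinarith
  have h5 : Real.exp (-(t.card : ℝ)) ≤ (1/2:ℝ) ^ t.card := by
    have : Real.exp (-1) ≤ 1/2 := by
      rw [Real.exp_neg, one_div]; exact inv_anti₀ (by norm_num) (by linarith [Real.add_one_le_exp (1:ℝ)])
    refine le_trans (le_of_eq ?_) (pow_le_pow_left₀ (Real.exp_pos _).le this _)
    rw [← Real.exp_nat_mul]; congr 1; ring
  have h6 : Real.exp (-(t.card : ℝ)) ≤ Real.exp (-(p / 4 * N)) * Real.exp (p / 8 * N) :=
    h5.trans (h1.trans (h2.trans (w3.trans (by gcongr))))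
  rw [← Real.exp_add, Real.exp_le_exp] at h6
  linarith

lemma multi0 (k j : ℕ) : ∀ d : ℝ, 0 < d → ∃ c : ℝ, 0 < c ∧ ∀ (α : Type) [Fintype α]
    (S : (Fin k → α) → Prop), d ≤ pr S →
      c ≤ pr (fun w : Fin k → (Fin j → Bool) → α => ∀ φ : Fin k → (Fin j → Bool), S (fun i => w i (φ i))) := by
  induction j with
  | zero =>
    intro d hd
    refine ⟨d, hd, fun α _ S hS => hS.trans ?_⟩
    let e : (Fin k → α) ≃ (Fin k → (Fin 0 → Bool) → α) :=
      ⟨fun x i _ => x i, fun w i => w i Fin.elim0, fun x => rfl, fun w => by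
        ext i t; simp only; congr 1; exact Subsingleton.elim _ _⟩
    rw [← pr_equiv e]
    exact pr_mono fun x hx φ => hx
  | succ j ih =>
    intro d hd
    obtain ⟨c1, hc1, h1⟩ := ih d hd
    obtain ⟨c2, hc2, h2⟩ := double k c1 hc1
    refine ⟨c2, hc2, fun α _ S hS => (h2 _ _ (h1 α S hS)).trans ?_⟩
    let e : (Fin k → (Fin j → Bool) → α) × (Fin k → (Fin j → Bool) → α) ≃ (Fin k → (Fin (j+1) → Bool) → α) :=
      ⟨fun p i t => if t 0 then p.2 i (Fin.tail t) else p.1 i (Fin.tail t),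
        fun w => (fun i t => w i (Fin.cons false t), fun i t => w i (Fin.cons true t)),
        fun p => by ext i t <;> simp, fun w => by
          ext i t; simp only
          cases h : t 0
          · simp only [Bool.false_eq_true, if_false]; rw [← h, Fin.cons_self_tail]
          · simp only [if_true]; rw [← h, Fin.cons_self_tail]⟩
    rw [← pr_equiv e]
    refine pr_mono fun p hp φ => ?_
    have := hp (fun i => φ i 0) (fun i => Fin.tail (φ i))
    convert this using 2 with i
    simp only [e, mix, Equiv.coe_fn_mk]
    split_ifs <;> rfl

lemma multi (k j : ℕ) (d : ℝ) (hd : 0 < d) : ∃ c : ℝ, 0 < c ∧ ∀ (α : Type) [Fintype α]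
    (S : (Fin k → α) → Prop), d ≤ pr S →
      c ≤ pr (fun w : Fin (2^j) × Fin k → α => ∀ φ : Fin k → Fin (2^j), S (fun i => w (φ i, i))) := by
  obtain ⟨c, hc, h⟩ := multi0 k j d hd
  refine ⟨c, hc, fun α _ S hS => (h α S hS).trans ?_⟩
  let e0 : Fin (2^j) ≃ (Fin j → Bool) := Fintype.equivOfCardEq (by simp)
  let e : (Fin k → (Fin j → Bool) → α) ≃ (Fin (2^j) × Fin k → α) :=
    ⟨fun w p => w p.2 (e0 p.1), fun w i t => w (e0.symm t, i), fun w => by ext; simp, fun w => by ext; simp⟩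
  rw [← pr_equiv e]
  exact pr_mono fun w hw φ => hw fun i => e0 (φ i)

section
variable {V C : Type} [Fintype V] [DecidableEq V] [Fintype C] {k : ℕ}

def Low (S : (Fin k → V) → Prop) (χ : V → C) (κ : ℝ) (f : Fin k → C) : Prop :=
  pr (fun x => S x ∧ χ ∘ x = f) ≤ κ * pr (fun x : Fin k → V => χ ∘ x = f)

def Her (S : (Fin k → V) → Prop) (χ : V → C) (ρ κ : ℝ) (f : Fin k → C) : Prop :=
  ∀ A : Fin k → V → Prop, (∀ i v, A i v → χ v = f i) → (∀ i, ρ * pr (fun v => χ v = f i) ≤ pr (A i)) →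
    κ * pr (fun x : Fin k → V => ∀ i, A i (x i)) ≤ pr (fun x => S x ∧ ∀ i, A i (x i))

lemma wref (S : (Fin k → V) → Prop) (χ : V → C) {ρ κ ε : ℝ} (hρ : 0 ≤ ρ) (hκ : 0 < κ)
    (hE : ε ≤ pr (fun x => ¬ Low S χ (κ^2) (χ ∘ x) ∧ ¬ Her S χ ρ (κ^2) (χ ∘ x))) :
    ∃ χ' : V → C × ((Fin k → C) → Fin k → Bool),
      pr (fun x => Low S χ (κ^2) (χ ∘ x)) + ρ^k * ε - κ ≤ pr (fun x => Low S χ' κ (χ' ∘ x)) := by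
  classical
  have : ∀ f, ∃ A : Fin k → V → Prop, ¬ Her S χ ρ (κ^2) f → (∀ i v, A i v → χ v = f i) ∧
      (∀ i, ρ * pr (fun v => χ v = f i) ≤ pr (A i)) ∧
      pr (fun x => S x ∧ ∀ i, A i (x i)) < κ^2 * pr (fun x : Fin k → V => ∀ i, A i (x i)) := by
    intro f
    by_cases h : Her S χ ρ (κ^2) f
    · exact ⟨fun _ _ => True, fun h' => absurd h h'⟩
    · unfold Her at h; push Not at h
      obtain ⟨A, h1, h2, h3⟩ := h
      exact ⟨A, fun _ => ⟨h1, h2, h3⟩⟩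
  choose A hA using this
  obtain ⟨L, hL⟩ : ∃ L : (Fin k → C) → Prop, ∀ f, L f ↔ Low S χ (κ^2) f := ⟨_, fun _ => Iff.rfl⟩
  obtain ⟨H, hH⟩ : ∃ H : (Fin k → C) → Prop, ∀ f, H f ↔ Her S χ ρ (κ^2) f := ⟨_, fun _ => Iff.rfl⟩
  simp only [← hL, ← hH] at hE hA ⊢
  let χ' : V → C × ((Fin k → C) → Fin k → Bool) := fun v => (χ v, fun f i => decide (A f i v))
  refine ⟨χ', ?_⟩
  obtain ⟨L', hL'⟩ : ∃ L' : (Fin k → C × ((Fin k → C) → Fin k → Bool)) → Prop, ∀ f, L' f ↔ Low S χ' κ f := ⟨_, fun _ => Iff.rfl⟩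
  simp only [← hL']
  obtain ⟨Z, hZ⟩ : ∃ Z : (Fin k → V) → Prop, ∀ x, Z x ↔ (L (χ ∘ x) ∨ (¬ L (χ ∘ x) ∧ ¬ H (χ ∘ x) ∧ ∀ i, A (χ ∘ x) i (x i))) :=
    ⟨_, fun _ => Iff.rfl⟩
  have hbox : ∀ f : Fin k → C, ¬ H f → ρ^k * pr (fun x : Fin k → V => χ ∘ x = f) ≤ pr (fun x : Fin k → V => ∀ i, A f i (x i)) := by
    intro f hf
    have e1 : pr (fun x : Fin k → V => χ ∘ x = f) = ∏ i, pr (fun v => χ v = f i) := by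
      rw [← pr_pi]; exact pr_congr fun x => funext_iff
    rw [e1, pr_pi]
    calc ρ^k * ∏ i, pr (fun v => χ v = f i) = ∏ i, ρ * pr (fun v => χ v = f i) := by
          rw [Finset.prod_mul_distrib]; simp
      _ ≤ _ := Finset.prod_le_prod (fun i _ => mul_nonneg hρ (pr_nonneg _)) fun i _ => (hA f hf).2.1 i
  have hsub : ∀ f, ¬ H f → ∀ x : Fin k → V, (∀ i, A f i (x i)) → χ ∘ x = f := fun f hf x hx =>
    funext fun i => (hA f hf).1 i _ (hx i)
  have s1 : pr (fun x => L (χ ∘ x)) + ρ^k * ε ≤ pr Z := by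
    have : pr (fun x => L (χ ∘ x)) + ρ^k * pr (fun x => ¬ L (χ ∘ x) ∧ ¬ H (χ ∘ x)) ≤ pr Z := by
      rw [pr_sum (fun x => χ ∘ x) Z, pr_sum (fun x => χ ∘ x) (fun x => L (χ ∘ x)),
        pr_sum (fun x => χ ∘ x) (fun x => ¬ L (χ ∘ x) ∧ ¬ H (χ ∘ x)), Finset.mul_sum, ← Finset.sum_add_distrib]
      refine Finset.sum_le_sum fun f _ => ?_
      by_cases h1 : L f
      · rw [pr_false (P := fun x => (¬ L (χ ∘ x) ∧ ¬ H (χ ∘ x)) ∧ χ ∘ x = f) (by rintro x ⟨⟨h, -⟩, rfl⟩; exact h h1), mul_zero, add_zero]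
        exact pr_mono fun x hx => ⟨(hZ x).2 (Or.inl hx.1), hx.2⟩
      · rw [pr_false (P := fun x => L (χ ∘ x) ∧ χ ∘ x = f) (by rintro x ⟨h, rfl⟩; exact h1 h), zero_add]
        by_cases h2 : H f
        · rw [pr_false (P := fun x => (¬ L (χ ∘ x) ∧ ¬ H (χ ∘ x)) ∧ χ ∘ x = f) (by rintro x ⟨⟨-, h⟩, rfl⟩; exact h h2), mul_zero]
          exact pr_nonneg _
        · refine le_trans ?_ ((hbox f h2).trans (pr_mono fun x hx => ?_))
          · gcongr; exact pr_mono fun x hx => hx.2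
          · have e := hsub f h2 x hx
            exact ⟨(hZ x).2 (Or.inr (by rw [e]; exact ⟨h1, h2, hx⟩)), e⟩
    have h2 : ρ^k * ε ≤ ρ^k * pr (fun x => ¬ L (χ ∘ x) ∧ ¬ H (χ ∘ x)) := by gcongr
    linarith
  have s2 : pr (fun x => S x ∧ Z x) ≤ κ^2 := by
    have h0 : κ^2 * pr (fun _ : Fin k → V => True) ≤ κ^2 := by
      nlinarith [pr_le_one (fun _ : Fin k → V => True), sq_nonneg κ]
    refine le_trans ?_ h0
    rw [pr_sum (fun x => χ ∘ x) (fun x => S x ∧ Z x), pr_sum (fun x : Fin k → V => χ ∘ x) (fun _ => True), Finset.mul_sum]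
    refine Finset.sum_le_sum fun f _ => ?_
    simp only [true_and]
    by_cases h1 : L f
    · exact (pr_mono fun x hx => ⟨hx.1.1, hx.2⟩).trans ((hL f).1 h1)
    · by_cases h2 : H f
      · rw [pr_false]; exact mul_nonneg (sq_nonneg _) (pr_nonneg _)
        rintro x ⟨⟨-, hz⟩, rfl⟩; rw [hZ] at hz; tauto
      · have h3 := (hA f h2).2.2.le
        refine le_trans (pr_mono ?_) (h3.trans (by gcongr; exact pr_mono (hsub f h2)))
        rintro x ⟨⟨hs, hz⟩, rfl⟩; rw [hZ] at hz
        refine ⟨hs, ?_⟩; tauto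
  have hZc : ∀ x y : Fin k → V, χ' ∘ x = χ' ∘ y → Z x → Z y := by
    intro x y h hx
    have e1 : χ ∘ x = χ ∘ y := funext fun i => congrArg Prod.fst (congrFun h i)
    have e2 : ∀ f i, A f i (x i) ↔ A f i (y i) := fun f i => by
      have := congrFun (congrFun (congrArg Prod.snd (congrFun h i)) f) i
      simpa [χ'] using this
    rw [hZ] at hx ⊢; rw [← e1]; simp only [e2] at hx; exact hx
  have s3 : κ * pr (fun x => Z x ∧ ¬ L' (χ' ∘ x)) ≤ pr (fun x => S x ∧ Z x) := by
    rw [pr_sum (fun x => χ' ∘ x) (fun x => S x ∧ Z x), pr_sum (fun x : Fin k → V => χ' ∘ x) (fun x => Z x ∧ ¬ L' (χ' ∘ x)), Finset.mul_sum]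
    refine Finset.sum_le_sum fun f _ => ?_
    by_cases h : ∃ x, (Z x ∧ ¬ L' (χ' ∘ x)) ∧ χ' ∘ x = f
    · obtain ⟨x, ⟨h1, h2⟩, rfl⟩ := h
      rw [hL', Low, not_le] at h2
      refine le_trans ?_ (h2.le.trans (pr_mono fun y hy => ⟨⟨hy.1, hZc x y hy.2.symm h1⟩, hy.2⟩))
      gcongr; exact pr_mono fun y hy => hy.2
    · push Not at h
      rw [pr_false (P := fun x => (Z x ∧ ¬ L' (χ' ∘ x)) ∧ χ' ∘ x = f) (fun x hx => h x hx.1 hx.2), mul_zero]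
      exact pr_nonneg _
  have s4 : pr Z ≤ pr (fun x => L' (χ' ∘ x)) + pr (fun x => Z x ∧ ¬ L' (χ' ∘ x)) := pr_or fun x hx => by tauto
  have s5 : pr (fun x => Z x ∧ ¬ L' (χ' ∘ x)) ≤ κ := by
    have := s3.trans s2
    rw [sq] at this; exact le_of_mul_le_mul_left this hκ
  linarith
end

lemma wreg (k : ℕ) {ρ ε : ℝ} (hρ : 0 < ρ) (hε : 0 < ε) (κs : ℝ) (hκs : 0 < κs) : ∃ (κ : ℝ) (M : ℕ), 0 < κ ∧
    ∀ (V : Type) [Fintype V] [DecidableEq V] (S : (Fin k → V) → Prop), ∃ (m : ℕ) (χ : V → Fin m) (κ' : ℝ), m ≤ M ∧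
      κ ≤ κ' ∧ κ' ≤ κs ∧ pr (fun x => ¬ Low S χ κ' (χ ∘ x) ∧ ¬ Her S χ ρ κ' (χ ∘ x)) ≤ ε := by
  classical
  obtain ⟨η, hη⟩ : ∃ η, η = ρ^k * ε / 2 := ⟨_, rfl⟩
  have hη0 : 0 < η := by rw [hη]; positivity
  have main : ∀ j : ℕ, ∀ κs : ℝ, 0 < κs → κs ≤ η → κs ≤ 1 → ∃ (κ : ℝ) (M : ℕ), 0 < κ ∧ κ ≤ κs ∧
      ∀ (V : Type) [Fintype V] [DecidableEq V] (S : (Fin k → V) → Prop), ∃ (C : Type) (_ : Fintype C) (χ : V → C), Fintype.card C ≤ M ∧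
      ((∃ κ', κ ≤ κ' ∧ κ' ≤ κs ∧ pr (fun x => ¬ Low S χ κ' (χ ∘ x) ∧ ¬ Her S χ ρ κ' (χ ∘ x)) ≤ ε) ∨
       j * η ≤ pr (fun x => Low S χ κs (χ ∘ x))) := by
    intro j
    induction j with
    | zero =>
      intro κs h0 _ _
      refine ⟨κs, 1, h0, le_rfl, fun V _ _ S => ⟨Unit, inferInstance, fun _ => (), by simp, Or.inr ?_⟩⟩
      simpa using pr_nonneg _
    | succ j ih =>
      intro κs h0 h1 h2
      have hsq : κs^2 ≤ κs := by nlinarith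
      obtain ⟨κ, M, k1, k2, k3⟩ := ih (κs^2) (by positivity) (hsq.trans h1) (hsq.trans h2)
      refine ⟨κ, M * 2 ^ (k * M ^ k) + M, k1, k2.trans hsq, fun V _ _ S => ?_⟩
      obtain ⟨C, _, χ, hC, h | h⟩ := k3 V S
      · obtain ⟨κ', g1, g2, g3⟩ := h
        exact ⟨C, inferInstance, χ, hC.trans (by omega), Or.inl ⟨κ', g1, g2.trans hsq, g3⟩⟩
      · by_cases hb : pr (fun x => ¬ Low S χ (κs^2) (χ ∘ x) ∧ ¬ Her S χ ρ (κs^2) (χ ∘ x)) ≤ ε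
        · exact ⟨C, inferInstance, χ, hC.trans (by omega), Or.inl ⟨κs^2, k2, hsq, hb⟩⟩
        · obtain ⟨χ', hχ⟩ := wref S χ hρ.le h0 (not_le.1 hb).le
          refine ⟨_, inferInstance, χ', ?_, Or.inr ?_⟩
          · simp only [Fintype.card_prod, Fintype.card_fun, Fintype.card_bool, Fintype.card_fin]
            rw [← pow_mul]
            calc Fintype.card C * 2 ^ (k * Fintype.card C ^ k) ≤ M * 2 ^ (k * M ^ k) := by gcongr; norm_num
              _ ≤ _ := by omega
          · push_cast; rw [hη] at h1 h ⊢; nlinarith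
  obtain ⟨j, hj⟩ := exists_nat_gt (1 / η)
  obtain ⟨κ, M, k1, k2, k3⟩ := main j (min κs (min η 1)) (by positivity) ((min_le_right _ _).trans (min_le_left _ _))
    ((min_le_right _ _).trans (min_le_right _ _))
  refine ⟨κ, M, k1, fun V _ _ S => ?_⟩
  obtain ⟨C, _, χ, hC, h⟩ := k3 V S
  rcases h with ⟨κ', g1, g2, g3⟩ | h
  · let e := Fintype.equivFin C
    refine ⟨Fintype.card C, fun v => e (χ v), κ', hC, g1, g2.trans (min_le_left _ _), le_trans (pr_mono fun x hx => ?_) g3⟩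
    have e1 : ∀ x y : Fin k → V, ((fun v => e (χ v)) ∘ y = (fun v => e (χ v)) ∘ x) ↔ χ ∘ y = χ ∘ x := by
      intro x y; simp [funext_iff]
    refine ⟨fun h => hx.1 ?_, fun h => hx.2 ?_⟩
    · unfold Low at h ⊢; simp only [e1]; exact h
    · unfold Her at h ⊢; simpa using h
  · exfalso
    have := h.trans (pr_le_one _)
    rw [div_lt_iff₀ hη0] at hj; linarith

section
variable {V : Type} [DecidableEq V] {r : ℕ}

def Pc (E : Finset (Finset V)) (Q : (Fin r → V) → Prop) (P : List V) : Prop :=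
  Tight E (r+1) P ∧ r ≤ P.length ∧ (∃ q, Q q ∧ P.take r = List.ofFn q) ∧ ∃ q, Q q ∧ lastR r P = List.ofFn q

lemma lastR_app {u v : List V} (h : v.length = r) : lastR r (u ++ v) = v := by
  unfold lastR; rw [List.length_append, h, Nat.add_sub_cancel, List.drop_left]

lemma take_app {u v : List V} (h : u.length = r) : (u ++ v).take r = u := by
  rw [← h, List.take_left]

lemma ofFn_tail (x : Fin (r+1) → V) : List.ofFn x = x 0 :: List.ofFn (Fin.tail x) := List.ofFn_succ

lemma blocks_tight {E : Finset (Finset V)} : ∀ X : List (Fin (r+1) → V), (∀ x ∈ X, ∀ y ∈ X, DD E x y) →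
    Tight E (r+1) (X.flatMap List.ofFn)
  | [], _ => Tight.short (by simp)
  | [x], h => Tight.infix (tight_pair (h x (by simp) x (by simp))) (by
      rw [List.flatMap_cons, List.flatMap_nil, List.append_nil]; exact (List.prefix_append _ _).isInfix)
  | x :: y :: X, h => by
    have h1 := blocks_tight (y :: X) fun a ha b hb => h a (List.mem_cons_of_mem _ ha) b (List.mem_cons_of_mem _ hb)
    have := Tight.glue (r := r) (by simp) (tight_pair (h x (by simp) y (by simp))) (by
      rw [List.flatMap_cons] at h1; exact h1)
    simpa only [List.flatMap_cons, List.append_assoc] using this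

lemma blocks_pc {E : Finset (Finset V)} {Q : (Fin r → V) → Prop} (X : List (Fin (r+1) → V)) (hX : X ≠ [])
    (h : ∀ x ∈ X, ∀ y ∈ X, DD E x y) (hQ : ∀ x ∈ X, Q (Fin.tail x)) :
    Pc E Q (X.flatMap List.ofFn).tail ∧ (X.flatMap List.ofFn).tail.length + 1 = (r+1) * X.length := by
  have hlen : (X.flatMap List.ofFn).length = (r+1) * X.length := by
    rw [List.length_flatMap]; simp [mul_comm]
  have hl0 : 0 < X.length := List.length_pos_iff.2 hX
  have hl1 : r + 1 ≤ (r+1) * X.length := Nat.le_mul_of_pos_right _ hl0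
  refine ⟨⟨(blocks_tight X h).infix (List.tail_suffix _).isInfix, by rw [List.length_tail, hlen]; omega, ?_, ?_⟩,
    by rw [List.length_tail, hlen]; omega⟩
  · obtain ⟨x, X', rfl⟩ := List.exists_cons_of_ne_nil hX
    refine ⟨Fin.tail x, hQ _ (by simp), ?_⟩
    rw [List.flatMap_cons, ofFn_tail, List.cons_append, List.tail_cons]
    exact take_app (by simp)
  · obtain ⟨Y, z, rfl⟩ : ∃ Y z, X = Y ++ [z] := ⟨_, _, (List.dropLast_append_getLast hX).symm⟩
    refine ⟨Fin.tail z, hQ _ (by simp), ?_⟩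
    have : (List.flatMap List.ofFn (Y ++ [z])).tail = (Y.flatMap List.ofFn ++ [z 0]).tail ++ List.ofFn (Fin.tail z) := by
      rw [← List.tail_append_of_ne_nil (by simp), List.flatMap_append]
      simp [List.flatMap_cons]; rfl
    rw [this]; exact lastR_app (by simp)

lemma copy_nodup {b : ℕ} {w : Fin b × Fin (r+1) → V} (hw : Function.Injective w) :
    ((List.ofFn fun t : Fin b => fun i => w (t, i)).flatMap List.ofFn).Nodup := by
  rw [List.nodup_flatMap]
  constructor
  · intro x hx
    rw [List.mem_ofFn] at hx; obtain ⟨t, rfl⟩ := hx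
    rw [List.nodup_ofFn]; intro i j hij; simpa using hw hij
  · rw [List.pairwise_ofFn]
    intro t t' htt' v hv hv'
    rw [List.mem_ofFn] at hv hv'
    obtain ⟨i, rfl⟩ := hv; obtain ⟨j, hj⟩ := hv'
    have := hw hj; simp at this; omega

lemma ed_inj {E : Finset (Finset V)} (hE : ∀ e ∈ E, e.card = r+1) {x : Fin (r+1) → V} (h : ed E x) : Function.Injective x := by
  have := hE _ h
  rw [← Set.injOn_univ, ← Finset.coe_univ, ← Finset.card_image_iff, this]; simp
end

lemma tile_J {V : Type} [Fintype V] [Nonempty V] [DecidableEq V] {k m : ℕ} {S : (Fin k → V) → Prop} {χ : V → Fin m} {κ' ρ ε τ κs : ℝ}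
    (hτ : 0 ≤ τ) (hκ : 0 ≤ κ') (h1 : pr (fun x => ¬ Low S χ κ' (χ ∘ x) ∧ ¬ Her S χ ρ κ' (χ ∘ x)) ≤ ε) (h2 : κ' ≤ κs) :
    pr (fun x => (¬ Low S χ κ' (χ ∘ x) ∧ ¬ Her S χ ρ κ' (χ ∘ x)) ∨ (S x ∧ Low S χ κ' (χ ∘ x)) ∨
      ∃ i, pr (fun v => χ v = χ (x i)) < τ) ≤ ε + (κs + k * (m * τ)) := by
  refine (pr_or fun x h => h).trans (add_le_add h1 ((pr_or fun x h => h).trans (add_le_add ?_ ?_)))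
  · have h0 : κ' * pr (fun _ : Fin k → V => True) ≤ κs := by
      nlinarith [pr_le_one (fun _ : Fin k → V => True)]
    refine le_trans ?_ h0
    rw [pr_sum (fun x : Fin k → V => χ ∘ x), pr_sum (fun x : Fin k → V => χ ∘ x) (fun _ => True), Finset.mul_sum]
    refine Finset.sum_le_sum fun f _ => ?_
    simp only [true_and]
    by_cases h : Low S χ κ' f
    · exact (pr_mono fun x hx => ⟨hx.1.1, hx.2⟩).trans h
    · rw [pr_false]; exact mul_nonneg hκ (pr_nonneg _)
      rintro x ⟨⟨-, h'⟩, rfl⟩; exact h h'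
  · refine (pr_exists (Q := fun (i : Fin k) (x : Fin k → V) => pr (fun v => χ v = χ (x i)) < τ) fun _ h => h).trans ?_
    have : ∀ i : Fin k, pr (fun x : Fin k → V => pr (fun v => χ v = χ (x i)) < τ) ≤ m * τ := by
      intro i
      rw [pr_coord i (fun u => pr (fun v => χ v = χ u) < τ), pr_sum χ]
      have : ∀ c ∈ (Finset.univ : Finset (Fin m)), pr (fun u => pr (fun v => χ v = χ u) < τ ∧ χ u = c) ≤ τ := by
        intro c _
        by_cases h : pr (fun v => χ v = c) < τ
        · exact (pr_mono fun x hx => hx.2).trans h.le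
        · rw [pr_false]; exact hτ
          rintro x ⟨h', rfl⟩; exact h h'
      simpa using Finset.sum_le_card_nsmul _ _ _ this
    simpa using Finset.sum_le_card_nsmul Finset.univ _ _ fun i _ => this i

lemma tile_load {V : Type} [Fintype V] [DecidableEq V] {k m : ℕ} (χ : V → Fin m) {ω : (Fin k → V) → ℝ} {A : Finset V}
    (h1 : ∀ x, ω x ≠ 0 → Function.Injective x ∧ ∀ i, x i ∉ A)
    (h2 : ∀ w, ∑ x, ω x * ind (∃ i, x i = w) ≤ 1) (c : Fin m) :
    ∑ f : Fin k → Fin m, (∑ x, ω x * ind (χ ∘ x = f)) * (∑ i, ind (f i = c)) ≤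
      ((Finset.univ.filter fun v => χ v = c ∧ v ∉ A).card : ℝ) := by
  have e1 : ∑ f : Fin k → Fin m, (∑ x, ω x * ind (χ ∘ x = f)) * (∑ i, ind (f i = c)) = ∑ x, ω x * ∑ i, ind (χ (x i) = c) := by
    simp only [Finset.sum_mul]
    rw [Finset.sum_comm]
    refine Finset.sum_congr rfl fun x _ => ?_
    rw [Finset.sum_eq_single (χ ∘ x)]
    · rw [ind_true rfl, mul_one]; rfl
    · intro f _ hf; rw [ind_false hf.symm]; simp
    · simp
  have e2 : ∀ x, ω x * ∑ i, ind (χ (x i) = c) = ∑ v ∈ Finset.univ.filter (fun v => χ v = c ∧ v ∉ A), ω x * ind (∃ i, x i = v) := by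
    intro x
    rw [← Finset.mul_sum]
    by_cases hx : ω x = 0
    · simp [hx]
    · congr 1
      have := (h1 x hx)
      have e3 : ∀ v, ind (∃ i, x i = v) = ∑ i, ind (x i = v) := by
        intro v
        by_cases h : ∃ i, x i = v
        · obtain ⟨i, rfl⟩ := h
          rw [ind_true ⟨i, rfl⟩, Finset.sum_eq_single i, ind_true rfl]
          · intro j _ hj; exact ind_false fun h => hj (this.1 h)
          · simp
        · rw [ind_false h, Finset.sum_eq_zero]; push Not at h; intro i _; exact ind_false (h i)
      simp only [e3]; rw [Finset.sum_comm]
      refine Finset.sum_congr rfl fun i _ => ?_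
      by_cases h : χ (x i) = c
      · rw [ind_true h, Finset.sum_eq_single (x i), ind_true rfl]
        · intro v _ hv; exact ind_false fun h => hv h.symm
        · intro h'; exact absurd (Finset.mem_filter.2 ⟨Finset.mem_univ _, h, this.2 i⟩) h'
      · rw [ind_false h, Finset.sum_eq_zero]
        intro v hv; refine ind_false ?_; rintro rfl; exact h (Finset.mem_filter.1 hv).2.1
  rw [e1]; simp only [e2]
  rw [Finset.sum_comm]
  refine (Finset.sum_le_card_nsmul _ _ 1 fun v _ => h2 v).trans ?_
  simp

/-- combinatorial core: maximal family of copies -/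
lemma tile_core {V : Type} [Fintype V] [Nonempty V] [DecidableEq V] {k m b : ℕ} (hk : 0 < k) (hb : 0 < b) {S : (Fin k → V) → Prop}
    (χ : V → Fin m) (A : Finset V) {W : (Fin k → Fin m) → ℝ} {ρ : ℝ} (hρ : 0 ≤ ρ) (hW : ∀ f, 0 ≤ W f)
    (hload : ∀ c, ∑ f, W f * ∑ i, ind (f i = c) ≤ ((Finset.univ.filter fun v => χ v = c ∧ v ∉ A).card : ℝ))
    (hext : ∀ f, 0 < W f → ∀ U : Finset V, (∀ i, ρ * pr (fun v => χ v = f i) ≤ pr (fun v => χ v = f i ∧ v ∉ U)) →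
      ∃ w : Fin b × Fin k → V, Function.Injective w ∧ (∀ a, w a ∉ U ∧ χ (w a) = f a.2) ∧ ∀ φ : Fin k → Fin b, S (fun i => w (φ i, i))) :
    ∃ F : Finset (Fin b × Fin k → V), (∀ w ∈ F, Function.Injective w ∧ (∀ a, w a ∉ A) ∧ ∀ φ : Fin k → Fin b, S (fun i => w (φ i, i))) ∧
      (∀ w ∈ F, ∀ w' ∈ F, w ≠ w' → ∀ a a', w a ≠ w' a') ∧ b * (F.card : ℝ) ≤ ∑ f, W f ∧
      ∑ f, W f ≤ b * F.card + b * m ^ k + ρ * Fintype.card V := by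
  classical
  let a0 : Fin b × Fin k := (⟨0, hb⟩, ⟨0, hk⟩)
  let Z := (Fin k → Fin m) × (Fin b × Fin k → V)
  obtain ⟨G, hG⟩ : ∃ G : Finset Z → Prop, ∀ F, G F ↔ ((∀ p ∈ F, Function.Injective p.2 ∧ (∀ a, p.2 a ∉ A ∧ χ (p.2 a) = p.1 a.2) ∧
      ∀ φ : Fin k → Fin b, S (fun i => p.2 (φ i, i))) ∧ (∀ p ∈ F, ∀ q ∈ F, p ≠ q → ∀ a a', p.2 a ≠ q.2 a') ∧
      ∀ f, b * ((F.filter fun p => p.1 = f).card : ℝ) ≤ W f) := ⟨_, fun _ => Iff.rfl⟩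
  obtain ⟨F, hF, hmax⟩ := Finset.exists_max_image (Finset.univ.filter G) Finset.card ⟨∅, by simp [hG, hW]⟩
  rw [Finset.mem_filter, hG] at hF
  obtain ⟨-, f1, f2, f3⟩ := hF
  let U : Finset V := A ∪ F.biUnion fun p => Finset.univ.image p.2
  have hUm : ∀ p ∈ F, ∀ a, p.2 a ∈ U := fun p hp a =>
    Finset.mem_union_right _ (Finset.mem_biUnion.2 ⟨p, hp, Finset.mem_image_of_mem _ (Finset.mem_univ _)⟩)
  have hcase : ∀ f, W f - b * ((F.filter fun p => p.1 = f).card : ℝ) ≤ b ∨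
      ∃ i, pr (fun v => χ v = f i ∧ v ∉ U) < ρ * pr (fun v => χ v = f i) := by
    intro f
    by_contra hcon
    push Not at hcon
    obtain ⟨g1, g2⟩ := hcon
    obtain ⟨w, w1, w2, w3⟩ := hext f (by
      have : (0:ℝ) ≤ b * ((F.filter fun p => p.1 = f).card : ℝ) := by positivity
      have : (0:ℝ) < b := by exact_mod_cast hb
      linarith) U g2
    have hnew : (f, w) ∉ F := fun h => (w2 a0).1 (hUm _ h a0)
    have : G (insert (f, w) F) := by
      rw [hG]
      refine ⟨?_, ?_, ?_⟩
      · intro p hp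
        rcases Finset.mem_insert.1 hp with rfl | hp
        · exact ⟨w1, fun a => ⟨fun h => (w2 a).1 (Finset.mem_union_left _ h), (w2 a).2⟩, w3⟩
        · exact f1 p hp
      · intro p hp q hq hpq a a' h
        rcases Finset.mem_insert.1 hp with rfl | hp <;> rcases Finset.mem_insert.1 hq with rfl | hq
        · exact hpq rfl
        · exact (w2 a).1 (by simp only at h; rw [h]; exact hUm q hq a')
        · exact (w2 a').1 (by simp only at h; rw [← h]; exact hUm p hp a)
        · exact f2 p hp q hq hpq a a' h
      · intro g
        rw [Finset.filter_insert]
        split_ifs with h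
        · simp only at h; subst h
          rw [Finset.card_insert_of_notMem (by simp [hnew])]; push_cast; linarith
        · exact f3 g
    have := hmax _ (Finset.mem_filter.2 ⟨Finset.mem_univ _, this⟩)
    rw [Finset.card_insert_of_notMem hnew] at this; omega
  let X : (Fin k → Fin m) → ℝ := fun f => ((F.filter fun p => p.1 = f).card : ℝ)
  have hXs : ∑ f, X f = F.card := by
    simp only [X]
    exact_mod_cast (Finset.card_eq_sum_card_fiberwise (f := fun p : Z => p.1) (t := Finset.univ) (by simp)).symm
  have hfull : ∀ c, pr (fun v => χ v = c ∧ v ∉ U) < ρ * pr (fun v => χ v = c) →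
      ∑ f, (W f - b * X f) * ∑ i, ind (f i = c) ≤ ρ * pr (fun v => χ v = c) * Fintype.card V := by
    intro c hc
    have h1 : ((Finset.univ.filter fun v => χ v = c ∧ v ∉ A).card : ℝ) ≤
        (Finset.univ.filter fun v => χ v = c ∧ v ∉ U).card + ∑ p ∈ F, ∑ a, ind (χ (p.2 a) = c) := by
      have : (Finset.univ.filter fun v => χ v = c ∧ v ∉ A) ⊆ (Finset.univ.filter fun v => χ v = c ∧ v ∉ U) ∪
          F.biUnion fun p => (Finset.univ.filter fun a => χ (p.2 a) = c).image p.2 := by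
        intro v hv
        rw [Finset.mem_filter] at hv
        by_cases hU : v ∈ U
        · refine Finset.mem_union_right _ ?_
          rcases Finset.mem_union.1 hU with h | h
          · exact absurd h hv.2.2
          · obtain ⟨p, hp, h⟩ := Finset.mem_biUnion.1 h
            obtain ⟨a, -, rfl⟩ := Finset.mem_image.1 h
            exact Finset.mem_biUnion.2 ⟨p, hp, Finset.mem_image_of_mem _ (by simp [hv.2.1])⟩
        · exact Finset.mem_union_left _ (by simp [hv.2.1, hU])
      have h2 := (Finset.card_le_card this).trans (Finset.card_union_le _ _)
      have h3 : (F.biUnion fun p => (Finset.univ.filter fun a => χ (p.2 a) = c).image p.2).card ≤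
          ∑ p ∈ F, (Finset.univ.filter fun a => χ (p.2 a) = c).card :=
        Finset.card_biUnion_le.trans (Finset.sum_le_sum fun p _ => Finset.card_image_le)
      have h4 : ∀ p : Z, ((Finset.univ.filter fun a => χ (p.2 a) = c).card : ℝ) = ∑ a, ind (χ (p.2 a) = c) := by
        intro p; rw [Finset.card_filter]; push_cast
        exact Finset.sum_congr rfl fun a _ => by unfold ind; congr
      simp only [← h4]
      exact_mod_cast h2.trans (Nat.add_le_add_left h3 _)
    have h2 : ∑ p ∈ F, ∑ a, ind (χ (p.2 a) = c) = ∑ f, b * X f * ∑ i, ind (f i = c) := by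
      have e1 : ∀ p ∈ F, ∑ a, ind (χ (p.2 a) = c) = b * ∑ i, ind (p.1 i = c) := by
        intro p hp
        rw [Fintype.sum_prod_type]
        simp only [((f1 p hp).2.1 _).2]
        simp
      rw [Finset.sum_congr rfl e1, ← Finset.sum_fiberwise_of_maps_to (g := fun p : Z => p.1) (t := Finset.univ) (by simp)]
      refine Finset.sum_congr rfl fun f _ => ?_
      rw [Finset.sum_congr rfl (g := fun _ => b * ∑ i, ind (f i = c)) (by
        intro p hp; rw [(Finset.mem_filter.1 hp).2])]
      simp only [Finset.sum_const, nsmul_eq_mul, X]; ring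
    have h3 : ((Finset.univ.filter fun v => χ v = c ∧ v ∉ U).card : ℝ) ≤ ρ * pr (fun v => χ v = c) * Fintype.card V := by
      rw [card_pr]; gcongr
    simp only [sub_mul, Finset.sum_sub_distrib]
    linarith [hload c]
  have hUX : ∀ f, W f - b * X f ≤ b + ∑ c, ind (pr (fun v => χ v = c ∧ v ∉ U) < ρ * pr (fun v => χ v = c)) *
      ((W f - b * X f) * ∑ i, ind (f i = c)) := by
    intro f
    have hnn : 0 ≤ W f - b * X f := by linarith [f3 f]
    have hnn2 : ∀ c, 0 ≤ ind (pr (fun v => χ v = c ∧ v ∉ U) < ρ * pr (fun v => χ v = c)) *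
      ((W f - b * X f) * ∑ i, ind (f i = c)) := fun c => mul_nonneg (ind_nonneg _) (mul_nonneg hnn (Finset.sum_nonneg fun i _ => ind_nonneg _))
    rcases hcase f with h | ⟨i, hi⟩
    · linarith [Finset.sum_nonneg fun c (_ : c ∈ Finset.univ) => hnn2 c]
    · have h1 := Finset.single_le_sum (fun c _ => hnn2 c) (Finset.mem_univ (f i))
      rw [ind_true hi, one_mul] at h1
      have h2 : (1:ℝ) ≤ ∑ j, ind (f j = f i) := by
        have := Finset.single_le_sum (f := fun j => ind (f j = f i)) (fun j _ => ind_nonneg _) (Finset.mem_univ i)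
        rwa [ind_true rfl] at this
      have h3 : (0:ℝ) ≤ b := Nat.cast_nonneg b
      nlinarith
  have htot : ∑ f, (W f - b * X f) ≤ b * m ^ k + ρ * Fintype.card V := by
    refine (Finset.sum_le_sum fun f _ => hUX f).trans ?_
    rw [Finset.sum_add_distrib]
    refine add_le_add (by simp [mul_comm]) ?_
    rw [Finset.sum_comm]
    have : ∀ c ∈ (Finset.univ : Finset (Fin m)), ∑ f, ind (pr (fun v => χ v = c ∧ v ∉ U) < ρ * pr (fun v => χ v = c)) *
      ((W f - b * X f) * ∑ i, ind (f i = c)) ≤ ρ * pr (fun v => χ v = c) * Fintype.card V := by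
      intro c _
      rw [← Finset.mul_sum]
      by_cases h : pr (fun v => χ v = c ∧ v ∉ U) < ρ * pr (fun v => χ v = c)
      · rw [ind_true h, one_mul]; exact hfull c h
      · rw [ind_false h, zero_mul]; exact mul_nonneg (mul_nonneg hρ (pr_nonneg _)) (Nat.cast_nonneg _)
    refine (Finset.sum_le_sum this).trans (le_of_eq ?_)
    rw [← Finset.sum_mul, ← Finset.mul_sum]
    have := pr_sum χ (fun _ => True)
    simp only [true_and] at this
    rw [← this, pr_true (fun _ => trivial), mul_one]
  rw [Finset.sum_sub_distrib, ← Finset.mul_sum, hXs] at htot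
  have hsum : b * (F.card : ℝ) ≤ ∑ f, W f := by
    rw [← hXs, Finset.mul_sum]; exact Finset.sum_le_sum fun f _ => f3 f
  have hinj : Set.InjOn (fun p : Z => p.2) F := by
    intro p hp q hq h
    by_contra hne
    exact f2 p hp q hq hne a0 a0 (congrFun h a0)
  refine ⟨F.image fun p => p.2, ?_, ?_, ?_, ?_⟩
  · intro w hw
    obtain ⟨p, hp, rfl⟩ := Finset.mem_image.1 hw
    exact ⟨(f1 p hp).1, fun a => ((f1 p hp).2.1 a).1, (f1 p hp).2.2⟩
  · intro w hw w' hw' hne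
    obtain ⟨p, hp, rfl⟩ := Finset.mem_image.1 hw
    obtain ⟨q, hq, rfl⟩ := Finset.mem_image.1 hw'
    exact f2 p hp q hq fun h => hne (by rw [h])
  · rw [Finset.card_image_of_injOn hinj]; exact hsum
  · rw [Finset.card_image_of_injOn hinj]; linarith

set_option maxHeartbeats 1000000 in
lemma tile (r : ℕ) (K c2 ζ η : ℝ) (hK : 0 < K) (hc2 : 0 < c2) (hζ : 0 < ζ) (hη : 0 < η) : ∃ n0 B : ℕ,
    ∀ (V : Type) [Fintype V] [DecidableEq V] (E : Finset (Finset V)) (Q : (Fin r → V) → Prop), n0 ≤ Fintype.card V →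
    (∀ e ∈ E, e.card = r+1) →
    ∀ A : Finset V, (∀ J : (Fin (r+1) → V) → Prop, pr J ≤ c2 → ∃ ω : (Fin (r+1) → V) → ℝ, (∀ x, 0 ≤ ω x) ∧
      (∀ x, ω x ≠ 0 → ed E x ∧ Q (Fin.tail x) ∧ ¬ J x ∧ ∀ i, x i ∉ A) ∧
      (∀ w, ∑ x, ω x * ind (∃ i, x i = w) ≤ 1) ∧
      (Fintype.card V : ℝ) - A.card - K * pr J * Fintype.card V ≤ (r+1) * ∑ x, ω x) →
    ∃ Ps : List (List V), Ps.flatten.Nodup ∧ (Ps.length : ℝ) ≤ η * Fintype.card V ∧ (∀ P ∈ Ps, Pc E Q P ∧ P.length % (r+1) = r ∧ P.length ≤ B) ∧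
      (∀ v ∈ Ps.flatten, v ∉ A) ∧ (Fintype.card V : ℝ) - A.card - ζ * Fintype.card V ≤ Ps.flatten.length := by
  classical
  obtain ⟨j, hj⟩ := pow_unbounded_of_one_lt (4 / ζ + 1 / η) (one_lt_two)
  set b : ℕ := 2 ^ j with hbd
  have hbp : 0 < b := by positivity
  have hb0 : (0:ℝ) < b := by exact_mod_cast hbp
  have hbR : 4 / ζ + 1 / η < (b:ℝ) := by rw [hbd]; push_cast; exact hj
  have hb1 : 1 ≤ ζ / 4 * b := by
    have : 4 / ζ ≤ b := by linarith [show 0 < 1 / η by positivity]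
    rw [div_le_iff₀ hζ] at this; linarith
  have hb2 : 1 ≤ η * b := by
    have : 1 / η ≤ b := by linarith [show 0 < 4 / ζ by positivity]
    rw [div_le_iff₀ hη] at this; linarith
  set ε := min (ζ / (12 * K)) (c2 / 3) with hε
  have hε0 : 0 < ε := by positivity
  set ρ := ζ / (4 * (r+1)) with hρ
  have hρ0 : 0 < ρ := by positivity
  obtain ⟨κ, M, hκ, hreg⟩ := wreg (r+1) hρ0 hε0 ε hε0
  set τ := ε / ((r+1) * (M+1)) with hτ
  have hτ0 : 0 < τ := by positivity
  obtain ⟨c, hc, hmul⟩ := multi (r+1) j (κ * (ρ * τ) ^ (r+1)) (by positivity)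
  refine ⟨max 1 (max (⌈((b:ℝ) * (r+1))^2 / c⌉₊ + 1) ⌈4 * (r+1) * (b * (M:ℝ)^(r+1)) / ζ⌉₊), (r+1) * b, ?_⟩
  intro V _ _ E Q hn hE A hω
  simp only [max_le_iff] at hn
  obtain ⟨n1, n2, n3⟩ := hn
  have hV : Nonempty V := Fintype.card_pos_iff.1 n1
  set n : ℝ := ((Fintype.card V : ℕ) : ℝ) with hnd
  have hn0 : 0 < n := by rw [hnd]; exact_mod_cast n1
  have n2' : ((b:ℝ) * (r+1))^2 / n < c := by
    have : ((b:ℝ) * (r+1))^2 / c < n := lt_of_le_of_lt (Nat.le_ceil _) (by rw [hnd]; exact_mod_cast n2)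
    rw [div_lt_iff₀ hc] at this; rw [div_lt_iff₀ hn0]; linarith
  have n3' : (r+1) * (b * (M:ℝ)^(r+1)) ≤ ζ / 4 * n := by
    have := Nat.ceil_le.1 n3; rw [div_le_iff₀ hζ] at this; linarith
  obtain ⟨S, hS⟩ : ∃ S : (Fin (r+1) → V) → Prop, ∀ x, S x ↔ ed E x ∧ Q (Fin.tail x) := ⟨_, fun _ => Iff.rfl⟩
  obtain ⟨m, χ, κ', m1, m2, m3, m4⟩ := hreg V S
  have hκ' : 0 < κ' := lt_of_lt_of_le hκ m2
  obtain ⟨J, hJ⟩ : ∃ J : (Fin (r+1) → V) → Prop, J = fun x => (¬ Low S χ κ' (χ ∘ x) ∧ ¬ Her S χ ρ κ' (χ ∘ x)) ∨ (S x ∧ Low S χ κ' (χ ∘ x)) ∨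
      ∃ i, pr (fun v => χ v = χ (x i)) < τ := ⟨_, rfl⟩
  have hJp : pr J ≤ 3 * ε := by
    rw [hJ]
    refine (tile_J hτ0.le hκ'.le m4 m3).trans ?_
    have : ((r+1 : ℕ) : ℝ) * (m * τ) ≤ (r+1) * ((M+1) * τ) := by
      push_cast; gcongr
      have : (m:ℝ) ≤ M := by exact_mod_cast m1
      linarith
    have e : ((r:ℝ)+1) * ((M+1) * τ) = ε := by rw [hτ]; field_simp
    linarith
  have hJ2 : 3 * ε ≤ c2 := by have := min_le_right (ζ / (12 * K)) (c2 / 3); rw [← hε] at this; linarith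
  have hJ3 : K * pr J ≤ ζ / 4 := by
    have h1 := min_le_left (ζ / (12 * K)) (c2 / 3); rw [← hε, le_div_iff₀ (by positivity)] at h1
    nlinarith
  obtain ⟨ω, w1, w2, w3, w4⟩ := hω J (hJp.trans hJ2)
  let W : (Fin (r+1) → Fin m) → ℝ := fun f => ∑ x, ω x * ind (χ ∘ x = f)
  have hW : ∀ f, 0 ≤ W f := fun f => Finset.sum_nonneg fun x _ => mul_nonneg (w1 x) (ind_nonneg _)
  have hWs : ∑ f, W f = ∑ x, ω x := by
    simp only [W]; rw [Finset.sum_comm]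
    refine Finset.sum_congr rfl fun x _ => ?_
    rw [Finset.sum_eq_single (χ ∘ x), ind_true rfl, mul_one]
    · intro f _ hf; rw [ind_false hf.symm, mul_zero]
    · simp
  have hext : ∀ f, 0 < W f → ∀ U : Finset V, (∀ i, ρ * pr (fun v => χ v = f i) ≤ pr (fun v => χ v = f i ∧ v ∉ U)) →
      ∃ w : Fin b × Fin (r+1) → V, Function.Injective w ∧ (∀ a, w a ∉ U ∧ χ (w a) = f a.2) ∧ ∀ φ : Fin (r+1) → Fin b, S (fun i => w (φ i, i)) := by
    intro f hf U hU
    obtain ⟨x, -, hx⟩ := Finset.exists_ne_zero_of_sum_ne_zero hf.ne'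
    have hx1 : ω x ≠ 0 := left_ne_zero_of_mul hx
    have hx2 : χ ∘ x = f := by by_contra h; rw [ind_false h, mul_zero] at hx; exact hx rfl
    obtain ⟨x3, x4, x5, x6⟩ := w2 x hx1
    have hSx : S x := (hS x).2 ⟨x3, x4⟩
    rw [hJ] at x5; simp only [hx2] at x5; push Not at x5
    obtain ⟨y1, y2, y3⟩ := x5
    have hher := y1 (y2 hSx)
    have h1 := hher (fun i v => χ v = f i ∧ v ∉ U) (fun i v h => h.1) hU
    have h2 : (ρ * τ) ^ (r+1) ≤ pr (fun x : Fin (r+1) → V => ∀ i, χ (x i) = f i ∧ x i ∉ U) := by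
      rw [pr_pi (fun i v => χ v = f i ∧ v ∉ U)]
      calc (ρ * τ) ^ (r+1) = ∏ _i : Fin (r+1), ρ * τ := by simp
        _ ≤ _ := Finset.prod_le_prod (fun _ _ => by positivity) fun i _ => ((mul_le_mul_of_nonneg_left (by
            have := y3 i; rw [← hx2]; exact this) hρ0.le).trans (hU i))
    have h3 : κ * (ρ * τ) ^ (r+1) ≤ pr (fun x => S x ∧ ∀ i, χ (x i) = f i ∧ x i ∉ U) := le_trans (by gcongr) h1
    have h4 := (hmul V _ h3).trans (avoid_pr _ ∅)
    obtain ⟨w, wa, wb, -⟩ := pr_pos (P := fun w : Fin b × Fin (r+1) → V => (∀ φ : Fin (r+1) → Fin b, S (fun i => w (φ i, i)) ∧ ∀ i, χ (w (φ i, i)) = f i ∧ w (φ i, i) ∉ U) ∧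
      Function.Injective w ∧ ∀ i, w i ∉ (∅ : Finset V)) (by
        simp only [Fintype.card_prod, Fintype.card_fin, Finset.card_empty, Nat.cast_zero, mul_zero, zero_add] at h4
        push_cast at h4 n2'
        rw [hbd] at n2'; push_cast at n2'
        linarith)
    exact ⟨w, wb, fun a => ⟨((wa fun _ => a.1).2 a.2).2, ((wa fun _ => a.1).2 a.2).1⟩, fun φ => (wa φ).1⟩
  obtain ⟨F, f1, f2, f3, f4⟩ := tile_core (Nat.succ_pos r) hbp χ A hρ0.le hW
    (tile_load χ (fun x hx => ⟨ed_inj hE (w2 x hx).1, (w2 x hx).2.2.2⟩) w3) hext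
  rw [hWs] at f3 f4
  have hωn : ∑ x, ω x ≤ n := by
    have : ∑ x, ω x ≤ ∑ w : V, ∑ x, ω x * ind (∃ i, x i = w) := by
      rw [Finset.sum_comm]
      refine Finset.sum_le_sum fun x _ => ?_
      have := Finset.single_le_sum (f := fun w => ω x * ind (∃ i, x i = w)) (fun w _ => mul_nonneg (w1 x) (ind_nonneg _)) (Finset.mem_univ (x 0))
      simp only [ind_true (⟨0, rfl⟩ : ∃ i, x i = x 0), mul_one] at this
      exact this
    refine this.trans ((Finset.sum_le_card_nsmul _ _ 1 fun w _ => w3 w).trans ?_)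
    simp [hnd]
  have hFn : b * (F.card : ℝ) ≤ n := f3.trans hωn
  let pt : (Fin b × Fin (r+1) → V) → List V := fun w => ((List.ofFn fun t : Fin b => fun i => w (t, i)).flatMap List.ofFn).tail
  have hmem : ∀ w v, v ∈ pt w → ∃ a, w a = v := by
    intro w v hv
    have := List.mem_of_mem_tail hv
    rw [List.mem_flatMap] at this
    obtain ⟨x, hx, hv⟩ := this
    rw [List.mem_ofFn] at hx; obtain ⟨t, rfl⟩ := hx
    rw [List.mem_ofFn] at hv; obtain ⟨i, rfl⟩ := hv
    exact ⟨_, rfl⟩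
  have hpc : ∀ w ∈ F, Pc E Q (pt w) ∧ (pt w).length + 1 = (r+1) * b := by
    intro w hw
    have h1 := (f1 w hw).2.2
    have h2 := blocks_pc (E := E) (Q := Q) (List.ofFn fun t : Fin b => fun i => w (t, i)) (by
      rw [← List.length_pos_iff]; simpa using hbp) (by
      intro x hx y hy s
      rw [List.mem_ofFn] at hx hy; obtain ⟨t, rfl⟩ := hx; obtain ⟨t', rfl⟩ := hy
      have := ((hS _).1 (h1 fun i => if s i then t' else t)).1
      convert this using 1
      ext i; simp only [mix]; split_ifs <;> rfl) (by
      intro x hx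
      rw [List.mem_ofFn] at hx; obtain ⟨t, rfl⟩ := hx
      exact ((hS _).1 (h1 fun _ => t)).2)
    rwa [List.length_ofFn] at h2
  refine ⟨F.toList.map pt, ?_, ?_, ?_, ?_, ?_⟩
  · rw [List.nodup_flatten]
    constructor
    · intro l hl
      obtain ⟨w, hw, rfl⟩ := List.mem_map.1 hl
      exact (copy_nodup (f1 w (Finset.mem_toList.1 hw)).1).sublist (List.tail_sublist _)
    · rw [List.pairwise_map]
      refine (Finset.nodup_toList F).imp_of_mem ?_
      intro w w' hw hw' hne v hv hv'
      obtain ⟨a, ha⟩ := hmem _ _ hv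
      obtain ⟨a', ha'⟩ := hmem _ _ hv'
      exact f2 w (Finset.mem_toList.1 hw) w' (Finset.mem_toList.1 hw') hne a a' (ha.trans ha'.symm)
  · rw [List.length_map, Finset.length_toList]
    nlinarith [show (0:ℝ) ≤ F.card from Nat.cast_nonneg _]
  · intro P hP
    obtain ⟨w, hw, rfl⟩ := List.mem_map.1 hP
    have h2 := (hpc w (Finset.mem_toList.1 hw)).2
    refine ⟨(hpc w (Finset.mem_toList.1 hw)).1, ?_, by omega⟩
    obtain ⟨b', hb'⟩ : ∃ b', b = b' + 1 := ⟨b - 1, by omega⟩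
    rw [hb', Nat.mul_succ] at h2
    have h3 : (pt w).length = r + (r+1) * b' := by omega
    rw [h3, Nat.add_mul_mod_self_left, Nat.mod_eq_of_lt (Nat.lt_succ_self r)]
  · intro v hv
    obtain ⟨l, hl, hv⟩ := List.mem_flatten.1 hv
    obtain ⟨w, hw, rfl⟩ := List.mem_map.1 hl
    obtain ⟨a, rfl⟩ := hmem _ _ hv
    exact (f1 w (Finset.mem_toList.1 hw)).2.1 a
  · have hlen : (F.toList.map pt).flatten.length + F.card = (r+1) * b * F.card := by
      rw [List.length_flatten, List.map_map]
      have : F.toList.map (List.length ∘ pt) = F.toList.map fun _ => (r+1) * b - 1 := by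
        refine List.map_congr_left fun w hw => ?_
        have := (hpc w (Finset.mem_toList.1 hw)).2
        simp only [Function.comp]; omega
      rw [this]
      simp only [List.map_const', List.sum_replicate, Finset.length_toList, smul_eq_mul]
      have : 1 ≤ (r+1) * b := Nat.mul_pos (Nat.succ_pos r) hbp
      obtain ⟨u, hu⟩ := Nat.exists_eq_add_of_le this
      rw [hu]; simp; ring
    have hlen' : ((F.toList.map pt).flatten.length : ℝ) + F.card = (r+1) * b * F.card := by exact_mod_cast hlen
    have g1 : (F.card : ℝ) ≤ ζ / 4 * n := by
      nlinarith [show (0:ℝ) ≤ F.card from Nat.cast_nonneg _]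
    have g2 : ((r:ℝ)+1) * (b * (m:ℝ)^(r+1)) ≤ ζ / 4 * n := by
      refine le_trans ?_ n3'; gcongr
    have g3 : ((r:ℝ)+1) * (ρ * n) = ζ / 4 * n := by rw [hρ]; field_simp
    have g4 : ((r:ℝ)+1) * ∑ x, ω x ≤ (r+1) * (b * F.card + b * m ^ (r+1) + ρ * n) := by gcongr
    have g5 : K * pr J * n ≤ ζ / 4 * n := by gcongr
    linarith

abbrev GI (r : ℕ) : Type := (Fin (2^2) × Fin (r+1)) ⊕ (Fin (r+1) × (Fin (2^1) × Fin r))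

section
variable {V : Type} {r : ℕ}

def gA (ω : GI r → V) : Option (Fin (r+1)) → Fin r → V
  | none => fun l => ω (Sum.inl (0, l.succ))
  | some i => fun l => ω (Sum.inr (i, (0, l)))

def gB (ω : GI r → V) : Option (Fin (r+1)) → Fin r → V
  | none => fun l => ω (Sum.inl (2, l.succ))
  | some i => fun l => ω (Sum.inr (i, (1, l)))

def gM (ω : GI r → V) : Option (Fin (r+1)) → V
  | none => ω (Sum.inl (2, 0))
  | some i => ω (Sum.inl (1, i))

def br (a b : Fin r → V) (m : List V) : List V := List.ofFn a ++ m ++ List.ofFn b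

def pas (ω : GI r → V) (o : Option (Fin (r+1))) : List V := br (gA ω o) (gB ω o) [gM ω o]

def actM (τ : Fin (r+1) → V) (ω : GI r → V) : Option (Fin (r+1)) → List V
  | none => List.ofFn (fun i : Fin (r+1) => ω (Sum.inl (1, i))) ++ [gM ω none]
  | some i => [τ i]

def act (τ : Fin (r+1) → V) (ω : GI r → V) (o : Option (Fin (r+1))) : List V := br (gA ω o) (gB ω o) (actM τ ω o)

lemma br_len (a b : Fin r → V) (m : List V) : (br a b m).length = 2 * r + m.length := by
  simp [br]; omega

lemma act_len (τ : Fin (r+1) → V) (ω : GI r → V) (o : Option (Fin (r+1))) :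
    (act τ ω o).length ≤ (pas ω o).length + if o = none then r+1 else 0 := by
  unfold act pas; rw [br_len, br_len]
  cases o <;> simp [actM] ; omega

lemma act_mem (τ : Fin (r+1) → V) (ω : GI r → V) (v : V) (h : (∃ o, v ∈ pas ω o) ∨ ∃ i, v = τ i) : ∃ o, v ∈ act τ ω o := by
  rcases h with ⟨o, h⟩ | ⟨i, rfl⟩
  · unfold pas br at h
    rw [List.mem_append, List.mem_append] at h
    rcases h with (h | h) | h
    · exact ⟨o, by unfold act br; simp only [List.mem_append]; tauto⟩
    · rw [List.mem_singleton] at h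
      refine ⟨none, ?_⟩
      unfold act br actM; simp only [List.mem_append]
      cases o with
      | none => simp [h]
      | some i => left; right; left; rw [List.mem_ofFn]; exact ⟨i, h.symm⟩
    · exact ⟨o, by unfold act br; simp only [List.mem_append]; tauto⟩
  · exact ⟨some i, by simp [act, br, actM]⟩

def tg : GI r → Option (Fin (r+1))
  | Sum.inl (t, i) => if t = 1 then some i else none
  | Sum.inr (i, _) => some i

lemma pas_tg {ω : GI r → V} {o : Option (Fin (r+1))} {v : V} (h : v ∈ pas ω o) : ∃ e, tg e = o ∧ ω e = v := by
  unfold pas br at h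
  simp only [List.mem_append, List.mem_ofFn, List.mem_singleton] at h
  cases o with
  | none =>
    rcases h with (⟨l, h⟩ | h) | ⟨l, h⟩
    · exact ⟨_, by simp [tg], h⟩
    · exact ⟨_, by simp [tg], h.symm⟩
    · exact ⟨_, by simp [tg], h⟩
  | some i =>
    rcases h with (⟨l, h⟩ | h) | ⟨l, h⟩
    · exact ⟨_, by simp [tg], h⟩
    · exact ⟨_, by simp [tg], h.symm⟩
    · exact ⟨_, by simp [tg], h⟩

lemma pas_nodup {ω : GI r → V} (hω : Function.Injective ω) (o : Option (Fin (r+1))) : (pas ω o).Nodup := by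
  have hb : ∀ (a b : Fin r → V) (m : V), Function.Injective a → Function.Injective b → (∀ i j, a i ≠ b j) →
      (∀ i, a i ≠ m) → (∀ i, b i ≠ m) → (br a b [m]).Nodup := by
    intro a b m ha hb h1 h2 h3
    unfold br
    rw [List.nodup_append, List.nodup_append]
    refine ⟨⟨List.nodup_ofFn.2 ha, by simp, ?_⟩, List.nodup_ofFn.2 hb, ?_⟩
    · intro x hx y hy; rw [List.mem_ofFn] at hx; obtain ⟨i, rfl⟩ := hx
      rw [List.mem_singleton] at hy; subst hy; exact h2 i
    · intro x hx y hy; rw [List.mem_ofFn] at hy; obtain ⟨j, rfl⟩ := hy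
      rw [List.mem_append, List.mem_ofFn, List.mem_singleton] at hx
      rcases hx with ⟨i, rfl⟩ | rfl
      · exact h1 i j
      · exact (h3 j).symm
  unfold pas
  cases o with
  | none =>
    apply hb
    · intro i j h; simpa using hω h
    · intro i j h; simpa using hω h
    · intro i j h; simpa using hω h
    · intro i h; simpa using hω h
    · intro i h; have := hω h; simp at this
  | some i =>
    apply hb
    · intro i j h; simpa using hω h
    · intro i j h; simpa using hω h
    · intro i j h; have := hω h; simp at this
    · intro i h; have := hω h; simp at this
    · intro i h; have := hω h; simp at this

lemma mix_cons (s : Fin (r+1) → Bool) (u : V) (a b : Fin r → V) :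
    mix s (Fin.cons u a : Fin (r+1) → V) (Fin.cons u b) = Fin.cons u (mix (Fin.tail s) a b) := by
  funext i; refine Fin.cases ?_ (fun i => ?_) i
  · simp [mix]
  · simp [mix, Fin.tail]; rfl

variable [DecidableEq V]

lemma br_take (a b : Fin r → V) (m : List V) : (br a b m).take r = List.ofFn a := by
  unfold br; rw [List.append_assoc]; exact take_app (by simp)

lemma br_last (a b : Fin r → V) (m : List V) : lastR r (br a b m) = List.ofFn b := lastR_app (by simp)


lemma br_pc {E : Finset (Finset V)} {Q : (Fin r → V) → Prop} {a b : Fin r → V} {m : List V} (ha : Q a) (hb : Q b)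
    (h : Tight E (r+1) (br a b m)) : Pc E Q (br a b m) :=
  ⟨h, by rw [br_len]; omega, ⟨a, ha, br_take _ _ _⟩, b, hb, br_last _ _ _⟩

lemma br_tight {E : Finset (Finset V)} {u : V} {a b : Fin r → V}
    (h : ∀ s, ed E (Fin.cons u (mix s a b) : Fin (r+1) → V)) : Tight E (r+1) (br a b [u]) := by
  have h1 : Tight E (r+1) (List.ofFn (Fin.cons u a : Fin (r+1) → V) ++ List.ofFn (Fin.cons u b : Fin (r+1) → V)) :=
    tight_pair fun s => by rw [mix_cons]; exact h _
  refine h1.infix ⟨[u], [], ?_⟩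
  simp [br, List.ofFn_cons]

def GR (E : Finset (Finset V)) (Q : (Fin r → V) → Prop) (τ : Fin (r+1) → V) (ω : GI r → V) : Prop :=
  (∀ φ : Fin (r+1) → Fin (2^2), ed E (fun i => ω (Sum.inl (φ i, i))) ∧ Q (Fin.tail fun i => ω (Sum.inl (φ i, i)))) ∧
  ∀ i, ∀ φ : Fin r → Fin (2^1), Q (fun l => ω (Sum.inr (i, (φ l, l)))) ∧
    ed E (Fin.cons (ω (Sum.inl (1, i))) (fun l => ω (Sum.inr (i, (φ l, l)))) : Fin (r+1) → V) ∧
    ed E (Fin.cons (τ i) (fun l => ω (Sum.inr (i, (φ l, l)))) : Fin (r+1) → V)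

lemma GR.spec {E : Finset (Finset V)} {Q : (Fin r → V) → Prop} {τ : Fin (r+1) → V} {ω : GI r → V} (h : GR E Q τ ω) :
    ∀ o, Pc E Q (pas ω o) ∧ Tight E (r+1) (act τ ω o) := by
  obtain ⟨h1, h2⟩ := h
  let B : Fin (2^2) → Fin (r+1) → V := fun t i => ω (Sum.inl (t, i))
  have hDD : ∀ t t', DD E (B t) (B t') := by
    intro t t' s
    have := (h1 fun i => if s i then t' else t).1
    convert this using 1
    funext i; simp only [mix, B]; split_ifs <;> rfl
  have hB : ∀ X : List (Fin (2^2)), Tight E (r+1) ((X.map B).flatMap List.ofFn) := by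
    intro X; apply blocks_tight
    intro x hx y hy
    obtain ⟨t, -, rfl⟩ := List.mem_map.1 hx; obtain ⟨t', -, rfl⟩ := List.mem_map.1 hy
    exact hDD _ _
  intro o
  cases o with
  | none =>
    refine ⟨br_pc (h1 fun _ => 0).2 (h1 fun _ => 2).2 ((hB [0, 2]).infix ⟨[B 0 0], [], ?_⟩), (hB [0, 1, 2]).infix ⟨[B 0 0], [], ?_⟩⟩
    · simp only [br, gA, gB, gM, B, List.map_cons, List.map_nil, List.flatMap_cons, List.flatMap_nil, List.append_nil, List.ofFn_succ (n := r)]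
      simp
    · simp only [act, actM, br, gA, gB, gM, B, List.map_cons, List.map_nil, List.flatMap_cons, List.flatMap_nil, List.append_nil, List.ofFn_succ (n := r)]
      simp
  | some i =>
    have hm : ∀ s, mix s (gA ω (some i)) (gB ω (some i)) = fun l => ω (Sum.inr (i, ((if s l then 1 else 0 : Fin (2^1)), l))) := by
      intro s; funext l; simp only [mix, gA, gB]; split_ifs <;> rfl
    refine ⟨br_pc (h2 i fun _ => 0).1 (h2 i fun _ => 1).1 (br_tight fun s => ?_), br_tight fun s => ?_⟩
    · rw [hm]; exact (h2 i _).2.1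
    · rw [hm]; exact (h2 i _).2.2
end

lemma gad_pr (r : ℕ) (c : ℝ) (hc : 0 < c) (hc1 : c ≤ 1) : ∃ p : ℝ, 0 < p ∧ ∀ (V : Type) [Fintype V] [DecidableEq V] [Nonempty V]
    (E : Finset (Finset V)) (Q : (Fin r → V) → Prop) (U : V → Prop), pr (fun v => ¬ U v) ≤ c / (4 * (r+1)) →
    (∀ u, U u → ∀ v, c ≤ pr (fun q : Fin r → V => Q q ∧ ed E (Fin.cons u q : Fin (r+1) → V) ∧ ed E (Fin.cons v q : Fin (r+1) → V))) →
    ∀ τ, p ≤ pr (fun ω : GI r → V => GR E Q τ ω) := by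
  obtain ⟨c', hc', h'⟩ := multi (r+1) 2 (c / 2) (by positivity)
  obtain ⟨c'', hc'', h''⟩ := multi r 1 c hc
  refine ⟨c'' ^ (r+1) * c', by positivity, ?_⟩
  intro V _ _ _ E Q U hU hl τ
  have e1 : c / (4 * (r+1)) ≤ 1/4 := by
    rw [div_le_div_iff₀ (by positivity) (by norm_num)]; nlinarith [(by positivity : (0:ℝ) ≤ r)]
  have hUp : 3/4 ≤ pr U := by rw [pr_not] at hU; linarith
  have a1 : c * pr U ≤ pr (fun x : Fin (r+1) → V => ed E x ∧ Q (Fin.tail x) ∧ U (x 0)) := by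
    rw [pr_cons]
    refine pr_prod_ge fun u hu => (hl u hu u).trans (pr_mono fun q hq => ?_)
    exact ⟨hq.2.1, by simpa using hq.1, by simpa using hu⟩
  have a2 : pr (fun x : Fin (r+1) → V => ∃ i, ¬ U (x i)) ≤ c / 4 := by
    refine (pr_exists (Q := fun (i : Fin (r+1)) (x : Fin (r+1) → V) => ¬ U (x i)) fun _ h => h).trans ?_
    have : ∀ i : Fin (r+1), pr (fun x : Fin (r+1) → V => ¬ U (x i)) ≤ c / (4 * (r+1)) := by
      intro i; rw [pr_coord i (fun v => ¬ U v)]; exact hU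
    refine (Finset.sum_le_card_nsmul Finset.univ _ _ fun i _ => this i).trans ?_
    simp; apply le_of_eq; field_simp
  have a3 : c / 2 ≤ pr (fun x : Fin (r+1) → V => ed E x ∧ Q (Fin.tail x) ∧ ∀ i, U (x i)) := by
    have := pr_or (P := fun x : Fin (r+1) → V => ed E x ∧ Q (Fin.tail x) ∧ U (x 0))
      (Q := fun x => ed E x ∧ Q (Fin.tail x) ∧ ∀ i, U (x i)) (R := fun x => ∃ i, ¬ U (x i)) (by
        intro x hx
        by_cases h : ∃ i, ¬ U (x i)
        · exact Or.inr h
        · push Not at h; exact Or.inl ⟨hx.1, hx.2.1, h⟩)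
    nlinarith
  have a4 := h' V _ a3
  rw [← pr_equiv (Equiv.sumArrowEquivProdArrow _ _ V).symm]
  refine le_trans (mul_le_mul_of_nonneg_left a4 (by positivity)) (pr_prod_ge fun w hw => ?_)
  rw [← pr_equiv (Equiv.curry (Fin (r+1)) (Fin (2^1) × Fin r) V).symm]
  have b1 : ∀ i : Fin (r+1), c'' ≤ pr (fun a : Fin (2^1) × Fin r → V => ∀ φ : Fin r → Fin (2^1), Q (fun l => a (φ l, l)) ∧
      ed E (Fin.cons (w (1, i)) (fun l => a (φ l, l)) : Fin (r+1) → V) ∧ ed E (Fin.cons (τ i) (fun l => a (φ l, l)) : Fin (r+1) → V)) :=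
    fun i => h'' V _ (hl (w (1, i)) ((hw fun _ => 1).2.2 i) (τ i))
  have b2 : c'' ^ (r+1) ≤ pr (fun a : Fin (r+1) → (Fin (2^1) × Fin r → V) => ∀ i, ∀ φ : Fin r → Fin (2^1), Q (fun l => a i (φ l, l)) ∧
      ed E (Fin.cons (w (1, i)) (fun l => a i (φ l, l)) : Fin (r+1) → V) ∧ ed E (Fin.cons (τ i) (fun l => a i (φ l, l)) : Fin (r+1) → V)) := by
    rw [pr_pi (fun (i : Fin (r+1)) (a : Fin (2^1) × Fin r → V) => ∀ φ : Fin r → Fin (2^1), Q (fun l => a (φ l, l)) ∧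
      ed E (Fin.cons (w (1, i)) (fun l => a (φ l, l)) : Fin (r+1) → V) ∧ ed E (Fin.cons (τ i) (fun l => a (φ l, l)) : Fin (r+1) → V))]
    calc c'' ^ (r+1) = ∏ _i : Fin (r+1), c'' := by simp
      _ ≤ _ := Finset.prod_le_prod (fun _ _ => hc''.le) fun i _ => b1 i
  refine b2.trans (pr_mono fun a ha => ⟨fun φ => ⟨(hw φ).1, (hw φ).2.1⟩, fun i φ => ha i φ⟩)

section
variable {V : Type} [DecidableEq V] {r : ℕ}

lemma Good.congr_c {ι : Type} {E : Finset (Finset V)} {P c c' : ι → List V} {z : List V} :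
    ∀ L : List ι, (∀ i ∈ L, c' i = c i) → Good E r P c z L → Good E r P c' z L
  | [], _, _ => trivial
  | i :: L, h, ⟨h1, h2, h3, h4⟩ =>
    ⟨h1, h2, by rw [h i (by simp)]; exact h3, Good.congr_c L (fun j hj => h j (by simp [hj])) h4⟩

/-- hitting property of a connector reservoir -/
def Res (E : Finset (Finset V)) (Q : (Fin r → V) → Prop) {s N : ℕ} (ω : Fin N → Fin s → V) (H : ℝ) : Prop :=
  ∀ q q', Q q → Q q' → ∃ idx : List (Fin s), idx.Nodup ∧ idx.length % (r+1) = 2 % (r+1) ∧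
    ∀ t : Finset (Fin N), (∀ j, Tight E (r+1) (List.ofFn q ++ idx.map (ω j) ++ List.ofFn q') → j ∈ t) → H ≤ t.card

lemma conn0 {ι : Type} [DecidableEq ι] {E : Finset (Finset V)} {Q : (Fin r → V) → Prop} {s N : ℕ} {ω : Fin N → Fin s → V} {H : ℝ}
    (hR : Res E Q ω H) (P : ι → List V) (z : List V) (hz : Pc E Q z) :
    ∀ L : List ι, L.Nodup → (∀ i ∈ L, Pc E Q (P i)) → (L.length : ℝ) ≤ H → ∃ (f : ι → Option (Fin N)) (c : ι → List V),
      Good E r P c z L ∧ (∀ i ∈ L, ∀ i' ∈ L, f i = f i' → i = i') ∧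
      ∀ i ∈ L, ∃ (j : Fin N) (idx : List (Fin s)), f i = some j ∧ idx.Nodup ∧ idx.length % (r+1) = 2 % (r+1) ∧ c i = idx.map (ω j)
  | [], _, _, _ => ⟨fun _ => none, fun _ => [], trivial, by simp, by simp⟩
  | i :: L, hn, hP, hl => by
    classical
    rw [List.nodup_cons] at hn
    have hl' : (L.length : ℝ) + 1 ≤ H := by simpa using hl
    obtain ⟨f, c, g1, g2, g3⟩ := conn0 hR P z hz L hn.2 (fun j hj => hP j (by simp [hj])) (by linarith)
    have hnx : Pc E Q (nextP P z L) := by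
      cases L with
      | nil => exact hz
      | cons a L => exact hP a (by simp)
    obtain ⟨p1, p2, -, q, hq, hq'⟩ := hP i (by simp)
    obtain ⟨-, -, ⟨q2, hq2, hq2'⟩, -⟩ := hnx
    obtain ⟨idx, i1, i2, i3⟩ := hR q q2 hq hq2
    let t : Finset (Fin N) := Finset.univ.filter fun j => Tight E (r+1) (List.ofFn q ++ idx.map (ω j) ++ List.ofFn q2)
    have ht := i3 t (fun j hj => Finset.mem_filter.2 ⟨Finset.mem_univ _, hj⟩)
    let u : Finset (Option (Fin N)) := (L.map f).toFinset
    obtain ⟨j, hj, hju⟩ : ∃ j ∈ t, some j ∉ u := by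
      by_contra hcon; push Not at hcon
      have h1 : (t.image some).card ≤ u.card := Finset.card_le_card fun x hx => by
        obtain ⟨j, hj, rfl⟩ := Finset.mem_image.1 hx; exact hcon j hj
      rw [Finset.card_image_of_injective _ (Option.some_injective _)] at h1
      have h2 : u.card ≤ L.length := by simpa using List.toFinset_card_le (L.map f)
      have h3 : (t.card : ℝ) ≤ L.length := by exact_mod_cast h1.trans h2
      linarith
    have hne : ∀ i' ∈ L, i' ≠ i := fun i' h h' => hn.1 (h' ▸ h)
    refine ⟨Function.update f i (some j), Function.update c i (idx.map (ω j)), ⟨p1, p2, ?_, ?_⟩, ?_, ?_⟩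
    · rw [Function.update_self, hq', hq2']; exact (Finset.mem_filter.1 hj).2
    · exact Good.congr_c L (fun i' hi' => Function.update_of_ne (hne i' hi') _ _) g1
    · have hx : ∀ i' ∈ L, f i' ≠ some j := fun i' hi' h => hju (by
        rw [List.mem_toFinset]; exact List.mem_map.2 ⟨i', hi', h⟩)
      intro a ha b hb hab
      rcases List.mem_cons.1 ha with ha1 | ha1 <;> rcases List.mem_cons.1 hb with hb1 | hb1
      · rw [ha1, hb1]
      · rw [ha1, Function.update_self, Function.update_of_ne (hne b hb1)] at hab; exact absurd hab.symm (hx b hb1)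
      · rw [hb1, Function.update_self, Function.update_of_ne (hne a ha1)] at hab; exact absurd hab (hx a ha1)
      · rw [Function.update_of_ne (hne a ha1), Function.update_of_ne (hne b hb1)] at hab; exact g2 a ha1 b hb1 hab
    · intro a ha
      rcases List.mem_cons.1 ha with rfl | ha
      · exact ⟨j, idx, Function.update_self _ _ _, i1, i2, Function.update_self _ _ _⟩
      · rw [Function.update_of_ne (hne a ha), Function.update_of_ne (hne a ha)]; exact g3 a ha

lemma conn {ι : Type} [DecidableEq ι] {E : Finset (Finset V)} {Q : (Fin r → V) → Prop} {s N : ℕ} {ω : Fin N → Fin s → V} {H : ℝ}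
    (hR : Res E Q ω H) (hω : Function.Injective fun p : Fin N × Fin s => ω p.1 p.2) (P : ι → List V) (z : List V) (hz : Pc E Q z)
    (L : List ι) (hL : L.Nodup) (hP : ∀ i ∈ L, Pc E Q (P i)) (hH : (L.length : ℝ) ≤ H) : ∃ c : ι → List V,
      Good E r P c z L ∧ (L.flatMap c).Nodup ∧ (∀ i ∈ L, (c i).length % (r+1) = 2 % (r+1) ∧ (c i).length ≤ s) ∧
      ∀ v ∈ L.flatMap c, ∃ j i, ω j i = v := by
  obtain ⟨f, c, h1, h2, h3⟩ := conn0 hR P z hz L hL hP hH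
  have hmem : ∀ i ∈ L, ∀ v ∈ c i, ∃ j e, f i = some j ∧ ω j e = v := by
    intro i hi v hv
    obtain ⟨j, idx, g1, g2, g3, g4⟩ := h3 i hi
    rw [g4] at hv; obtain ⟨e, -, rfl⟩ := List.mem_map.1 hv
    exact ⟨j, e, g1, rfl⟩
  refine ⟨c, h1, ?_, ?_, ?_⟩
  · rw [List.nodup_flatMap]
    constructor
    · intro i hi
      obtain ⟨j, idx, g1, g2, g3, g4⟩ := h3 i hi
      rw [g4]; refine List.Nodup.map (fun a b hab => ?_) g2
      simpa using hω (a₁ := (j, a)) (a₂ := (j, b)) hab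
    · refine hL.imp_of_mem ?_
      intro a b ha hb hab v hv hv'
      obtain ⟨j, e, g1, g2⟩ := hmem a ha v hv
      obtain ⟨j', e', g1', g2'⟩ := hmem b hb v hv'
      have := hω (a₁ := (j, e)) (a₂ := (j', e')) (g2.trans g2'.symm)
      simp only [Prod.mk.injEq] at this
      exact hab (h2 a ha b hb (by rw [g1, g1', this.1]))
  · intro i hi
    obtain ⟨j, idx, g1, g2, g3, g4⟩ := h3 i hi
    rw [g4, List.length_map]; exact ⟨g3, by simpa using g2.length_le_card⟩
  · intro v hv
    obtain ⟨i, hi, hv⟩ := List.mem_flatMap.1 hv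
    obtain ⟨j, e, -, g⟩ := hmem i hi v hv; exact ⟨j, e, g⟩

lemma path {ι : Type} {E : Finset (Finset V)} {P c : ι → List V} {z : List V} (hz : r ≤ z.length) (hzt : Tight E (r+1) z)
    (L : List ι) (h : Good E r P c z L) :
    Tight E (r+1) (L.flatMap (fun i => P i ++ c i) ++ z) ∧
      (L.flatMap (fun i => P i ++ c i) ++ z).take r = (nextP P z L).take r ∧
      lastR r (L.flatMap (fun i => P i ++ c i) ++ z) = lastR r z := by
  obtain ⟨h1, t, h2, h3⟩ := Good.tight hz L h
  have e : L.flatMap (fun i => P i ++ c i) ++ z = L.flatMap (fun i => P i ++ c i) ++ z.take r ++ z.drop r := by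
    rw [List.append_assoc, List.take_append_drop]
  refine ⟨?_, ?_, ?_⟩
  · rw [e]; exact Tight.glue (by simp [hz]) h1 (by rw [List.take_append_drop]; exact hzt)
  · rw [e, h2, List.append_assoc]; exact take_app (by simp [h3])
  · unfold lastR
    rw [List.length_append, Nat.add_sub_assoc hz, List.drop_append, List.drop_eq_nil_of_le (by omega), List.nil_append]
    congr 1; omega

lemma fm_nodup {ι : Type} {P c : ι → List V} {L : List ι} (h1 : (L.flatMap P).Nodup) (h2 : (L.flatMap c).Nodup)
    (h3 : ∀ v ∈ L.flatMap P, v ∉ L.flatMap c) : (L.flatMap fun i => P i ++ c i).Nodup := by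
  rw [← (List.flatMap_append_perm L P c).nodup_iff, List.nodup_append]
  exact ⟨h1, h2, fun a ha b hb hab => h3 a ha (hab ▸ hb)⟩
end

lemma mk_res (r s : ℕ) (c2 : ℝ) (hc2 : 0 < c2) : ∃ β0 : ℝ, 0 < β0 ∧ β0 ≤ 1 ∧ ∀ β : ℝ, 0 < β → β ≤ β0 → ∃ n0 : ℕ, ∀ (V : Type) [Fintype V] [DecidableEq V]
    (E : Finset (Finset V)) (Q : (Fin r → V) → Prop), n0 ≤ Fintype.card V → (∃ q, Q q) →
    (∀ q q', Q q → Q q' → ∃ idx : List (Fin s), idx.Nodup ∧ idx.length % (r+1) = 2 % (r+1) ∧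
    c2 ≤ pr (fun ω : Fin s → V => Tight E (r+1) (List.ofFn q ++ idx.map ω ++ List.ofFn q'))) →
    ∀ W : Finset V, (W.card : ℝ) ≤ β0 * Fintype.card V →
    ∃ (N : ℕ) (ω : Fin N → Fin s → V), β / 2 * Fintype.card V ≤ N ∧ (N : ℝ) ≤ β * Fintype.card V ∧
      (Function.Injective fun q : Fin N × Fin s => ω q.1 q.2) ∧ (∀ j i, ω j i ∉ W) ∧ Res E Q ω (c2 / 8 * N) := by
  classical
  obtain ⟨β0, h0, h1, h⟩ := sel s (2 * r) c2 hc2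
  refine ⟨β0, h0, h1, fun β hβ hβ0 => ?_⟩
  obtain ⟨n0, h⟩ := h β hβ hβ0
  refine ⟨n0, fun V _ _ E Q hn hQ hI W hW => ?_⟩
  let T : Type := {q // Q q} × {q // Q q}
  obtain ⟨q0, hq0⟩ := hQ
  haveI : Nonempty T := ⟨(⟨q0, hq0⟩, ⟨q0, hq0⟩)⟩
  have hI' : ∀ τ : T, ∃ idx : List (Fin s), idx.Nodup ∧ idx.length % (r+1) = 2 % (r+1) ∧
    c2 ≤ pr (fun ω : Fin s → V => Tight E (r+1) (List.ofFn τ.1.1 ++ idx.map ω ++ List.ofFn τ.2.1)) :=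
    fun τ => hI _ _ τ.1.2 τ.2.2
  choose idx i1 i2 i3 using hI'
  have hT : Fintype.card T ≤ Fintype.card V ^ (2 * r) := by
    rw [Fintype.card_prod, two_mul, pow_add]
    have : Fintype.card {q // Q q} ≤ Fintype.card V ^ r := by
      simpa using Fintype.card_subtype_le Q
    exact Nat.mul_le_mul this this
  obtain ⟨N, ω, g1, g2, g3, g4, g5⟩ := h V hn (Fin s) T (by simp) hT _ i3 W hW
  refine ⟨N, ω, g1, g2, g3, g4, fun q q' hq hq' => ⟨idx (⟨q, hq⟩, ⟨q', hq'⟩), i1 _, i2 _, fun t ht => g5 (⟨q, hq⟩, ⟨q', hq'⟩) t ht⟩⟩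

lemma abs_swap {V : Type} [DecidableEq V] {r M : ℕ} {E : Finset (Finset V)} {Q : (Fin r → V) → Prop} {G : Type} [Fintype G] [DecidableEq G]
    (ω : G → GI r → V) (hω : ∀ j o, Pc E Q (pas (ω j) o)) (i0 : G × Option (Fin (r+1))) (L : List (G × Option (Fin (r+1))))
    (hL : (i0 :: L).Nodup) (hm : ∀ p, p ∈ i0 :: L) (c : G × Option (Fin (r+1)) → List V)
    (hG : Good E r (fun p => pas (ω p.1) p.2) c (pas (ω i0.1) i0.2) L)
    (τ : Fin M → Fin (r+1) → V) (g : Fin M → G) (hgi : Function.Injective g) (hg : ∀ m, GR E Q (τ m) (ω (g m))) :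
    ∃ P' : List V, Tight E (r+1) P' ∧ r ≤ P'.length ∧
      P'.take r = (L.flatMap (fun p => pas (ω p.1) p.2 ++ c p) ++ pas (ω i0.1) i0.2).take r ∧
      lastR r P' = lastR r (L.flatMap (fun p => pas (ω p.1) p.2 ++ c p) ++ pas (ω i0.1) i0.2) ∧
      (∀ v, (v ∈ L.flatMap (fun p => pas (ω p.1) p.2 ++ c p) ++ pas (ω i0.1) i0.2) ∨ (∃ m i, v = τ m i) → v ∈ P') ∧
      P'.length ≤ (L.flatMap (fun p => pas (ω p.1) p.2 ++ c p) ++ pas (ω i0.1) i0.2).length + (r+1) * M := by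
  classical
  let P : G × Option (Fin (r+1)) → List V := fun p => pas (ω p.1) p.2
  let P' : G × Option (Fin (r+1)) → List V := fun p => if h : ∃ m, g m = p.1 then act (τ h.choose) (ω p.1) p.2 else pas (ω p.1) p.2
  have hP'1 : ∀ m o, P' (g m, o) = act (τ m) (ω (g m)) o := by
    intro m o
    have h : ∃ m', g m' = g m := ⟨m, rfl⟩
    have : P' (g m, o) = act (τ h.choose) (ω (g m)) o := dif_pos h
    rw [this, hgi h.choose_spec]
  have hP'2 : ∀ p : G × Option (Fin (r+1)), (¬ ∃ m, g m = p.1) → P' p = P p := fun p h => dif_neg h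
  have hspec : ∀ p, Tight E (r+1) (P' p) ∧ r ≤ (P' p).length ∧ (P' p).take r = (P p).take r ∧ lastR r (P' p) = lastR r (P p) := by
    rintro ⟨j, o⟩
    by_cases h : ∃ m, g m = j
    · obtain ⟨m, rfl⟩ := h
      rw [hP'1]
      refine ⟨((hg m).spec o).2, by unfold act; rw [br_len]; omega, ?_, ?_⟩
      · simp only [P]; unfold act pas; rw [br_take, br_take]
      · simp only [P]; unfold act pas; rw [br_last, br_last]
    · rw [hP'2 _ h]; exact ⟨(hω j o).1, (hω j o).2.1, rfl, rfl⟩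
  have hG' : Good E r P' c (P' i0) L := Good.congr (hspec i0).2.2.1 hspec L hG
  have hp := path (hω i0.1 i0.2).2.1 (hω i0.1 i0.2).1 L hG
  have hp' := path (hspec i0).2.1 (hspec i0).1 L hG'
  refine ⟨L.flatMap (fun i => P' i ++ c i) ++ P' i0, hp'.1, ?_, ?_, ?_, ?_, ?_⟩
  · rw [List.length_append]; have := (hspec i0).2.1; omega
  · rw [hp'.2.1, hp.2.1]
    cases L with
    | nil => exact (hspec i0).2.2.1
    | cons a L => exact (hspec a).2.2.1
  · rw [hp'.2.2, hp.2.2]; exact (hspec i0).2.2.2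
  · have key : ∀ p v, v ∈ P' p → v ∈ L.flatMap (fun i => P' i ++ c i) ++ P' i0 := by
      intro p v hv
      rw [List.mem_append, List.mem_flatMap]
      rcases List.mem_cons.1 (hm p) with h | h
      · right; rw [← h]; exact hv
      · left; exact ⟨p, h, List.mem_append_left _ hv⟩
    have key2 : ∀ p v, v ∈ P p → v ∈ L.flatMap (fun i => P' i ++ c i) ++ P' i0 := by
      rintro ⟨j, o⟩ v hv
      by_cases h : ∃ m, g m = j
      · obtain ⟨m, rfl⟩ := h
        obtain ⟨o', ho'⟩ := act_mem (τ m) (ω (g m)) v (Or.inl ⟨o, hv⟩)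
        exact key (g m, o') v (by rw [hP'1]; exact ho')
      · exact key (j, o) v (by rw [hP'2 _ h]; exact hv)
    rintro v (hv | ⟨m, i, hv⟩)
    · rw [List.mem_append, List.mem_flatMap] at hv
      rcases hv with ⟨p, hpL, hv⟩ | hv
      · rcases List.mem_append.1 hv with hv | hv
        · exact key2 p v hv
        · rw [List.mem_append, List.mem_flatMap]; left; exact ⟨p, hpL, List.mem_append_right _ hv⟩
      · exact key2 i0 v hv
    · obtain ⟨o', ho'⟩ := act_mem (τ m) (ω (g m)) v (Or.inr ⟨i, hv⟩)
      exact key (g m, o') v (by rw [hP'1]; exact ho')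
  · let e : G × Option (Fin (r+1)) → ℕ := fun p => if p.2 = none ∧ ∃ m, g m = p.1 then r+1 else 0
    have he : ∀ p, (P' p).length ≤ (P p).length + e p := by
      rintro ⟨j, o⟩
      by_cases h : ∃ m, g m = j
      · have e1 : e (j, o) = if o = none then r+1 else 0 := by simp [e, h]
        rw [e1]
        obtain ⟨m, rfl⟩ := h
        rw [hP'1]; exact act_len _ _ _
      · rw [hP'2 _ h]; omega
    have hs : ∀ L : List (G × Option (Fin (r+1))), (L.flatMap (fun i => P' i ++ c i)).length ≤ (L.flatMap (fun i => P i ++ c i)).length + (L.map e).sum := by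
      intro L
      induction L with
      | nil => simp
      | cons a L ih =>
        simp only [List.flatMap_cons, List.length_append, List.map_cons, List.sum_cons] at ih ⊢
        have := he a; omega
    have h1 := hs L
    have h2 := he i0
    have h3 : ((i0 :: L).map e).sum ≤ (r+1) * M := by
      rw [← List.sum_toFinset e hL]
      have : (i0 :: L).toFinset = Finset.univ := by
        ext p; simp only [List.mem_toFinset, Finset.mem_univ, iff_true]; exact hm p
      rw [this]
      simp only [e]
      rw [← Finset.sum_filter, Finset.sum_const, smul_eq_mul, mul_comm]
      refine Nat.mul_le_mul_left _ ?_
      have : (Finset.univ.filter fun p : G × Option (Fin (r+1)) => p.2 = none ∧ ∃ m, g m = p.1) ⊆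
          (Finset.univ : Finset (Fin M)).image fun m => (g m, none) := by
        rintro ⟨j, o⟩ hp
        obtain ⟨-, h, m, hm⟩ := Finset.mem_filter.1 hp
        simp only at h hm
        exact Finset.mem_image.2 ⟨m, Finset.mem_univ _, by rw [h, hm]⟩
      exact (Finset.card_le_card this).trans (Finset.card_image_le.trans (by simp))
    rw [List.map_cons, List.sum_cons] at h3
    rw [List.length_append, List.length_append]
    have h4 : (L.flatMap (fun p => pas (ω p.1) p.2 ++ c p)).length = (L.flatMap (fun i => P i ++ c i)).length := rfl
    have h5 : (pas (ω i0.1) i0.2).length = (P i0).length := rfl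
    omega

set_option maxHeartbeats 1000000 in
lemma absb (r s : ℕ) (c c2 θ : ℝ) (hc : 0 < c) (hc1 : c ≤ 1) (hc2 : 0 < c2) (hθ : 0 < θ) : ∃ κ : ℝ, 0 < κ ∧ ∃ n0 : ℕ,
    ∀ (V : Type) [Fintype V] [DecidableEq V] (E : Finset (Finset V)) (Q : (Fin r → V) → Prop), n0 ≤ Fintype.card V →
    (∀ q q', Q q → Q q' → ∃ idx : List (Fin s), idx.Nodup ∧ idx.length % (r+1) = 2 % (r+1) ∧
      c2 ≤ pr (fun ω : Fin s → V => Tight E (r+1) (List.ofFn q ++ idx.map ω ++ List.ofFn q'))) →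
    (∃ U : V → Prop, pr (fun v => ¬ U v) ≤ c / (4 * (r+1)) ∧ ∀ u, U u → ∀ v,
      c ≤ pr (fun q : Fin r → V => Q q ∧ ed E (Fin.cons u q : Fin (r+1) → V) ∧ ed E (Fin.cons v q : Fin (r+1) → V))) →
    ∃ P : List V, Pc E Q P ∧ P.Nodup ∧ (P.length : ℝ) ≤ θ * Fintype.card V ∧
      ∀ X : Finset V, (X.card : ℝ) ≤ κ * Fintype.card V → (r+1) ∣ X.card → ∃ P' : List V, Tight E (r+1) P' ∧ r ≤ P'.length ∧
        P'.take r = P.take r ∧ lastR r P' = lastR r P ∧ (∀ v, v ∈ P ∨ v ∈ X → v ∈ P') ∧ P'.length ≤ P.length + X.card := by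
  classical
  obtain ⟨p, hp, hgad⟩ := gad_pr r c hc hc1
  obtain ⟨βg, hβg, -, hsel⟩ := sel (Fintype.card (GI r)) (r+1) p hp
  obtain ⟨βc, hβc, -, hres⟩ := mk_res r s c2 hc2
  set g : ℝ := ((Fintype.card (GI r) : ℕ) : ℝ) with hg
  have hg0 : 0 ≤ g := by rw [hg]; positivity
  set β := min βg (min (βc / (g + 1)) (min (c2 * βc / (16 * (r+2))) (θ / (g + s * (r+2) + 1)))) with hβ
  have hβ0 : 0 < β := by simp only [hβ, lt_min_iff]; refine ⟨hβg, ?_, ?_, ?_⟩ <;> positivity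
  have b1 : β ≤ βg := min_le_left _ _
  have b2 : β * (g + 1) ≤ βc := by
    rw [← le_div_iff₀ (by positivity)]; exact (min_le_right _ _).trans (min_le_left _ _)
  have b3 : β * (16 * (r+2)) ≤ c2 * βc := by
    rw [← le_div_iff₀ (by positivity)]; exact (min_le_right _ _).trans ((min_le_right _ _).trans (min_le_left _ _))
  have b4 : β * (g + s * (r+2) + 1) ≤ θ := by
    rw [← le_div_iff₀ (by positivity)]; exact (min_le_right _ _).trans ((min_le_right _ _).trans (min_le_right _ _))
  obtain ⟨n1, hsel⟩ := hsel β hβ0 b1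
  obtain ⟨n2, hres⟩ := hres βc hβc le_rfl
  refine ⟨p * β / 16, by positivity, max 1 (max n1 n2), ?_⟩
  intro V _ _ E Q hn hI hU
  simp only [max_le_iff] at hn
  obtain ⟨m0, m1, m2⟩ := hn
  haveI : Nonempty V := Fintype.card_pos_iff.1 m0
  set n : ℝ := ((Fintype.card V : ℕ) : ℝ) with hnd
  have hn0 : 0 < n := by rw [hnd]; exact_mod_cast m0
  obtain ⟨U, hU1, hU2⟩ := hU
  have hgp := hgad V E Q U hU1 hU2
  obtain ⟨N, ω, s1, s2, s3, -, s5⟩ := hsel V m1 (GI r) (Fin (r+1) → V) rfl (by simp) _ hgp ∅ (by simp; positivity)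
  let G : Type := {j : Fin N // ∀ o, Pc E Q (pas (ω j) o)}
  let w : G → GI r → V := fun j => ω j.1
  have hw : ∀ j o, Pc E Q (pas (w j) o) := fun j o => j.2 o
  have hhit : ∀ τ, p / 8 * N ≤ ((Finset.univ.filter fun j : G => GR E Q τ (w j)).card : ℝ) := by
    intro τ
    have := s5 τ ((Finset.univ.filter fun j : G => GR E Q τ (w j)).image Subtype.val) (fun j hj => by
      refine Finset.mem_image.2 ⟨⟨j, fun o => (hj.spec o).1⟩, ?_, rfl⟩
      exact Finset.mem_filter.2 ⟨Finset.mem_univ _, hj⟩)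
    rwa [Finset.card_image_of_injective _ Subtype.val_injective] at this
  have hNp : 0 < p / 8 * N := by
    have : 0 < β / 2 * n := by positivity
    have : (0:ℝ) < N := by linarith
    positivity
  have hGN : (Fintype.card G : ℝ) ≤ N := by
    have := Fintype.card_subtype_le fun j : Fin N => ∀ o, Pc E Q (pas (ω j) o)
    rw [Fintype.card_fin] at this; exact_mod_cast this
  obtain ⟨j0⟩ : Nonempty G := by
    have h1 := hNp.trans_le (hhit (fun _ => Classical.arbitrary V))
    have h2 : 0 < (Finset.univ.filter fun j : G => GR E Q (fun _ => Classical.arbitrary V) (w j)).card := by exact_mod_cast h1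
    obtain ⟨j, -⟩ := Finset.card_pos.1 h2; exact ⟨j⟩
  let i0 : G × Option (Fin (r+1)) := (j0, none)
  let L := ((Finset.univ : Finset (G × Option (Fin (r+1)))).erase i0).toList
  have hL1 : (i0 :: L).Nodup := by
    rw [List.nodup_cons]; exact ⟨by simp [L], Finset.nodup_toList _⟩
  have hL2 : ∀ p, p ∈ i0 :: L := by
    intro p; rw [List.mem_cons]; by_cases h : p = i0
    · exact Or.inl h
    · right; simp [L, h]
  have hLl : (L.length : ℝ) ≤ N * (r+2) := by
    have h1 : L.length ≤ Fintype.card G * (r+2) := by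
      have : L.length ≤ Fintype.card (G × Option (Fin (r+1))) := by
        simp only [L, Finset.length_toList]; exact Finset.card_le_univ _
      simpa [Fintype.card_prod] using this
    have h2 : (L.length : ℝ) ≤ Fintype.card G * (r+2) := by exact_mod_cast h1
    refine h2.trans ?_; gcongr
  let W : Finset V := (Finset.univ : Finset (Fin N × GI r)).image fun q => ω q.1 q.2
  have hWc : (W.card : ℝ) ≤ g * (β * n) := by
    have h1 : W.card ≤ N * Fintype.card (GI r) := Finset.card_image_le.trans (by simp [Fintype.card_prod])
    have h2 : (W.card : ℝ) ≤ N * g := by rw [hg]; exact_mod_cast h1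
    nlinarith
  have hQ : ∃ q, Q q := by
    obtain ⟨-, -, ⟨q, hq, -⟩, -⟩ := hw j0 none; exact ⟨q, hq⟩
  obtain ⟨N', ω', r1, r2, r3, r4, r5⟩ := hres V E Q m2 hQ hI W (by nlinarith)
  have hLH : (L.length : ℝ) ≤ c2 / 8 * N' := by
    have h1 : (N:ℝ) * (r+2) ≤ β * n * (r+2) := by gcongr
    have h2 : c2 / 8 * (βc / 2 * n) ≤ c2 / 8 * N' := by gcongr
    have h3 : β * (16 * (r+2)) * n ≤ c2 * βc * n := by gcongr
    linarith
  obtain ⟨cc, q1, q2, q3, q4⟩ := conn r5 r3 (fun p : G × Option (Fin (r+1)) => pas (w p.1) p.2) (pas (w i0.1) i0.2) (hw _ _) L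
    (List.nodup_cons.1 hL1).2 (fun i _ => hw _ _) hLH
  have hpm : ∀ (p : G × Option (Fin (r+1))) v, v ∈ pas (w p.1) p.2 → ∃ e, tg e = p.2 ∧ ω p.1.1 e = v := fun p v hv => pas_tg hv
  have hpW : ∀ (p : G × Option (Fin (r+1))) v, v ∈ pas (w p.1) p.2 → v ∈ W := by
    intro p v hv; obtain ⟨e, -, he⟩ := hpm p v hv
    exact Finset.mem_image.2 ⟨(p.1.1, e), Finset.mem_univ _, he⟩
  have hnW : ∀ v, v ∈ L.flatMap cc → v ∉ W := by
    intro v hv; obtain ⟨j, i, rfl⟩ := q4 v hv; exact r4 j i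
  have hpd : ∀ p p' : G × Option (Fin (r+1)), p ≠ p' → ∀ v, v ∈ pas (w p.1) p.2 → v ∉ pas (w p'.1) p'.2 := by
    intro p p' hne v hv hv'
    obtain ⟨e, h1, h2⟩ := hpm p v hv
    obtain ⟨e', h1', h2'⟩ := hpm p' v hv'
    have := s3 (a₁ := (p.1.1, e)) (a₂ := (p'.1.1, e')) (h2.trans h2'.symm)
    simp only [Prod.mk.injEq] at this
    exact hne (Prod.ext (Subtype.ext this.1) (by rw [← h1, ← h1', this.2]))
  have hwi : ∀ j : G, Function.Injective (w j) := fun j a b hab => by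
    simpa using s3 (a₁ := (j.1, a)) (a₂ := (j.1, b)) hab
  have hnd1 : (L.flatMap fun p => pas (w p.1) p.2).Nodup := by
    rw [List.nodup_flatMap]
    exact ⟨fun p _ => pas_nodup (hwi _) _, (List.nodup_cons.1 hL1).2.imp fun {a b} hab v hv hv' => hpd a b hab v hv hv'⟩
  obtain ⟨A1, A2, A3⟩ := path (hw i0.1 i0.2).2.1 (hw i0.1 i0.2).1 L q1
  obtain ⟨PP, hPP⟩ : ∃ PP, PP = L.flatMap (fun p => pas (w p.1) p.2 ++ cc p) ++ pas (w i0.1) i0.2 := ⟨_, rfl⟩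
  rw [← hPP] at A1 A2 A3
  have hmemPP : ∀ v ∈ PP, v ∈ W ∨ v ∈ L.flatMap cc := by
    intro v hv
    rw [hPP, List.mem_append, List.mem_flatMap] at hv
    rcases hv with ⟨p, hpL, hv⟩ | hv
    · rcases List.mem_append.1 hv with hv | hv
      · exact Or.inl (hpW _ _ hv)
      · exact Or.inr (List.mem_flatMap.2 ⟨p, hpL, hv⟩)
    · exact Or.inl (hpW _ _ hv)
  have hnd : PP.Nodup := by
    rw [hPP, List.nodup_append]
    refine ⟨fm_nodup hnd1 q2 ?_, pas_nodup (hwi _) _, ?_⟩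
    · intro v hv hv'
      obtain ⟨p, -, hv⟩ := List.mem_flatMap.1 hv
      exact hnW v hv' (hpW _ _ hv)
    · rintro a ha b hb rfl
      obtain ⟨p, hpL, ha⟩ := List.mem_flatMap.1 ha
      rcases List.mem_append.1 ha with ha | ha
      · refine hpd p i0 ?_ a ha hb
        rintro rfl; exact (List.nodup_cons.1 hL1).1 hpL
      · exact hnW a (List.mem_flatMap.2 ⟨p, hpL, ha⟩) (hpW _ _ hb)
  refine ⟨PP, ⟨A1, ?_, ?_, ?_⟩, hnd, ?_, ?_⟩
  · rw [hPP, List.length_append]; have := (hw i0.1 i0.2).2.1; omega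
  · have : Pc E Q (nextP (fun p : G × Option (Fin (r+1)) => pas (w p.1) p.2) (pas (w i0.1) i0.2) L) := by
      cases L with
      | nil => exact hw _ _
      | cons a L => exact hw _ _
    obtain ⟨-, -, ⟨q, hq, hq'⟩, -⟩ := this
    exact ⟨q, hq, by rw [A2, hq']⟩
  · obtain ⟨-, -, -, q, hq, hq'⟩ := hw i0.1 i0.2
    exact ⟨q, hq, by rw [A3, hq']⟩
  · have h1 : PP.length = PP.toFinset.card := (List.toFinset_card_of_nodup hnd).symm
    have h2 : PP.toFinset ⊆ W ∪ (L.flatMap cc).toFinset := by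
      intro v hv; rw [List.mem_toFinset] at hv; rw [Finset.mem_union, List.mem_toFinset]; exact hmemPP v hv
    have h3 : (L.flatMap cc).length ≤ L.length * s := by
      rw [List.length_flatMap]
      refine (List.sum_le_card_nsmul _ s ?_).trans (by simp)
      intro x hx; obtain ⟨i, hi, rfl⟩ := List.mem_map.1 hx; exact (q3 i hi).2
    have h4 : PP.length ≤ W.card + L.length * s := by
      rw [h1]
      exact (Finset.card_le_card h2).trans ((Finset.card_union_le _ _).trans (Nat.add_le_add_left ((List.toFinset_card_le _).trans h3) _))
    have h5 : (PP.length : ℝ) ≤ W.card + L.length * s := by exact_mod_cast h4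
    have h6 : (L.length : ℝ) * s ≤ β * n * (r+2) * s := by
      gcongr; refine hLl.trans ?_; gcongr
    have h7 : β * (g + s * (r+2) + 1) * n ≤ θ * n := by gcongr
    have : 0 ≤ β * n := by positivity
    nlinarith
  · intro X hX hd
    obtain ⟨M, hM⟩ := hd
    have e : Fin M × Fin (r+1) ≃ X := by
      refine Fintype.equivOfCardEq ?_
      simp [hM, mul_comm]
    let τ : Fin M → Fin (r+1) → V := fun m i => (e (m, i)).1
    have hMc : (M : ℝ) ≤ p / 8 * N := by
      have h1 : M ≤ X.card := by rw [hM]; exact Nat.le_mul_of_pos_left _ (Nat.succ_pos r)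
      have h2 : (M:ℝ) ≤ X.card := by exact_mod_cast h1
      have h3 : p / 8 * (β / 2 * n) ≤ p / 8 * N := by gcongr
      linarith
    obtain ⟨gg, gi, gm⟩ := sdr (fun m : Fin M => Finset.univ.filter fun j : G => GR E Q (τ m) (w j)) (by
      intro m; rw [Fintype.card_fin]; exact_mod_cast hMc.trans (hhit (τ m)))
    obtain ⟨P', t1, t2, t3, t4, t5, t6⟩ := abs_swap w hw i0 L hL1 hL2 cc q1 τ gg gi (fun m => (Finset.mem_filter.1 (gm m)).2)
    rw [← hPP] at t3 t4 t5 t6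
    refine ⟨P', t1, t2, t3, t4, fun v hv => t5 v (hv.imp_right fun hx => ?_), by rw [hM]; exact t6⟩
    obtain ⟨⟨m, i⟩, hmi⟩ := e.surjective ⟨v, hx⟩
    exact ⟨m, i, by simp only [τ, hmi]⟩

lemma Good.congr2 {V : Type} [DecidableEq V] {ι : Type} {E : Finset (Finset V)} {r : ℕ} {P P' c : ι → List V} {z z' : List V}
    (hz : z'.take r = z.take r) :
    ∀ L : List ι, (∀ i ∈ L, Tight E (r+1) (P' i) ∧ r ≤ (P' i).length ∧
      (P' i).take r = (P i).take r ∧ lastR r (P' i) = lastR r (P i)) → Good E r P c z L → Good E r P' c z' L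
  | [], _, _ => trivial
  | i :: L, h, ⟨_, _, h3, h4⟩ => by
    have hi := h i (by simp)
    refine ⟨hi.1, hi.2.1, ?_, Good.congr2 hz L (fun j hj => h j (by simp [hj])) h4⟩
    have : (nextP P' z' L).take r = (nextP P z L).take r := by
      cases L with
      | nil => exact hz
      | cons j L => exact (h j (by simp)).2.2.1
    rw [this, hi.2.2.2]; exact h3

lemma len_mod {V : Type} {r : ℕ} (c : List V → List V) : ∀ L : List (List V),
    (∀ l ∈ L, l.length % (r+1) = r ∧ (c l).length % (r+1) = 2 % (r+1)) →
    (L.flatMap fun l => l ++ c l).length ≡ L.length [MOD (r+1)]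
  | [], _ => by simp; rfl
  | l :: L, h => by
    have ih := len_mod c L fun a ha => h a (by simp [ha])
    obtain ⟨h1, h2⟩ := h l (by simp)
    have e1 : l.length ≡ r [MOD (r+1)] := by
      unfold Nat.ModEq; rw [h1, Nat.mod_eq_of_lt (by omega)]
    have e2 : (c l).length ≡ 2 [MOD (r+1)] := h2
    have e3 : r + 2 ≡ 1 [MOD (r+1)] := by
      unfold Nat.ModEq; rw [show r + 2 = 1 + (r+1) by ring, Nat.add_mod_right]
    rw [List.flatMap_cons, List.length_append, List.length_append, List.length_cons]
    have := ((e1.add e2).trans e3).add ih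
    rwa [add_comm 1 L.length] at this

lemma len_ge {V : Type} (c : List V → List V) : ∀ L : List (List V),
    L.flatten.length ≤ (L.flatMap fun l => l ++ c l).length
  | [] => by simp
  | l :: L => by
    have ih := len_ge c L
    rw [List.flatMap_cons, List.flatten_cons, List.length_append, List.length_append, List.length_append]; omega

lemma len_le {V : Type} {B : ℕ} : ∀ L : List (List V), (∀ l ∈ L, l.length ≤ B) → L.flatten.length ≤ B * L.length
  | [], _ => by simp
  | l :: L, h => by
    have ih := len_le L fun a ha => h a (by simp [ha])
    have := h l (by simp)
    rw [List.flatten_cons, List.length_append, List.length_cons, Nat.mul_succ]; omega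

lemma fin_asm {V : Type} [Fintype V] [DecidableEq V] {r : ℕ} {E : Finset (Finset V)} (hn : r + 1 ≤ Fintype.card V)
    {PA PA' : List V} {Ps : List (List V)} {c : List V → List V} (hg : Good E r id c PA (PA :: Ps))
    (hnot : PA ∉ Ps) (hps : ∀ l ∈ Ps, Tight E (r+1) l ∧ r ≤ l.length)
    (h1 : Tight E (r+1) PA') (h2 : r ≤ PA'.length) (h3 : PA'.take r = PA.take r) (h4 : lastR r PA' = lastR r PA)
    (hcov : ∀ v, v ∈ PA ∨ v ∉ ((PA :: Ps).flatMap fun l => l ++ c l) → v ∈ PA')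
    (hlen : PA'.length + ((PA :: Ps).flatMap fun l => l ++ c l).length ≤ PA.length + Fintype.card V) :
    ∃ w : List V, w.Nodup ∧ w.toFinset = Finset.univ ∧ IsClosedTightWalk (r+1) E w := by
  let P' : List V → List V := fun l => if l = PA then PA' else l
  have hg' : Good E r P' c PA' (PA :: Ps) := by
    refine Good.congr2 h3 _ ?_ hg
    intro l hl
    by_cases hc : l = PA
    · subst hc; simp only [P', if_true, id]; exact ⟨h1, h2, h3, h4⟩
    · have hl' : l ∈ Ps := by simpa [hc] using hl
      have hP : P' l = l := if_neg hc
      rw [hP]; exact ⟨(hps l hl').1, (hps l hl').2, rfl, rfl⟩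
  have ht := (Good.tight h2 _ hg').1
  have hw : (PA :: Ps).flatMap (fun l => P' l ++ c l) = PA' ++ (c PA ++ Ps.flatMap fun l => l ++ c l) := by
    rw [List.flatMap_cons]
    have : Ps.flatMap (fun l => P' l ++ c l) = Ps.flatMap fun l => l ++ c l := by
      rw [List.flatMap_def, List.flatMap_def]; congr 1
      refine List.map_congr_left fun l hl => ?_
      have : l ≠ PA := fun h => hnot (h ▸ hl)
      simp only [P', if_neg this]
    rw [this]; simp only [P', if_true, List.append_assoc]
  rw [hw] at ht
  rw [List.flatMap_cons] at hcov hlen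
  set R := c PA ++ Ps.flatMap fun l => l ++ c l with hR
  have hlen' : (PA' ++ R).length ≤ Fintype.card V := by
    rw [hR]; simp only [List.length_append] at hlen ⊢; omega
  have huniv : (PA' ++ R).toFinset = Finset.univ := by
    ext v; simp only [List.mem_toFinset, Finset.mem_univ, iff_true, List.mem_append]
    by_cases hv : v ∈ PA'
    · exact Or.inl hv
    · right
      have := fun h => hv (hcov v h)
      obtain ⟨a, b⟩ := not_or.1 this
      have b := not_not.1 b
      rw [List.append_assoc, ← hR, List.mem_append] at b
      exact b.resolve_left a
  have hcard : Fintype.card V ≤ (PA' ++ R).length := by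
    rw [← Finset.card_univ, ← huniv]; exact List.toFinset_card_le _
  refine ⟨PA' ++ R, ?_, huniv, Tight.closed (by omega) ?_⟩
  · apply Multiset.coe_nodup.1
    rw [← Multiset.toFinset_card_eq_card_iff_nodup]
    have : (Multiset.toFinset (↑(PA' ++ R) : Multiset V)) = Finset.univ := huniv
    rw [this, Finset.card_univ, Multiset.coe_card]; omega
  · rwa [List.take_append_of_le_length h2]

set_option maxHeartbeats 1000000 in
lemma main2 (r : ℕ) (hr : 1 ≤ r) (c K c2 : ℝ) (s : ℕ) (hc : 0 < c) (hc1 : c ≤ 1) (hK : 0 < K) (hc2 : 0 < c2) : ∃ n0 : ℕ,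
    ∀ (V : Type) [Fintype V] [DecidableEq V] (E : Finset (Finset V)) (Q : (Fin r → V) → Prop), n0 ≤ Fintype.card V →
    (∀ e ∈ E, e.card = r+1) → Iface r c K c2 s E Q →
    ∃ w : List V, w.Nodup ∧ w.toFinset = Finset.univ ∧ IsClosedTightWalk (r+1) E w := by
  obtain ⟨β0, hβ0, -, hres⟩ := mk_res r s c2 hc2
  set θ := min (c2 / 2) (min β0 (1/4)) with hθ
  have hθ0 : 0 < θ := by positivity
  have t1 : θ ≤ c2 / 2 := min_le_left _ _
  have t2 : θ ≤ β0 := (min_le_right _ _).trans (min_le_left _ _)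
  have t3 : θ ≤ 1/4 := (min_le_right _ _).trans (min_le_right _ _)
  obtain ⟨κ, hκ, n1, habs⟩ := absb r s c c2 θ hc hc1 hc2 hθ0
  set β := min β0 (min (κ / (4 * (s+1))) (min (c2 / (2 * (s+1))) (1 / (4 * (s+1))))) with hβ
  have hβp : 0 < β := by positivity
  have b1 : β ≤ β0 := min_le_left _ _
  have b2 : β * (4 * (s+1)) ≤ κ := by
    rw [← le_div_iff₀ (by positivity)]; exact (min_le_right _ _).trans (min_le_left _ _)
  have b3 : β * (2 * (s+1)) ≤ c2 := by
    rw [← le_div_iff₀ (by positivity)]; exact (min_le_right _ _).trans ((min_le_right _ _).trans (min_le_left _ _))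
  have b4 : β * (4 * (s+1)) ≤ 1 := by
    rw [← le_div_iff₀ (by positivity)]; exact (min_le_right _ _).trans ((min_le_right _ _).trans (min_le_right _ _))
  obtain ⟨n2, hres⟩ := hres β hβp b1
  set η := c2 * β / 32 with hη
  have hηp : 0 < η := by positivity
  set ζ := min (κ / 4) (1/4) with hζ
  have hζp : 0 < ζ := by positivity
  have z1 : ζ ≤ κ / 4 := min_le_left _ _
  have z2 : ζ ≤ 1 / 4 := min_le_right _ _
  obtain ⟨n3, B, htile⟩ := tile r K c2 ζ η hK hc2 hζp hηp
  obtain ⟨n4, hn4⟩ := exists_nat_ge (1 / η)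
  obtain ⟨n5, hn5⟩ := exists_nat_ge (B * r / (κ / 4))
  refine ⟨max (r+1) (max n1 (max n2 (max n3 (max n4 (max n5 (4 * (B * r) + 1)))))), ?_⟩
  intro V _ _ E Q hn hE hI
  simp only [max_le_iff] at hn
  obtain ⟨m0, m1, m2, m3, m4, m5, m6⟩ := hn
  obtain ⟨I1, I2, I3⟩ := hI
  set n : ℝ := ((Fintype.card V : ℕ) : ℝ) with hnd
  have hn0 : 0 < n := by rw [hnd]; exact_mod_cast (by omega : 0 < Fintype.card V)
  have g4 : 1 ≤ η * n := by
    have : 1 / η ≤ n := hn4.trans (by rw [hnd]; exact_mod_cast m4)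
    rw [div_le_iff₀ hηp] at this; linarith
  have g5 : (B:ℝ) * r ≤ κ / 4 * n := by
    have : B * r / (κ / 4) ≤ n := hn5.trans (by rw [hnd]; exact_mod_cast m5)
    rw [div_le_iff₀ (by positivity)] at this; linarith
  have g6 : 4 * ((B:ℝ) * r) + 1 ≤ n := by rw [hnd]; exact_mod_cast m6
  obtain ⟨PA, a1, a2, a3, a4⟩ := habs V E Q m1 I1 I2
  have hPW : (PA.toFinset.card : ℝ) ≤ PA.length := by exact_mod_cast List.toFinset_card_le _
  obtain ⟨N, ω, w1, w2, w3, w4, w5⟩ := hres V E Q m2 (by obtain ⟨-, -, ⟨q, hq, -⟩, -⟩ := a1; exact ⟨q, hq⟩) I1 PA.toFinset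
    (hPW.trans (a3.trans (by gcongr)))
  set A : Finset V := PA.toFinset ∪ Finset.univ.image (fun q : Fin N × Fin s => ω q.1 q.2) with hA
  have hA1 : (A.card : ℝ) ≤ PA.length + s * N := by
    have h1 : A.card ≤ PA.toFinset.card + N * s := by
      refine (Finset.card_union_le _ _).trans (Nat.add_le_add_left (Finset.card_image_le.trans ?_) _)
      simp
    have h2 : (A.card : ℝ) ≤ PA.toFinset.card + N * s := by exact_mod_cast h1
    linarith
  have hsN : (s:ℝ) * N ≤ s * β * n := by
    rw [mul_assoc]; exact mul_le_mul_of_nonneg_left w2 (by positivity)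
  have e1 : (s:ℝ) * β * n ≤ κ / 4 * n := by
    apply mul_le_mul_of_nonneg_right _ hn0.le; nlinarith
  have e2 : (s:ℝ) * β * n ≤ c2 / 2 * n := by
    apply mul_le_mul_of_nonneg_right _ hn0.le; nlinarith
  have e3 : (s:ℝ) * β * n ≤ 1 / 4 * n := by
    apply mul_le_mul_of_nonneg_right _ hn0.le; nlinarith
  have e4 : θ * n ≤ c2 / 2 * n := mul_le_mul_of_nonneg_right t1 hn0.le
  have e5 : θ * n ≤ 1 / 4 * n := mul_le_mul_of_nonneg_right t3 hn0.le
  have e6 : ζ * n ≤ κ / 4 * n := mul_le_mul_of_nonneg_right z1 hn0.le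
  have e7 : ζ * n ≤ 1 / 4 * n := mul_le_mul_of_nonneg_right z2 hn0.le
  have hA2 : (A.card : ℝ) ≤ c2 * n := by linarith
  obtain ⟨Ps, p1, p2, p3, p4, p5⟩ := htile V E Q m3 hE A (I3 A hA2)
  have hPsl : Ps.flatten.length ≤ B * Ps.length := len_le Ps fun l hl => (p3 l hl).2.2
  have hPsl' : (Ps.flatten.length : ℝ) ≤ B * Ps.length := by exact_mod_cast hPsl
  have hrm : r ≤ Ps.length := by
    by_contra hcon; push Not at hcon
    have : (B:ℝ) * Ps.length ≤ B * r := mul_le_mul_of_nonneg_left (by exact_mod_cast hcon.le) (by positivity)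
    linarith
  set j := (PA.length + 2 + Ps.length + r * Fintype.card V) % (r+1) with hj
  have hjr : j ≤ r := Nat.lt_succ_iff.1 (Nat.mod_lt _ (by omega))
  set Ps' := Ps.drop j with hPs'
  have hsub : ∀ l ∈ Ps', l ∈ Ps := fun l hl => List.mem_of_mem_drop hl
  have hsp : Ps.flatten = (Ps.take j).flatten ++ Ps'.flatten := by
    rw [← List.flatten_append, List.take_append_drop]
  have hfl : Ps.flatten.length ≤ B * r + Ps'.flatten.length := by
    rw [hsp, List.length_append]
    have h1 := len_le (B := B) (Ps.take j) fun l hl => (p3 l (List.mem_of_mem_take hl)).2.2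
    have h2 : (Ps.take j).length ≤ r := (List.length_take_le _ _).trans hjr
    exact Nat.add_le_add_right (h1.trans (Nat.mul_le_mul_left _ h2)) _
  have hfl' : (Ps.flatten.length : ℝ) ≤ B * r + Ps'.flatten.length := by exact_mod_cast hfl
  have hnd' : Ps'.flatten.Nodup := by rw [hsp] at p1; exact (List.nodup_append.1 p1).2.1
  have hav : ∀ v ∈ Ps'.flatten, v ∉ A := fun v hv => p4 v (by rw [hsp]; exact List.mem_append_right _ hv)
  have hpos : ∀ l ∈ Ps', ∃ v, v ∈ l := by
    intro l hl
    have := (p3 l (hsub l hl)).1.2.1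
    exact List.exists_mem_of_length_pos (by omega)
  have hPAA : ∀ v ∈ PA, v ∈ A := fun v hv => Finset.mem_union_left _ (List.mem_toFinset.2 hv)
  have hnot : PA ∉ Ps' := by
    intro hin
    obtain ⟨v, hv⟩ := hpos _ hin
    exact hav v (List.mem_flatten.2 ⟨_, hin, hv⟩) (hPAA v hv)
  have hLnd : (PA :: Ps').Nodup := by
    rw [List.nodup_cons]; refine ⟨hnot, ?_⟩
    rw [List.nodup_flatten] at hnd'
    refine hnd'.2.imp_of_mem ?_
    intro a b ha hb hab hEq
    subst hEq
    obtain ⟨v, hv⟩ := hpos _ ha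
    exact hab hv hv
  have hLP : ∀ l ∈ PA :: Ps', Pc E Q (id l) := by
    intro l hl
    rcases List.mem_cons.1 hl with rfl | hl
    · exact a1
    · exact (p3 l (hsub l hl)).1
  have hLl : ((PA :: Ps').length : ℝ) ≤ c2 / 8 * N := by
    have h1 : (PA :: Ps').length ≤ Ps.length + 1 := by simp [hPs']
    have h2 : ((PA :: Ps').length : ℝ) ≤ Ps.length + 1 := by exact_mod_cast h1
    have h3 : c2 / 8 * (β / 2 * n) ≤ c2 / 8 * N := mul_le_mul_of_nonneg_left w1 (by positivity)
    have h4 : c2 / 8 * (β / 2 * n) = η * n + η * n := by rw [hη]; ring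
    linarith
  obtain ⟨cc, c1, c2', c3, c4⟩ := conn w5 w3 id PA a1 (PA :: Ps') hLnd hLP hLl
  have hW0 : ((PA :: Ps').flatMap fun l => l ++ cc l).Nodup := by
    refine fm_nodup (P := id) ?_ c2' ?_
    · rw [List.flatMap_id, List.flatten_cons, List.nodup_append]
      refine ⟨a2, hnd', ?_⟩
      rintro a ha b hb rfl
      exact hav a hb (hPAA a ha)
    · intro v hv hv'
      obtain ⟨jj, i, rfl⟩ := c4 v hv'
      rw [List.flatMap_id, List.flatten_cons, List.mem_append] at hv
      rcases hv with hv | hv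
      · exact w4 jj i (List.mem_toFinset.2 hv)
      · exact hav _ hv (Finset.mem_union_right _ (Finset.mem_image.2 ⟨(jj, i), Finset.mem_univ _, rfl⟩))
  set W0 := (PA :: Ps').flatMap fun l => l ++ cc l with hW0d
  have hWc : W0.toFinset.card = W0.length := List.toFinset_card_of_nodup hW0
  have hWn : W0.length ≤ Fintype.card V := by rw [← hWc]; exact Finset.card_le_univ _
  have hXc : (Finset.univ \ W0.toFinset).card + W0.length = Fintype.card V := by
    rw [← hWc, Finset.card_sdiff_add_card_eq_card (Finset.subset_univ _), Finset.card_univ]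
  have hWge : PA.length + Ps'.flatten.length ≤ W0.length := by
    have := len_ge cc (PA :: Ps')
    rw [List.flatten_cons, List.length_append] at this; exact this
  have hWge' : (PA.length : ℝ) + Ps'.flatten.length ≤ W0.length := by exact_mod_cast hWge
  have hXc' : ((Finset.univ \ W0.toFinset).card : ℝ) + W0.length = n := by rw [hnd]; exact_mod_cast hXc
  have hXs : ((Finset.univ \ W0.toFinset).card : ℝ) ≤ κ * n := by linarith
  have hdv : (r+1) ∣ (Finset.univ \ W0.toFinset).card := by
    have h1 : W0.length ≡ PA.length + 2 + Ps'.length [MOD (r+1)] := by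
      rw [hW0d, List.flatMap_cons, List.length_append, List.length_append]
      refine Nat.ModEq.add (Nat.ModEq.add_left _ ?_) (len_mod cc Ps' ?_)
      · exact (c3 PA (by simp)).1
      · exact fun l hl => ⟨(p3 l (hsub l hl)).2.1, (c3 l (by simp [hl])).1⟩
    have h2 : Ps'.length + j = Ps.length := by rw [hPs', List.length_drop]; omega
    have h3 : j ≡ PA.length + 2 + Ps.length + r * Fintype.card V [MOD (r+1)] := Nat.mod_modEq _ _
    have h4 : W0.length + j ≡ PA.length + 2 + Ps.length [MOD (r+1)] := by
      have := h1.add_right j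
      rwa [add_assoc, h2] at this
    have h5 : W0.length + (PA.length + 2 + Ps.length + r * Fintype.card V) ≡ PA.length + 2 + Ps.length [MOD (r+1)] :=
      (Nat.ModEq.add_left _ h3.symm).trans h4
    have h6 : (PA.length + 2 + Ps.length) + (W0.length + r * Fintype.card V) ≡ (PA.length + 2 + Ps.length) + 0 [MOD (r+1)] := by
      rw [add_zero]
      have e : (PA.length + 2 + Ps.length) + (W0.length + r * Fintype.card V) = W0.length + (PA.length + 2 + Ps.length + r * Fintype.card V) := by ring
      rw [e]; exact h5
    have h7 := Nat.ModEq.add_left_cancel' _ h6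
    have h8 : W0.length + r * Fintype.card V + (Finset.univ \ W0.toFinset).card = (r+1) * Fintype.card V := by
      rw [← hXc]; ring
    have h9 : (r+1) ∣ W0.length + r * Fintype.card V := (Nat.modEq_zero_iff_dvd).1 h7
    exact (Nat.dvd_add_right h9).1 (h8 ▸ dvd_mul_right _ _)
  obtain ⟨PA', q1, q2, q3, q4, q5, q6⟩ := a4 _ hXs hdv
  refine fin_asm m0 c1 hnot (fun l hl => ?_) q1 q2 q3 q4 (fun v hv => q5 v ?_) ?_
  · have := (p3 l (hsub l hl)).1; exact ⟨this.1, this.2.1⟩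
  · refine hv.imp id fun h => ?_
    rw [Finset.mem_sdiff, List.mem_toFinset]; exact ⟨Finset.mem_univ _, h⟩
  · rw [← hW0d]; omega

lemma main3 (r d : ℕ) (hd : 1 ≤ d) (hdr : d ≤ r) (δ : ℝ) (hδ : 0 < δ) (h : HamFrameworkProp (r+1) d δ)
    (μ : ℝ) (hμ : 0 < μ) : ∃ n0 : ℕ,
    ∀ (V : Type) [Fintype V] [DecidableEq V] (E : Finset (Finset V)), n0 ≤ Fintype.card V → (∀ e ∈ E, e.card = r+1) →
    (∀ S : Finset V, S.card = d → (δ + μ) * (((Fintype.card V - d).choose (r + 1 - d) : ℕ) : ℝ)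
          ≤ ((E.filter fun e => S ⊆ e).card : ℝ)) →
    ∃ w : List V, w.Nodup ∧ w.toFinset = Finset.univ ∧ IsClosedTightWalk (r+1) E w := by
  by_cases hδμ : δ + μ ≤ 1
  · obtain ⟨c, K, c2, s, n0, hc, hc1, hK, hc2, hI⟩ := iface r d hd hdr δ hδ h μ hμ hδμ
    obtain ⟨n1, hm⟩ := main2 r (hd.trans hdr) c K c2 s hc hc1 hK hc2
    refine ⟨max n0 n1, fun V _ _ E hn hE hdeg => ?_⟩
    obtain ⟨Q, hQ⟩ := hI V E ((le_max_left _ _).trans hn) hE hdeg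
    exact hm V E Q ((le_max_right _ _).trans hn) hE hQ
  · push Not at hδμ
    refine ⟨r + 1, fun V _ _ E hn hE hdeg => ?_⟩
    exfalso
    obtain ⟨S, -, hS⟩ := Finset.exists_subset_card_eq (s := (Finset.univ : Finset V)) (n := d) (by rw [Finset.card_univ]; omega)
    have h1 := hdeg S hS
    have h2 : (E.filter fun e => S ⊆ e).card ≤ (Fintype.card V - d).choose (r+1-d) := by
      have hc : (Finset.univ \ S).card = Fintype.card V - d := by
        rw [Finset.card_sdiff_of_subset (Finset.subset_univ _), Finset.card_univ, hS]
      rw [← hc, ← Finset.card_powersetCard]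
      refine Finset.card_le_card_of_injOn (fun e => e \ S) ?_ ?_
      · intro e he
        have he := Finset.mem_filter.1 he
        refine Finset.mem_coe.2 (Finset.mem_powersetCard.2 ⟨Finset.sdiff_subset_sdiff (Finset.subset_univ _) le_rfl, ?_⟩)
        rw [Finset.card_sdiff_of_subset he.2, hE e he.1, hS]
      · intro e he e' he' hee
        have he := Finset.mem_filter.1 he
        have he' := Finset.mem_filter.1 he'
        have hee : e \ S = e' \ S := hee
        rw [← Finset.sdiff_union_of_subset he.2, ← Finset.sdiff_union_of_subset he'.2, hee]
    have h3 : 0 < (Fintype.card V - d).choose (r+1-d) := Nat.choose_pos (by omega)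
    have h4 : ((E.filter fun e => S ⊆ e).card : ℝ) ≤ (((Fintype.card V - d).choose (r+1-d) : ℕ) : ℝ) := by exact_mod_cast h2
    have h5 : (0:ℝ) < (((Fintype.card V - d).choose (r+1-d) : ℕ) : ℝ) := by exact_mod_cast h3
    nlinarith

theorem framework_theorem (k d : ℕ) (hk : 2 ≤ k) (hd : 1 ≤ d) (hdk : d ≤ k - 1)
    (δ : ℝ) (hδ : 0 < δ) (h : HamFrameworkProp k d δ) :
    HamCycleProp k d δ := by
  obtain ⟨r, rfl⟩ : ∃ r, k = r + 1 := ⟨k - 1, by omega⟩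
  intro μ hμ
  obtain ⟨n0, hm⟩ := main3 r d hd (by omega) δ hδ h μ hμ
  refine ⟨n0, fun B _ V E hn hE hdeg => ?_⟩
  let f : {x // x ∈ V} ↪ B := ⟨Subtype.val, Subtype.val_injective⟩
  let E' : Finset (Finset {x // x ∈ V}) := Finset.univ.filter fun e => e.map f ∈ E
  have hE' : ∀ e, e ∈ E' ↔ e.map f ∈ E := fun e => by simp [E']
  have hsub : ∀ e ∈ E, ∃ e' ∈ E', e'.map f = e := by
    intro e he
    refine ⟨e.subtype (· ∈ V), ?_, ?_⟩
    · rw [hE']; convert he; exact Finset.subtype_map_of_mem (hE e he).1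
    · exact Finset.subtype_map_of_mem (hE e he).1
  obtain ⟨w, w1, w2, w3, w4⟩ := hm {x // x ∈ V} E' (by simpa using hn) (fun e he => by
      rw [← (hE _ ((hE' e).1 he)).2, Finset.card_map]) (by
    intro S hS
    have h1 := hdeg (S.map f) (by
      intro x hx; obtain ⟨y, -, rfl⟩ := Finset.mem_map.1 hx; exact y.2) (by rw [Finset.card_map, hS])
    rw [Fintype.card_coe]
    refine h1.trans ?_
    norm_cast
    refine (Finset.card_le_card ?_).trans (Finset.card_image_le (f := fun e => e.map f))
    intro e he
    obtain ⟨he1, he2⟩ := Finset.mem_filter.1 he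
    obtain ⟨e', he', rfl⟩ := hsub e he1
    exact Finset.mem_image.2 ⟨e', Finset.mem_filter.2 ⟨he', Finset.map_subset_map.1 he2⟩, rfl⟩)
  have hmap : ∀ l : List {x // x ∈ V}, (l.map f).toFinset = l.toFinset.map f := by
    intro l; ext x; simp
  refine ⟨w.map f, w1.map f.injective, ?_, by simpa using w3, ?_⟩
  · rw [hmap, w2]; ext x; simp [f]
  · intro i hi
    rw [List.length_map] at hi
    have := (hE' _).1 (w4 i hi)
    rwa [← List.map_rotate, ← List.map_take, hmap]
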